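/- Suppose K and L are simple polygons in the plane with aco K > −π and aco L > −π. Then the Minkowski sum K + L is a simple polygon and aco(K + L) ≥ min{aco K, aco L}. -/

import Mathlib

open Real Set Pointwise

noncomputable section

/-- The signed angle from `v` to `w`, in `(-π, π]`; for nonzero non-opposite
vectors it lies in `(-π, π)` and its sign is the sign of the skew product. -/
def vangle (v w : ℝ × ℝ) : ℝ :=
  Complex.arg ((w.1 + w.2 * Complex.I) / (v.1 + v.2 * Complex.I))

/-- `w` is opposite to `v` : `w = a • v` with `a < 0`. -/
def Opp (v w : ℝ × ℝ) : Prop := ∃ a : ℝ, a < 0 ∧ w = a • v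

/-- A shift sequence is non-reverse if no two consecutive shifts are opposite. -/
def NonReverse (s : List (ℝ × ℝ)) : Prop := List.Chain' (fun v w => ¬ Opp v w) s

/-- The rotation of a polyline with the given shift sequence:
the sum of the signed angles between consecutive shifts. -/
def rotShifts : List (ℝ × ℝ) → ℝ
  | v :: w :: rest => vangle v w + rotShifts (w :: rest)
  | _ => 0

/-- The angular convexity of a polyline with shift sequence `s` :
the minimum of the rotations of its contiguous subpolylines. -/
def acoShifts (s : List (ℝ × ℝ)) : ℝ :=
  sInf (rotShifts '' { t : List (ℝ × ℝ) | t <:+: s })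

/-- The (cyclic) rotation of a closed polyline with shift sequence `s`. -/
def rotClosed (s : List (ℝ × ℝ)) : ℝ := rotShifts (s ++ s.take 1)

/-- The angular convexity of a closed polyline with shift sequence `s` :
the minimum of the rotations over all (possibly wrapping) contiguous
subpolylines traversing the cycle at most once, oriented along it. -/
def acoClosed (s : List (ℝ × ℝ)) : ℝ :=
  sInf (rotShifts '' { t : List (ℝ × ℝ) | t.length ≤ s.length ∧ t <:+: (s ++ s) })

/-- A polyline, given by its first vertex and its shift sequence. -/
structure Polyline where
  start : ℝ × ℝ
  shifts : List (ℝ × ℝ)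

namespace Polyline

/-- A genuine polyline: at least one edge and consecutive vertices distinct. -/
def Proper (P : Polyline) : Prop := P.shifts ≠ [] ∧ ∀ v ∈ P.shifts, v ≠ 0

/-- The `i`-th vertex (`0`-indexed). -/
def vert (P : Polyline) (i : ℕ) : ℝ × ℝ := P.start + (P.shifts.take i).sum

/-- The natural piecewise-linear parameterization of `P` on `[0, number of edges]`. -/
def param (P : Polyline) (t : ℝ) : ℝ × ℝ :=
  P.vert ⌊t⌋.toNat + Int.fract t • P.shifts.getD ⌊t⌋.toNat 0

/-- The polyline as a subset of the plane. -/
def trace (P : Polyline) : Set (ℝ × ℝ) := P.param '' Set.Icc 0 (P.shifts.length : ℝ)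

/-- A closed polyline: the last vertex equals the first one. -/
def Closed (P : Polyline) : Prop := P.shifts.sum = 0

/-- A simple (open) polyline: edges may intersect only at a common vertex of
consecutive edges, i.e. the natural parameterization is injective. -/
def Simple (P : Polyline) : Prop := Set.InjOn P.param (Set.Icc 0 (P.shifts.length : ℝ))

/-- A simple closed polyline: closed and injective except for first = last point. -/
def SimpleClosed (P : Polyline) : Prop :=
  P.Closed ∧ Set.InjOn P.param (Set.Ico 0 (P.shifts.length : ℝ))

/-- The `i`-th edge as a segment in the plane. -/
def edge (P : Polyline) (i : ℕ) : Set (ℝ × ℝ) := segment ℝ (P.vert i) (P.vert (i + 1))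

/-- A polyline is in general position if all vertices are distinct, two edges meet
in at most one point which is either the common vertex of consecutive edges or lies
in the relative interiors of both, and no three edges have a common point. -/
def GeneralPosition (P : Polyline) : Prop :=
  (∀ i j, i < j → j ≤ P.shifts.length → P.vert i ≠ P.vert j) ∧
  (∀ i j, i < j → j < P.shifts.length →
    (P.edge i ∩ P.edge j).Subsingleton ∧
    ∀ x ∈ P.edge i ∩ P.edge j,
      (j = i + 1 ∧ x = P.vert j) ∨
      (x ∈ openSegment ℝ (P.vert i) (P.vert (i + 1)) ∧
        x ∈ openSegment ℝ (P.vert j) (P.vert (j + 1)))) ∧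
  ∀ i j k, i < j → j < k → k < P.shifts.length →
    P.edge i ∩ P.edge j ∩ P.edge k = ∅

end Polyline

/-- `P` is the (anticlockwise-oriented) closed simple boundary polyline of the
simple polygon `K`. -/
structure IsSimplePolygon (K : Set (ℝ × ℝ)) (P : Polyline) : Prop where
  compact : IsCompact K
  regular : K = closure (interior K)
  proper : P.Proper
  nonReverse : NonReverse (P.shifts ++ P.shifts.take 1)
  simpleClosed : P.SimpleClosed
  boundary : frontier K = P.trace
  orient : rotClosed P.shifts = 2 * π

/-- The ray with apex `x` and direction `d`. -/
def ray (x d : ℝ × ℝ) : Set (ℝ × ℝ) := {y | ∃ t : ℝ, 0 ≤ t ∧ y = x + t • d}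

/-- The angular region with apex `x` spanned by the directions `u` and `v` :
the convex hull of the two rays. Its angular measure is `|vangle u v|`. -/
def angularRegion (x u v : ℝ × ℝ) : Set (ℝ × ℝ) :=
  convexHull ℝ (ray x u ∪ ray x v)

/-- The merge of two shift sequences used in the sorted sum: repeatedly take the
head of the remaining sequence with the larger rotation (preferring the first). -/
def sortedMerge : List (ℝ × ℝ) → List (ℝ × ℝ) → List (ℝ × ℝ)
  | [], t => t
  | s, [] => s
  | a :: s, b :: t =>
    if rotShifts (b :: t) ≤ rotShifts (a :: s) then a :: sortedMerge s (b :: t)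
    else b :: sortedMerge (a :: s) t
termination_by s t => s.length + t.length

/-- The hypotheses of the sorted sum: both polylines are proper and non-reverse,
their first shifts have the same direction, and their rotations are equal. -/
def SortedSumHyp (P Q : Polyline) : Prop :=
  P.Proper ∧ Q.Proper ∧ NonReverse P.shifts ∧ NonReverse Q.shifts ∧
  vangle P.shifts.headI Q.shifts.headI = 0 ∧
  rotShifts P.shifts = rotShifts Q.shifts

/-- The sorted sum `P +ₛ Q` : starts at the sum of the first vertices and has the
merged shift sequence. -/
def sortedSum (P Q : Polyline) : Polyline :=
  ⟨P.start + Q.start, sortedMerge P.shifts Q.shifts⟩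

section
set_option linter.all false
namespace MS

def cis (θ : ℝ) : ℂ := Complex.exp (θ * Complex.I)

lemma cis_add (a b : ℝ) : cis (a + b) = cis a * cis b := by
  simp [cis, add_mul, Complex.exp_add]

lemma cis_zero : cis 0 = 1 := by simp [cis]

lemma cis_pi : cis π = -1 := by simp [cis, Complex.exp_pi_mul_I]

lemma cis_ne (a : ℝ) : cis a ≠ 0 := Complex.exp_ne_zero _

lemma cis_re (a : ℝ) : (cis a).re = cos a := by simp [cis, Complex.exp_ofReal_mul_I_re]

lemma cis_im (a : ℝ) : (cis a).im = sin a := by simp [cis, Complex.exp_ofReal_mul_I_im]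

lemma norm_cis (a : ℝ) : ‖cis a‖ = 1 := by simp [cis, Complex.norm_exp_ofReal_mul_I]

lemma cis_cont : Continuous cis := by unfold cis; fun_prop

lemma cis_eq_iff {a b : ℝ} : cis a = cis b ↔ ∃ k : ℤ, a = b + k * (2 * π) := by
  unfold cis
  rw [Complex.exp_eq_exp_iff_exists_int]
  refine exists_congr fun k => ?_
  constructor
  · intro h
    have := congrArg Complex.im h
    simpa using this
  · intro h
    rw [h]; push_cast; ring

lemma cis_int (a : ℝ) (k : ℤ) : cis (a + k * (2 * π)) = cis a := cis_eq_iff.2 ⟨k, rfl⟩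

lemma cis_two_pi (a : ℝ) : cis (a + 2 * π) = cis a := by
  simpa using cis_int a 1

lemma cis_add_pi (a : ℝ) : cis (a + π) = - cis a := by rw [cis_add, cis_pi]; ring

lemma cis_sub_pi (a : ℝ) : cis (a - π) = - cis a := by
  have := cis_add_pi (a - π)
  rw [sub_add_cancel] at this; rw [this]; ring

lemma cis_neg (a : ℝ) : cis (-a) = (starRingEnd ℂ) (cis a) := by
  apply Complex.ext <;> simp [cis_re, cis_im]

lemma cis_sub (a b : ℝ) : cis (a - b) = cis a / cis b := by
  rw [eq_div_iff (cis_ne b), ← cis_add, sub_add_cancel]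

/-- `w` is a positive multiple of `cis θ`. -/
def Dir (w : ℂ) (θ : ℝ) : Prop := ∃ r : ℝ, 0 < r ∧ w = r * cis θ

lemma Dir.ne {w : ℂ} {θ : ℝ} (h : Dir w θ) : w ≠ 0 := by
  obtain ⟨r, hr, rfl⟩ := h
  exact mul_ne_zero (by exact_mod_cast hr.ne') (cis_ne _)

lemma dir_mk {r : ℝ} (hr : 0 < r) (θ : ℝ) : Dir (r * cis θ) θ := ⟨r, hr, rfl⟩

lemma dir_cis (θ : ℝ) : Dir (cis θ) θ := ⟨1, one_pos, by simp⟩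

lemma dir_norm {w : ℂ} {θ : ℝ} (h : Dir w θ) : w = ‖w‖ * cis θ := by
  obtain ⟨r, hr, rfl⟩ := h
  simp [norm_cis, abs_of_pos hr]

lemma dir_arg {w : ℂ} (h : w ≠ 0) : Dir w w.arg :=
  ⟨‖w‖, norm_pos_iff.2 h, by rw [cis]; exact (Complex.norm_mul_exp_arg_mul_I w).symm⟩

lemma Dir.unique {w : ℂ} {a b : ℝ} (ha : Dir w a) (hb : Dir w b) :
    ∃ k : ℤ, a = b + k * (2 * π) := by
  rw [← cis_eq_iff]
  have h1 := dir_norm ha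
  have h2 := dir_norm hb
  have : (‖w‖ : ℂ) ≠ 0 := by
    have := ha.ne
    simpa using this
  rw [h1] at h2
  simp only [norm_mul, norm_cis, Complex.norm_real, norm_norm, mul_one] at h2
  exact mul_left_cancel₀ this h2

lemma Dir.add_int {w : ℂ} {a : ℝ} (ha : Dir w a) (k : ℤ) : Dir w (a + k * (2 * π)) := by
  obtain ⟨r, hr, h⟩ := ha
  exact ⟨r, hr, by rw [cis_int, h]⟩

lemma Dir.add_two_pi {w : ℂ} {a : ℝ} (ha : Dir w a) : Dir w (a + 2 * π) := by
  simpa using ha.add_int 1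

lemma Dir.sub_two_pi {w : ℂ} {a : ℝ} (ha : Dir w a) : Dir w (a - 2 * π) := by
  have := ha.add_int (-1)
  convert this using 1; push_cast; ring

lemma Dir.neg {w : ℂ} {a : ℝ} (ha : Dir w a) : Dir (-w) (a + π) := by
  obtain ⟨r, hr, h⟩ := ha
  exact ⟨r, hr, by rw [cis_add_pi, h]; ring⟩

lemma Dir.neg_sub {w : ℂ} {a : ℝ} (ha : Dir w a) : Dir (-w) (a - π) := by
  obtain ⟨r, hr, h⟩ := ha
  exact ⟨r, hr, by rw [cis_sub_pi, h]; ring⟩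

lemma Dir.smul {w : ℂ} {a : ℝ} (ha : Dir w a) {c : ℝ} (hc : 0 < c) : Dir (c * w) a := by
  obtain ⟨r, hr, h⟩ := ha
  exact ⟨c * r, by positivity, by rw [h]; push_cast; ring⟩

lemma Dir.conj {w : ℂ} {a : ℝ} (ha : Dir w a) : Dir ((starRingEnd ℂ) w) (-a) := by
  obtain ⟨r, hr, h⟩ := ha
  exact ⟨r, hr, by rw [h, cis_neg]; simp⟩

lemma Dir.mul {w w' : ℂ} {a b : ℝ} (ha : Dir w a) (hb : Dir w' b) : Dir (w * w') (a + b) := by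
  obtain ⟨r, hr, h⟩ := ha
  obtain ⟨r', hr', h'⟩ := hb
  exact ⟨r * r', by positivity, by rw [h, h', cis_add]; push_cast; ring⟩

lemma Dir.div {w w' : ℂ} {a b : ℝ} (ha : Dir w a) (hb : Dir w' b) : Dir (w / w') (a - b) := by
  obtain ⟨r, hr, h⟩ := ha
  obtain ⟨r', hr', h'⟩ := hb
  refine ⟨r / r', by positivity, ?_⟩
  rw [h, h', cis_sub]; push_cast
  have : (r' : ℂ) ≠ 0 := by exact_mod_cast hr'.ne'
  have := cis_ne b
  field_simp

lemma dir_unique_of_lt {w : ℂ} {a b : ℝ} (ha : Dir w a) (hb : Dir w b)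
    (h1 : a < b + 2 * π) (h2 : b < a + 2 * π) : a = b := by
  obtain ⟨k, hk⟩ := ha.unique hb
  have hp := Real.pi_pos
  have : k = 0 := by
    have h3 : (k : ℝ) < 1 := by nlinarith
    have h4 : (-1 : ℝ) < k := by nlinarith
    have h5 : k < 1 := by exact_mod_cast h3
    have h6 : -1 < k := by exact_mod_cast h4
    omega
  simpa [this] using hk

theorem lift_exists {X : Type*} [NormedAddCommGroup X] [NormedSpace ℝ X] {U : Set X}
    (hU : IsOpen U) (hc : Convex ℝ U) (hne : U.Nonempty) {f : X → ℂ} (hf : ContinuousOn f U)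
    (h0 : ∀ u ∈ U, f u ≠ 0) : ∃ F : X → ℝ, ContinuousOn F U ∧ ∀ u ∈ U, Dir (f u) (F u) := by
  have hsc : IsSimplyConnected U := by
    have : ContractibleSpace U := hc.contractibleSpace hne
    change SimplyConnectedSpace U
    infer_instance
  obtain ⟨g, hg, hgf⟩ := Complex.exists_continuousOn_eqOn_exp_comp hsc hU hf
    (by rintro ⟨u, hu, h⟩; exact h0 u hu h)
  refine ⟨fun u => (g u).im, Complex.continuous_im.comp_continuousOn hg, fun u hu => ?_⟩
  refine ⟨rexp (g u).re, Real.exp_pos _, ?_⟩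
  rw [← hgf hu, cis, Complex.ofReal_exp, ← Complex.exp_add, Function.comp, Complex.re_add_im]

theorem branch {X : Type*} [TopologicalSpace X] {S : Set X} (hS : IsPreconnected S) {g : X → ℝ}
    (hg : ContinuousOn g S) {ω : ℝ} (h : ∀ s ∈ S, ∀ k : ℤ, g s ≠ ω + k * (2 * π)) :
    ∃ k : ℤ, ∀ s ∈ S, ω + k * (2 * π) < g s ∧ g s < ω + k * (2 * π) + 2 * π := by
  rcases S.eq_empty_or_nonempty with rfl | ⟨s0, hs0⟩
  · exact ⟨0, by simp⟩
  have hp : 0 < 2 * π := by positivity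
  have ho := (hS.image g hg).ordConnected
  set k := ⌊(g s0 - ω) / (2 * π)⌋ with hk
  have k1 : ω + k * (2 * π) ≤ g s0 := by
    have := Int.floor_le ((g s0 - ω) / (2 * π))
    rw [le_div_iff₀ hp] at this
    linarith
  have k2 : g s0 < ω + (k + 1 : ℤ) * (2 * π) := by
    have := Int.lt_floor_add_one ((g s0 - ω) / (2 * π))
    rw [div_lt_iff₀ hp] at this
    push_cast
    linarith
  refine ⟨k, fun s hs => ?_⟩
  constructor
  · by_contra hcon
    push Not at hcon
    obtain ⟨u, hu, hu'⟩ := ho.out (mem_image_of_mem g hs) (mem_image_of_mem g hs0) ⟨hcon, k1⟩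
    exact h u hu k hu'
  · by_contra hcon
    push Not at hcon
    obtain ⟨u, hu, hu'⟩ := ho.out (mem_image_of_mem g hs0) (mem_image_of_mem g hs)
      ⟨k2.le, by push_cast; linarith⟩
    exact h u hu (k+1) hu'

theorem int_const {X : Type*} [TopologicalSpace X] {S : Set X} (hS : IsPreconnected S) {g : X → ℝ}
    (hg : ContinuousOn g S) (h : ∀ s ∈ S, ∃ k : ℤ, g s = k * (2 * π)) :
    ∃ k : ℤ, ∀ s ∈ S, g s = k * (2 * π) := by
  have hp := Real.pi_pos
  obtain ⟨k, hk⟩ := branch hS hg (ω := π) (by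
    intro s hs k hk
    obtain ⟨l, hl⟩ := h s hs
    rw [hl] at hk
    have : (2 * l : ℝ) = 1 + 2 * k := by
      apply mul_right_cancel₀ hp.ne'; linarith
    have h2 : (2 * l : ℤ) = 1 + 2 * k := by exact_mod_cast this
    omega)
  refine ⟨k + 1, fun s hs => ?_⟩
  obtain ⟨l, hl⟩ := h s hs
  have := hk s hs
  rw [hl] at this ⊢
  have h1 : (k : ℝ) < l := by nlinarith
  have h2 : (l : ℝ) < k + 2 := by nlinarith
  have h1' : k < l := by exact_mod_cast h1
  have h2' : l < k + 2 := by exact_mod_cast h2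
  have : l = k + 1 := by omega
  rw [this]

theorem lift_unique {X : Type*} [TopologicalSpace X] {S : Set X} (hS : IsPreconnected S)
    {f : X → ℂ} {F G : X → ℝ} (hF : ContinuousOn F S) (hG : ContinuousOn G S)
    (h1 : ∀ s ∈ S, Dir (f s) (F s)) (h2 : ∀ s ∈ S, Dir (f s) (G s)) :
    ∃ k : ℤ, ∀ s ∈ S, F s = G s + k * (2 * π) := by
  obtain ⟨k, hk⟩ := int_const hS (hF.sub hG) (fun s hs => by
    obtain ⟨k, hk⟩ := (h1 s hs).unique (h2 s hs)
    exact ⟨k, by simp [hk]⟩)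
  exact ⟨k, fun s hs => by have := hk s hs; simp at this; linarith⟩

end MS
end

section
set_option linter.all false
namespace MS

lemma cross_eq {f a p F A G : ℝ} (h : (f : ℂ) * cis F = a * cis A + p * cis G) (B : ℝ) :
    f * sin (F - B) = a * sin (A - B) + p * sin (G - B) := by
  have := congrArg (fun w => (w * cis (-B)).im) h
  simp only [add_mul, mul_assoc, ← cis_add, Complex.add_im, Complex.re_ofReal_mul,
    Complex.im_ofReal_mul, cis_im] at this
  simpa [sub_eq_add_neg] using this

lemma dot_eq {f a p F A G : ℝ} (h : (f : ℂ) * cis F = a * cis A + p * cis G) (B : ℝ) :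
    f * cos (F - B) = a * cos (A - B) + p * cos (G - B) := by
  have := congrArg (fun w => (w * cis (-B)).re) h
  simp only [add_mul, mul_assoc, ← cis_add, Complex.add_re, Complex.re_ofReal_mul,
    Complex.im_ofReal_mul, cis_re] at this
  simpa [sub_eq_add_neg] using this

/-- sign tools for sine -/
lemma sin_pos_of {x : ℝ} (h : 0 < x) (h' : x < π) : 0 < sin x := sin_pos_of_pos_of_lt_pi h h'
lemma sin_neg_of {x : ℝ} (h : -π < x) (h' : x < 0) : sin x < 0 := by
  have := sin_pos_of (x := -x) (by linarith) (by linarith)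
  rw [sin_neg] at this; linarith

lemma pos_of_sin {x : ℝ} (h1 : -π < x) (h2 : x < π) (h : 0 < sin x) : 0 < x := by
  by_contra hc
  rcases (not_lt.1 hc).eq_or_lt with h0 | h0
  · simp [h0] at h
  · have := sin_neg_of h1 h0; linarith

lemma neg_of_sin {x : ℝ} (h1 : -π < x) (h2 : x < π) (h : sin x < 0) : x < 0 := by
  by_contra hc
  rcases (not_lt.1 hc).eq_or_lt with h0 | h0
  · simp [← h0] at h
  · have := sin_pos_of h0 h2; linarith

lemma zero_of_sin {x : ℝ} (h1 : -π < x) (h2 : x < π) (h : sin x = 0) : x = 0 := by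
  rcases lt_trichotomy x 0 with h0 | h0 | h0
  · have := sin_neg_of h1 h0; linarith
  · exact h0
  · have := sin_pos_of h0 h2; linarith

lemma tri0 {f a p F G : ℝ} (hf : 0 < f) (ha : 0 < a) (hp : 0 < p)
    (h : (f : ℂ) * cis F = a * cis 0 + p * cis G) (hF1 : -(2 * π) < F) (hF2 : F ≤ 0)
    (hG1 : 0 < G) (hG2 : G ≤ 2 * π) : G ∈ uIcc (F + 2 * π) π := by
  have e1 := cross_eq h 0
  have e2 := cross_eq h G
  have e3 := dot_eq h 0
  simp at e1 e2 e3
  have hpi := Real.pi_pos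
  rw [mem_uIcc]
  have shift : sin (F - G) = sin (F + 2 * π - G) := by
    rw [show F + 2 * π - G = F - G + 2 * π by ring, sin_add_two_pi]
  have sG : sin G = - sin (G - π) := by rw [sin_sub_pi]; ring
  have sF : sin F = - sin (F + π) := by rw [sin_add_pi]; ring
  rcases lt_trichotomy F (-π) with hF | hF | hF
  · left
    have s1 : 0 < sin F := by
      have := sin_pos_of (x := F + 2 * π) (by linarith) (by linarith)
      rwa [sin_add_two_pi] at this
    have s2 : 0 < sin G := by
      have : 0 < p * sin G := by rw [← e1]; positivity
      exact (pos_iff_pos_of_mul_pos this).1 hp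
    have g1 : G < π := by
      by_contra hc
      push Not at hc
      have : sin G ≤ 0 := by
        rw [sG]; have := sin_nonneg_of_nonneg_of_le_pi (x := G - π) (by linarith) (by linarith)
        linarith
      linarith
    have : sin (F + 2 * π - G) < 0 := by
      rw [← shift]
      have : f * sin (F - G) < 0 := by rw [e2]; nlinarith
      by_contra hc; push Not at hc; nlinarith
    have := neg_of_sin (by linarith) (by linarith) this
    constructor <;> linarith
  · have s1 : sin G = 0 := by
      have : p * sin G = 0 := by rw [← e1, hF]; simp
      rcases mul_eq_zero.1 this with h | h
      · linarith
      · exact h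
    have : G = π := by
      by_contra hne
      have hG : G = 2 * π := by
        by_contra hne2
        have hlt : G < 2 * π := lt_of_le_of_ne hG2 hne2
        have := zero_of_sin (x := G - π) (by linarith) (by linarith) (by rw [sin_sub_pi, s1]; simp)
        exact hne (by linarith)
      rw [hF, hG] at e3
      simp at e3
      nlinarith
    left; constructor <;> linarith
  · right
    rcases hF2.lt_or_eq with hF0 | hF0
    · have s1 : sin F < 0 := sin_neg_of hF hF0
      have s2 : sin G < 0 := by
        by_contra hc; push Not at hc
        nlinarith [mul_nonneg hp.le hc]
      have g1 : π < G := by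
        by_contra hc
        have := sin_nonneg_of_nonneg_of_le_pi (x := G) (by linarith) (by linarith)
        linarith
      have : 0 < sin (F + 2 * π - G) := by
        rw [← shift]
        by_contra hc; push Not at hc
        nlinarith [mul_nonpos_of_nonneg_of_nonpos hf.le hc, mul_neg_of_pos_of_neg ha s2]
      have := pos_of_sin (by linarith) (by linarith) this
      constructor <;> linarith
    · have s1 : sin G = 0 := by
        have : p * sin G = 0 := by rw [← e1, hF0]; simp
        rcases mul_eq_zero.1 this with h | h
        · linarith
        · exact h
      constructor
      · by_contra hc
        push Not at hc
        have := sin_pos_of hG1 hc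
        linarith
      · linarith

lemma tri {f a p F A G : ℝ} (hf : 0 < f) (ha : 0 < a) (hp : 0 < p)
    (h : (f : ℂ) * cis F = a * cis A + p * cis G) (hF1 : A - 2 * π < F) (hF2 : F ≤ A)
    (hG1 : A < G) (hG2 : G ≤ A + 2 * π) : G ∈ uIcc (F + 2 * π) (A + π) := by
  have h' : (f : ℂ) * cis (F - A) = a * cis 0 + p * cis (G - A) := by
    simp only [cis_sub, cis_zero]
    have := cis_ne A
    field_simp
    linear_combination h
  have := tri0 hf ha hp h' (by linarith) (by linarith) (by linarith) (by linarith)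
  rw [mem_uIcc] at this ⊢
  rcases this with h | h
  · left; constructor <;> linarith
  · right; constructor <;> linarith

/-- positive combination of two directions at angular distance less than `π` lies in between -/
lemma between {f a p F A W : ℝ} (hf : 0 < f) (ha : 0 < a) (hp : 0 < p)
    (h : (f : ℂ) * cis F = a * cis A + p * cis W) (h1 : A < W) (h2 : W < A + π)
    (hF1 : W - 2 * π < F) (hF2 : F ≤ A) : False := by
  have e1 := cross_eq h A
  have e2 := cross_eq h W
  simp at e1 e2
  have hpi := Real.pi_pos
  have s1 : 0 < sin (W - A) := sin_pos_of (by linarith) (by linarith)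
  have s2 : sin (A - W) < 0 := sin_neg_of (by linarith) (by linarith)
  have t1 : 0 < sin (F - A) := by
    by_contra hc; push Not at hc
    nlinarith [mul_nonpos_of_nonneg_of_nonpos hf.le hc, mul_pos hp s1]
  have t2 : sin (F - W) < 0 := by
    by_contra hc; push Not at hc
    nlinarith [mul_nonneg hf.le hc, mul_neg_of_pos_of_neg ha s2]
  have h3 : F < A - π := by
    by_contra hc; push Not at hc
    have := sin_nonneg_of_nonneg_of_le_pi (x := A - F) (by linarith) (by linarith)
    rw [show A - F = -(F - A) by ring, sin_neg] at this
    linarith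
  have : 0 < sin (F - W + 2 * π) := sin_pos_of (by linarith) (by linarith)
  rw [sin_add_two_pi] at this
  linarith

/-- A simple closed polygonal loop with its direction function; `c` is the odd half-rotation. -/
structure Loop (c : ℝ) where
  x : ℝ → ℂ
  n : ℝ
  H : ℝ → ℝ → ℝ
  θo : ℝ → ℝ
  θi : ℝ → ℝ
  npos : 0 < n
  xcont : Continuous x
  xper : ∀ s, x (s + n) = x s
  Hcont : ContinuousOn (fun p : ℝ × ℝ => H p.1 p.2) {p | p.1 < p.2 ∧ p.2 < p.1 + n}
  Hdir : ∀ s s', s < s' → s' < s + n → Dir (x s' - x s) (H s s')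
  flip : ∀ s s', s < s' → s' < s + n → H s' (s + n) = H s s' + c * π
  Hout : ∀ s, ∃ ε > 0, ∀ s', s < s' → s' < s + ε → H s s' = θo s
  Hin : ∀ s, ∃ ε > 0, ∀ s', s - ε < s' → s' < s → H s' s = θi s
  turn : ∀ s, |θo s - θi s| < π

namespace Loop
variable {c : ℝ} (γ : Loop c)

/-- Angular convexity bound. -/
def Aco (δ : ℝ) : Prop := ∀ s s', s < s' → -π + δ ≤ γ.θi s' - γ.θo s

/-- `Θ` is a tangent level at parameter `s`. -/
def Lev (s Θ : ℝ) : Prop := γ.θi s ≤ Θ ∧ Θ ≤ γ.θo s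

lemma H_per {s s' : ℝ} (h1 : s < s') (h2 : s' < s + γ.n) :
    γ.H (s + γ.n) (s' + γ.n) = γ.H s s' + 2 * c * π := by
  have e1 := γ.flip s s' h1 h2
  have e2 := γ.flip s' (s + γ.n) h2 (by linarith)
  rw [e2, e1]; ring

lemma θo_per (s : ℝ) : γ.θo (s + γ.n) = γ.θo s + 2 * c * π := by
  obtain ⟨ε, hε, h⟩ := γ.Hout s
  obtain ⟨ε', hε', h'⟩ := γ.Hout (s + γ.n)
  have hn := γ.npos
  obtain ⟨r, hr0, hr⟩ := exists_between (lt_min (lt_min hε hε') hn)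
  simp only [lt_min_iff] at hr
  have e1 := h (s + r) (by linarith) (by linarith)
  have e2 := h' (s + r + γ.n) (by linarith) (by linarith)
  rw [γ.H_per (by linarith) (by linarith)] at e2
  linarith

lemma θi_per (s : ℝ) : γ.θi (s + γ.n) = γ.θi s + 2 * c * π := by
  obtain ⟨ε, hε, h⟩ := γ.Hin s
  obtain ⟨ε', hε', h'⟩ := γ.Hin (s + γ.n)
  have hn := γ.npos
  obtain ⟨r, hr0, hr⟩ := exists_between (lt_min (lt_min hε hε') hn)
  simp only [lt_min_iff] at hr
  have e1 := h (s - r) (by linarith) (by linarith)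
  have e2 := h' (s - r + γ.n) (by linarith) (by linarith)
  rw [γ.H_per (by linarith) (by linarith)] at e2
  linarith

lemma θo_per_int (s : ℝ) (k : ℤ) : γ.θo (s + k * γ.n) = γ.θo s + k * (2 * c * π) := by
  induction k using Int.induction_on with
  | zero => simp
  | succ i ih =>
    have := γ.θo_per (s + (i:ℤ) * γ.n)
    rw [ih] at this
    push_cast at this ⊢
    rw [show s + ((i:ℝ) + 1) * γ.n = s + i * γ.n + γ.n by ring, this]; ring
  | pred i ih =>
    have := γ.θo_per (s + ((-i - 1 : ℤ) : ℝ) * γ.n)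
    rw [show s + ((-i - 1 : ℤ) : ℝ) * γ.n + γ.n = s + ((-i : ℤ) : ℝ) * γ.n by push_cast; ring, ih]
      at this
    push_cast at this ⊢
    linarith

lemma θi_per_int (s : ℝ) (k : ℤ) : γ.θi (s + k * γ.n) = γ.θi s + k * (2 * c * π) := by
  induction k using Int.induction_on with
  | zero => simp
  | succ i ih =>
    have := γ.θi_per (s + (i:ℤ) * γ.n)
    rw [ih] at this
    push_cast at this ⊢
    rw [show s + ((i:ℝ) + 1) * γ.n = s + i * γ.n + γ.n by ring, this]; ring
  | pred i ih =>
    have := γ.θi_per (s + ((-i - 1 : ℤ) : ℝ) * γ.n)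
    rw [show s + ((-i - 1 : ℤ) : ℝ) * γ.n + γ.n = s + ((-i : ℤ) : ℝ) * γ.n by push_cast; ring, ih]
      at this
    push_cast at this ⊢
    linarith

lemma Lev.shift {γ : Loop 1} {s Θ : ℝ} (h : γ.Lev s Θ) (k : ℤ) :
    γ.Lev (s + k * γ.n) (Θ + k * (2 * π)) := by
  unfold Lev at *
  rw [θo_per_int, θi_per_int]
  constructor <;> linarith [h.1, h.2]

lemma per_int {α : Type*} {f : ℝ → α} {n : ℝ} (h : ∀ s, f (s + n) = f s) (s : ℝ) (k : ℤ) :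
    f (s + k * n) = f s := (show Function.Periodic f n from h).int_mul k s

/-- the curve starts radially -/
lemma H_cont_right (s : ℝ) : ContinuousOn (γ.H s) (Ioo s (s + γ.n)) := by
  have := γ.Hcont.comp (f := fun s' : ℝ => (s, s')) (s := Ioo s (s + γ.n)) (by fun_prop)
    (fun s' hs' => hs')
  exact this

/-- the ends of `H s` on the right. -/
lemma H_near_end (s : ℝ) : ∃ ε > 0, ε < γ.n ∧ ∀ s', s + γ.n - ε < s' → s' < s + γ.n →
    γ.H s s' = γ.θi s + c * π := by
  obtain ⟨ε, hε, h⟩ := γ.Hin (s + γ.n)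
  have hn := γ.npos
  obtain ⟨r, hr0, hr⟩ := exists_between (lt_min hε hn)
  simp only [lt_min_iff] at hr
  refine ⟨r, hr0, hr.2, fun s' h1 h2 => ?_⟩
  have e1 := γ.flip s s' (by linarith) h2
  have e2 := h s' (by linarith) h2
  rw [γ.θi_per] at e2
  linarith

end Loop
end MS
end

section
set_option linter.all false
namespace MS
namespace Loop

/-- The mirror image of a loop, traversed backwards. -/
def mirror (γ : Loop 1) : Loop 1 where
  x := fun s => (starRingEnd ℂ) (γ.x (-s))
  n := γ.n
  H := fun s s' => π - γ.H (-s') (-s)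
  θo := fun s => π - γ.θi (-s)
  θi := fun s => π - γ.θo (-s)
  npos := γ.npos
  xcont := Complex.continuous_conj.comp (γ.xcont.comp continuous_neg)
  xper := fun s => by
    have := γ.xper (-(s + γ.n))
    rw [show -(s + γ.n) + γ.n = -s by ring] at this
    rw [this]
  Hcont := by
    apply continuousOn_const.sub
    refine γ.Hcont.comp (f := fun p : ℝ × ℝ => (-p.2, -p.1)) (by fun_prop) ?_
    rintro ⟨a, b⟩ ⟨h1, h2⟩
    simp only [mem_setOf_eq] at *
    constructor <;> linarith
  Hdir := fun s s' h1 h2 => by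
    have := (γ.Hdir (-s') (-s) (by linarith) (by linarith)).neg_sub.conj
    convert this using 1
    · simp
    · ring
  flip := fun s s' h1 h2 => by
    have := γ.flip (-s') (-s) (by linarith) (by linarith)
    have h3 := γ.H_per (s := -(s + γ.n)) (s' := -s') (by linarith) (by linarith)
    have e1 : -(s + γ.n) + γ.n = -s := by ring
    rw [e1] at h3
    linarith
  Hout := fun s => by
    obtain ⟨ε, hε, h⟩ := γ.Hin (-s)
    exact ⟨ε, hε, fun s' h1 h2 => by rw [h (-s') (by linarith) (by linarith)]⟩
  Hin := fun s => by
    obtain ⟨ε, hε, h⟩ := γ.Hout (-s)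
    exact ⟨ε, hε, fun s' h1 h2 => by rw [h (-s') (by linarith) (by linarith)]⟩
  turn := fun s => by
    have := γ.turn (-s)
    rw [show π - γ.θi (-s) - (π - γ.θo (-s)) = γ.θo (-s) - γ.θi (-s) by ring]
    exact this

lemma exists_min_per {F : ℝ → ℝ} {n : ℝ} (hn : 0 < n) (hF : Continuous F)
    (hper : ∀ s, F (s + n) = F s) : ∃ s0, ∀ s, F s0 ≤ F s := by
  obtain ⟨s0, hs0, h⟩ := isCompact_Icc.exists_isMinOn (nonempty_Icc.2 hn.le) hF.continuousOn
    (s := Icc 0 n)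
  refine ⟨s0, fun s => ?_⟩
  obtain ⟨y, hy, hy'⟩ := (show Function.Periodic F n from hper).exists_mem_Ico₀ hn s
  rw [hy']
  exact h (Ico_subset_Icc_self hy)

theorem lockMax (γ : Loop 1) {z : ℂ} {F : ℝ → ℝ} (hF : Continuous F)
    (hper : ∀ s, F (s + γ.n) = F s) (hdir : ∀ s, Dir (γ.x s - z) (F s)) {s1 : ℝ}
    (hmax : ∀ s, F s ≤ F s1) (hlow : ∀ s, F s1 - 2 * π < F s) :
    ∃ k : ℤ, γ.Lev s1 (F s1 + π + k * (2 * π)) ∧ ∀ s', s1 < s' → s' < s1 + γ.n →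
      γ.H s1 s' - k * (2 * π) ∈ uIcc (F s' + 2 * π) (F s1 + π) := by
  have hpi := Real.pi_pos
  set A := F s1 with hA
  obtain ⟨s0, hs0⟩ := exists_min_per γ.npos hF hper
  -- the basic triangle
  have key : ∀ s', s1 < s' → s' < s1 + γ.n → ∃ f a p : ℝ, 0 < f ∧ 0 < a ∧ 0 < p ∧
      (f : ℂ) * cis (F s') = a * cis A + p * cis (γ.H s1 s') := by
    intro s' h1 h2
    obtain ⟨f, hf, hf'⟩ := hdir s'
    obtain ⟨a, ha, ha'⟩ := hdir s1
    obtain ⟨p, hp, hp'⟩ := γ.Hdir s1 s' h1 h2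
    exact ⟨f, a, p, hf, ha, hp, by rw [← hf', ← ha', ← hp']; ring⟩
  have avoid : ∀ ω, A < ω → ω < A + π → ω < F s0 + 2 * π → ∀ s' ∈ Ioo s1 (s1 + γ.n), ∀ k : ℤ,
      γ.H s1 s' ≠ ω + k * (2 * π) := by
    intro ω h1 h2 h3 s' hs' k hk
    obtain ⟨f, a, p, hf, ha, hp, h⟩ := key s' hs'.1 hs'.2
    rw [hk, cis_int] at h
    exact between hf ha hp h h1 h2 (by linarith [hs0 s']) (hmax s')
  obtain ⟨ω, hω1, hω2⟩ := exists_between (show A < min (A + π) (F s0 + 2 * π) from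
    lt_min (by linarith) (by linarith [hlow s0]))
  rw [lt_min_iff] at hω2
  obtain ⟨k, hk⟩ := branch isPreconnected_Ioo (γ.H_cont_right s1) (avoid ω hω1 hω2.1 hω2.2)
  have range : ∀ s', s1 < s' → s' < s1 + γ.n → A < γ.H s1 s' - k * (2 * π) ∧
      γ.H s1 s' - k * (2 * π) ≤ A + 2 * π := by
    intro s' h1 h2
    have := hk s' ⟨h1, h2⟩
    refine ⟨by linarith, ?_⟩
    by_contra hc
    push Not at hc
    refine avoid (γ.H s1 s' - k * (2 * π) - 2 * π) (by linarith) (by linarith) (by linarith) s'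
      ⟨h1, h2⟩ (k + 1) ?_
    push_cast; ring
  have main : ∀ s', s1 < s' → s' < s1 + γ.n →
      γ.H s1 s' - k * (2 * π) ∈ uIcc (F s' + 2 * π) (A + π) := by
    intro s' h1 h2
    obtain ⟨f, a, p, hf, ha, hp, h⟩ := key s' h1 h2
    obtain ⟨r1, r2⟩ := range s' h1 h2
    refine tri hf ha hp ?_ (hlow s') (hmax s') r1 r2
    rw [h]
    congr 2
    have := cis_int (γ.H s1 s' - k * (2 * π)) k
    rw [sub_add_cancel] at this
    exact this
  refine ⟨k, ?_, main⟩
  -- near s1 the angle F is close to A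
  obtain ⟨η, hη, hη'⟩ : ∃ η > 0, ∀ s, |s - s1| < η → A - π < F s := by
    have := (hF.continuousAt (x := s1)).eventually (lt_mem_nhds (show A - π < F s1 by linarith))
    obtain ⟨η, hη, h⟩ := Metric.eventually_nhds_iff.1 this
    exact ⟨η, hη, fun s hs => h (by rwa [Real.dist_eq])⟩
  have hn := γ.npos
  constructor
  · obtain ⟨ε, hε, hεn, h⟩ := γ.H_near_end s1
    obtain ⟨r, hr0, hr⟩ := exists_between (lt_min hε hη)
    simp only [lt_min_iff] at hr
    have e := h (s1 + γ.n - r) (by linarith) (by linarith)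
    have := range (s1 + γ.n - r) (by linarith) (by linarith)
    rw [e] at this
    linarith
  · obtain ⟨ε, hε, h⟩ := γ.Hout s1
    obtain ⟨r, hr0, hr⟩ := exists_between (lt_min (lt_min hε hη) hn)
    simp only [lt_min_iff] at hr
    have e := h (s1 + r) (by linarith) (by linarith)
    have m := main (s1 + r) (by linarith) (by linarith)
    have f1 := hη' (s1 + r) (by rw [add_sub_cancel_left, abs_of_pos hr0]; exact hr.1.2)
    rw [e, mem_uIcc] at m
    rcases m with m | m <;> linarith

theorem lockMin (γ : Loop 1) {z : ℂ} {F : ℝ → ℝ} (hF : Continuous F)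
    (hper : ∀ s, F (s + γ.n) = F s) (hdir : ∀ s, Dir (γ.x s - z) (F s)) {s2 : ℝ}
    (hmin : ∀ s, F s2 ≤ F s) (hup : ∀ s, F s < F s2 + 2 * π) :
    ∃ j : ℤ, γ.Lev s2 (F s2 + j * (2 * π)) ∧ ∀ u, s2 - γ.n < u → u < s2 →
      γ.H u s2 - j * (2 * π) ∈ uIcc (F u - π) (F s2) := by
  obtain ⟨k, hk1, hk2⟩ := lockMax γ.mirror (z := (starRingEnd ℂ) z) (F := fun s => - F (-s))
    (s1 := -s2) (by fun_prop)
    (fun s => by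
      have := hper (-(s + γ.n))
      rw [show -(s + γ.n) + γ.n = -s by ring] at this
      change - F (-(s + γ.n)) = - F (-s)
      rw [this])
    (fun s => by
      have := (hdir (-s)).conj
      rw [map_sub] at this
      exact this)
    (fun s => by have := hmin (-s); simp; linarith)
    (fun s => by have := hup (-s); simp; linarith)
  refine ⟨-k, ?_, ?_⟩
  · obtain ⟨h1, h2⟩ := hk1
    simp only [mirror, neg_neg] at h1 h2
    constructor <;> push_cast <;> linarith
  · intro u h1 h2
    have := hk2 (-u) (by linarith) (by simp only [mirror]; linarith)
    simp only [mirror, neg_neg] at this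
    rw [mem_uIcc] at this ⊢
    push_cast
    rcases this with h | h
    · right; constructor <;> linarith
    · left; constructor <;> linarith

theorem dich (γ : Loop 1) {δ : ℝ} (hδ : δ ≤ π) (haco : γ.Aco δ) {z1 z2 : ℂ} {F1 F2 : ℝ → ℝ}
    (hF1 : Continuous F1) (hF2 : Continuous F2) (hper1 : ∀ s, F1 (s + γ.n) = F1 s)
    (hper2 : ∀ s, F2 (s + γ.n) = F2 s) (hdir1 : ∀ s, Dir (γ.x s - z1) (F1 s))
    (hdir2 : ∀ s, Dir (γ.x s - z2) (F2 s)) {s1 s2 : ℝ} (hmax : ∀ s, F1 s ≤ F1 s1)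
    (hlow : ∀ s, F1 s1 - 2 * π < F1 s) (hmin : ∀ s, F2 s2 ≤ F2 s)
    (hup : ∀ s, F2 s < F2 s2 + 2 * π) (hD : F1 s2 < F2 s2 + 2 * π) (hC : F1 s1 - 2 * π < F2 s1) :
    F1 s1 - F2 s2 ≤ 2 * π - δ ∨ π ≤ F1 s2 - F2 s1 ∨ 3 * π ≤ F1 s1 - F2 s2 := by
  wlog hs : s1 < s2 ∧ s2 ≤ s1 + γ.n generalizing s2
  · have hn := γ.npos
    obtain ⟨k, ⟨hk1, hk2⟩, -⟩ := existsUnique_add_zsmul_mem_Ioc hn s2 s1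
    rw [zsmul_eq_mul] at hk1 hk2
    have := this (s2 := s2 + k * γ.n)
    rw [per_int hper1, per_int hper2] at this
    exact this hmin hup hD ⟨hk1, hk2⟩
  obtain ⟨h1, h2⟩ := hs
  obtain ⟨k, hk, hk'⟩ := γ.lockMax hF1 hper1 hdir1 hmax hlow
  obtain ⟨j, hj, hj'⟩ := γ.lockMin hF2 hper2 hdir2 hmin hup
  have hpi := Real.pi_pos
  have a := haco s1 s2 h1
  have b1 := hk.2
  have b2 := hj.1
  rcases le_or_gt (j - k) 1 with hi | hi
  · left
    have : (j : ℝ) - k ≤ 1 := by exact_mod_cast hi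
    nlinarith
  · have hi' : (2 : ℝ) ≤ j - k := by exact_mod_cast hi
    rcases h2.lt_or_eq with h2 | h2
    · have u := hk' s2 h1 h2
      have v := hj' s1 (by linarith) h1
      have w : (4 * π : ℝ) ≤ j * (2 * π) - k * (2 * π) := by nlinarith
      rw [mem_uIcc] at u v
      by_contra hcon
      push Not at hcon
      obtain ⟨c1, c2, c3⟩ := hcon
      rcases u with u | u <;> rcases v with v | v <;> linarith [u.1, u.2, v.1, v.2]
    · have e1 := hper1 s1
      have e2 := hper2 s1
      rw [← h2] at e1 e2
      rw [e1, ← e2]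
      rcases le_or_gt (F1 s1 - F2 s2) (2 * π - δ) with h | h
      · exact Or.inl h
      · right; left; linarith

end Loop
end MS
end

section
set_option linter.all false
namespace MS

def sec (z : ℂ) (ε a b : ℝ) : Set ℂ := {w | ∃ r φ : ℝ, 0 < r ∧ r < ε ∧ a < φ ∧ φ < b ∧ w = z + r * cis φ}

lemma sec_eq (z : ℂ) (ε a b : ℝ) :
    sec z ε a b = (fun p : ℝ × ℝ => z + p.1 * cis p.2) '' (Ioo 0 ε ×ˢ Ioo a b) := by
  ext w
  simp only [sec, mem_setOf_eq, mem_image, Prod.exists, mem_prod, mem_Ioo]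
  constructor
  · rintro ⟨r, φ, h1, h2, h3, h4, rfl⟩; exact ⟨r, φ, ⟨⟨h1, h2⟩, h3, h4⟩, rfl⟩
  · rintro ⟨r, φ, ⟨⟨h1, h2⟩, h3, h4⟩, rfl⟩; exact ⟨r, φ, h1, h2, h3, h4, rfl⟩

lemma polar_cont (z : ℂ) : Continuous (fun p : ℝ × ℝ => z + p.1 * cis p.2) := by
  have := cis_cont
  fun_prop

lemma sec_preconn (z : ℂ) (ε a b : ℝ) : IsPreconnected (sec z ε a b) := by
  rw [sec_eq]
  exact (isPreconnected_Ioo.prod isPreconnected_Ioo).image _ (polar_cont z).continuousOn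

lemma mem_closure_sec {z : ℂ} {ε a b r φ : ℝ} (hab : a < b) (h1 : 0 ≤ r) (h2 : r < ε)
    (h3 : a ≤ φ) (h4 : φ ≤ b) : z + r * cis φ ∈ closure (sec z ε a b) := by
  rw [sec_eq]
  apply image_closure_subset_closure_image (polar_cont z)
  refine ⟨(r, φ), ?_, rfl⟩
  rw [closure_prod_eq, closure_Ioo (by linarith), closure_Ioo hab.ne]
  exact ⟨⟨h1, h2.le⟩, h3, h4⟩

lemma sec_mono {z : ℂ} {ε ε' a b : ℝ} (h : ε ≤ ε') : sec z ε a b ⊆ sec z ε' a b := by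
  rintro w ⟨r, φ, h1, h2, h3, h4, h5⟩
  exact ⟨r, φ, h1, by linarith, h3, h4, h5⟩

lemma polar_exists (w : ℂ) (hw : w ≠ 0) (a : ℝ) : ∃ φ, a < φ ∧ φ ≤ a + 2 * π ∧ w = ‖w‖ * cis φ := by
  obtain ⟨k, ⟨h1, h2⟩, -⟩ := existsUnique_add_zsmul_mem_Ioc Real.two_pi_pos w.arg a
  rw [zsmul_eq_mul] at h1 h2
  exact ⟨_, h1, h2, dir_norm ((dir_arg hw).add_int k)⟩

namespace Loop
variable {c : ℝ} (γ : Loop c)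

def secL (s ε : ℝ) : Set ℂ := sec (γ.x s) ε (γ.θo s) (γ.θi s + π)
def secR (s ε : ℝ) : Set ℂ := sec (γ.x s) ε (γ.θi s - π) (γ.θo s)

lemma exists_rep (u s : ℝ) : ∃ u', γ.x u' = γ.x u ∧ s ≤ u' ∧ u' < s + γ.n := by
  obtain ⟨k, ⟨h1, h2⟩, -⟩ := existsUnique_add_zsmul_mem_Ico γ.npos u s
  rw [zsmul_eq_mul] at h1 h2
  exact ⟨_, per_int γ.xper u k, h1, h2⟩

lemma isCompact_range : IsCompact (range γ.x) := by
  have : range γ.x = γ.x '' Icc 0 (0 + γ.n) := by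
    apply Subset.antisymm
    · rintro _ ⟨u, rfl⟩
      obtain ⟨u', h1, h2, h3⟩ := γ.exists_rep u 0
      exact ⟨u', ⟨h2, h3.le⟩, h1⟩
    · exact image_subset_range _ _
  rw [this]
  exact isCompact_Icc.image γ.xcont

lemma near_out (s : ℝ) : ∃ ε > 0, ε ≤ γ.n / 2 ∧ ∀ s', s < s' → s' < s + ε → Dir (γ.x s' - γ.x s) (γ.θo s) := by
  obtain ⟨ε, hε, h⟩ := γ.Hout s
  have hn := γ.npos
  refine ⟨min ε (γ.n / 2), by positivity, min_le_right _ _, fun s' h1 h2 => ?_⟩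
  have a1 := min_le_left ε (γ.n / 2)
  have a2 := min_le_right ε (γ.n / 2)
  rw [← h s' h1 (by linarith)]
  exact γ.Hdir s s' h1 (by linarith)

lemma near_in (s : ℝ) : ∃ ε > 0, ε ≤ γ.n / 2 ∧ ∀ s', s - ε < s' → s' < s → Dir (γ.x s' - γ.x s) (γ.θi s + π) := by
  obtain ⟨ε, hε, h⟩ := γ.Hin s
  have hn := γ.npos
  refine ⟨min ε (γ.n / 2), by positivity, min_le_right _ _, fun s' h1 h2 => ?_⟩
  have a1 := min_le_left ε (γ.n / 2)
  have a2 := min_le_right ε (γ.n / 2)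
  rw [← h s' (by linarith) h2]
  have := (γ.Hdir s' s h2 (by linarith)).neg
  rwa [neg_sub] at this

/-- local structure of the trace. -/
lemma local_struct (s : ℝ) : ∃ ε > 0, ∀ r φ : ℝ, 0 < r → r < ε →
    (γ.x s + r * cis φ ∈ range γ.x ↔ cis φ = cis (γ.θo s) ∨ cis φ = cis (γ.θi s + π)) := by
  obtain ⟨ε1, hε1, hn1, h1⟩ := γ.near_out s
  obtain ⟨ε2, hε2, hn2, h2⟩ := γ.near_in s
  have hn := γ.npos
  set η := min ε1 ε2 / 2 with hη
  have hηpos : 0 < η := by positivity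
  have hη1 : η < ε1 := by have := min_le_left ε1 ε2; linarith
  have hη2 : η < ε2 := by have := min_le_right ε1 ε2; linarith
  -- far part
  have hcomp : IsCompact (γ.x '' Icc (s + η) (s + γ.n - η)) := isCompact_Icc.image γ.xcont
  have hfar : γ.x s ∉ γ.x '' Icc (s + η) (s + γ.n - η) := by
    rintro ⟨u, ⟨hu1, hu2⟩, hu⟩
    exact (γ.Hdir s u (by linarith) (by linarith)).ne (by rw [hu, sub_self])
  obtain ⟨d, hd, hd'⟩ := Metric.mem_nhds_iff.1 (hcomp.isClosed.isOpen_compl.mem_nhds hfar)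
  -- existence on radial segments
  have ex1 : ∀ r, 0 < r → r < ‖γ.x (s + η) - γ.x s‖ → γ.x s + r * cis (γ.θo s) ∈ range γ.x := by
    intro r hr0 hr
    have := intermediate_value_Icc (f := fun u => ‖γ.x u - γ.x s‖) (a := s) (b := s + η) (by linarith)
      ((γ.xcont.sub continuous_const).norm.continuousOn)
    obtain ⟨u, hu, hu'⟩ := this ⟨by simpa using hr0.le, hr.le⟩
    have hus : s < u := by
      rcases hu.1.eq_or_lt with h | h
      · rw [← h] at hu'; simp at hu'; linarith
      · exact h
    have := dir_norm (h1 u hus (by linarith [hu.2]))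
    simp only at hu'
    rw [hu'] at this
    exact ⟨u, by rw [← this]; ring⟩
  have ex2 : ∀ r, 0 < r → r < ‖γ.x (s - η) - γ.x s‖ → γ.x s + r * cis (γ.θi s + π) ∈ range γ.x := by
    intro r hr0 hr
    have := intermediate_value_Icc' (f := fun u => ‖γ.x u - γ.x s‖) (a := s - η) (b := s) (by linarith)
      ((γ.xcont.sub continuous_const).norm.continuousOn)
    obtain ⟨u, hu, hu'⟩ := this ⟨by simpa using hr0.le, hr.le⟩
    have hus : u < s := by
      rcases hu.2.eq_or_lt with h | h
      · rw [h] at hu'; simp at hu'; linarith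
      · exact h
    have := dir_norm (h2 u (by linarith [hu.1]) hus)
    simp only at hu'
    rw [hu'] at this
    exact ⟨u, by rw [← this]; ring⟩
  have p1 : 0 < ‖γ.x (s + η) - γ.x s‖ := norm_pos_iff.2 (h1 _ (by linarith) (by linarith)).ne
  have p2 : 0 < ‖γ.x (s - η) - γ.x s‖ := norm_pos_iff.2 (h2 _ (by linarith) (by linarith)).ne
  refine ⟨min d (min ‖γ.x (s + η) - γ.x s‖ ‖γ.x (s - η) - γ.x s‖), by positivity,
    fun r φ hr0 hr => ?_⟩
  simp only [lt_min_iff] at hr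
  constructor
  · rintro ⟨u, hu⟩
    obtain ⟨u', e, hu1, hu2⟩ := γ.exists_rep u s
    rw [hu] at e
    have key : ∀ {v θ}, γ.x v = γ.x s + r * cis φ → Dir (γ.x v - γ.x s) θ → cis φ = cis θ := by
      intro v θ hv hd
      rw [hv, add_sub_cancel_left] at hd
      exact cis_eq_iff.2 ((dir_mk hr0 φ).unique hd)
    have hne : u' ≠ s := by
      rintro rfl
      have : (r : ℂ) * cis φ = 0 := by linear_combination -e
      exact (dir_mk hr0 φ).ne this
    have hlt : s < u' := lt_of_le_of_ne hu1 hne.symm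
    rcases lt_or_ge u' (s + η) with h | h
    · left; exact key e (h1 u' hlt (by linarith))
    · rcases le_or_gt u' (s + γ.n - η) with h' | h'
      · exfalso
        apply hd' (a := γ.x u')
        · rw [e]; simp [norm_cis, abs_of_pos hr0, hr.1]
        · exact ⟨u', ⟨h, h'⟩, rfl⟩
      · right
        have e' : γ.x (u' - γ.n) = γ.x s + r * cis φ := by
          rw [← e, ← γ.xper (u' - γ.n), sub_add_cancel]
        exact key e' (h2 _ (by linarith) (by linarith))
  · rintro (h | h)
    · rw [h]; exact ex1 r hr0 hr.2.1
    · rw [h]; exact ex2 r hr0 hr.2.2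

lemma turn' (s : ℝ) : γ.θi s - π < γ.θo s ∧ γ.θo s < γ.θi s + π := by
  have := abs_lt.1 (γ.turn s)
  constructor <;> linarith

lemma cis_ne_of {a b : ℝ} (h1 : a < b) (h2 : b < a + 2 * π) : cis a ≠ cis b := by
  intro h
  have := dir_unique_of_lt (dir_cis a) (h ▸ dir_cis b) (by linarith) (by linarith)
  linarith

lemma local_secs (s : ℝ) : ∃ ε > 0, Disjoint (γ.secL s ε) (range γ.x) ∧
    Disjoint (γ.secR s ε) (range γ.x) ∧
    ∀ w, ‖w - γ.x s‖ < ε → w ∉ range γ.x → w ∈ γ.secL s ε ∨ w ∈ γ.secR s ε := by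
  obtain ⟨ε, hε, h⟩ := γ.local_struct s
  obtain ⟨t1, t2⟩ := γ.turn' s
  have hpi := Real.pi_pos
  refine ⟨ε, hε, ?_, ?_, ?_⟩
  · rw [disjoint_left]
    rintro w ⟨r, φ, h1, h2, h3, h4, rfl⟩ hw
    rcases (h r φ h1 h2).1 hw with h5 | h5
    · exact cis_ne_of h3 (by linarith) h5.symm
    · exact cis_ne_of h4 (by linarith) h5
  · rw [disjoint_left]
    rintro w ⟨r, φ, h1, h2, h3, h4, rfl⟩ hw
    rcases (h r φ h1 h2).1 hw with h5 | h5
    · exact cis_ne_of h4 (by linarith) h5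
    · rw [← cis_two_pi φ] at h5
      exact cis_ne_of (a := γ.θi s + π) (b := φ + 2 * π) (by linarith) (by linarith) h5.symm
  · intro w hw hwT
    have hne : w - γ.x s ≠ 0 := by
      intro h0
      exact hwT ⟨s, by linear_combination -h0⟩
    obtain ⟨φ, f1, f2, f3⟩ := polar_exists _ hne (γ.θi s - π)
    have hp := norm_pos_iff.2 hne
    have hw' : w = γ.x s + ‖w - γ.x s‖ * cis φ := by rw [← f3]; ring
    have hnot : ¬ (cis φ = cis (γ.θo s) ∨ cis φ = cis (γ.θi s + π)) := by
      rw [← h _ φ hp hw, ← hw']; exact hwT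
    push Not at hnot
    have f4 : φ < γ.θi s + π := lt_of_le_of_ne (by linarith) (fun e => hnot.2 (by rw [e]))
    rcases lt_trichotomy φ (γ.θo s) with g | g | g
    · right; exact ⟨_, φ, hp, hw, f1, g, hw'⟩
    · exact absurd (by rw [g]) hnot.1
    · left; exact ⟨_, φ, hp, hw, g, f4, hw'⟩

lemma secL_closure {s ε : ℝ} : ∃ η > 0, ∀ s', |s' - s| < η → ‖γ.x s' - γ.x s‖ < ε →
    γ.x s' ∈ closure (γ.secL s ε) ∧ γ.x s' ∈ closure (γ.secR s ε) := by
  obtain ⟨ε1, hε1, hn1, h1⟩ := γ.near_out s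
  obtain ⟨ε2, hε2, hn2, h2⟩ := γ.near_in s
  obtain ⟨t1, t2⟩ := γ.turn' s
  refine ⟨min ε1 ε2, by positivity, fun s' hs' hn => ?_⟩
  rw [lt_min_iff, abs_lt, abs_lt] at hs'
  have hnn := norm_nonneg (γ.x s' - γ.x s)
  rcases lt_trichotomy s' s with h | h | h
  · have e := dir_norm (h2 s' (by linarith) h)
    have e' : γ.x s' = γ.x s + ‖γ.x s' - γ.x s‖ * cis (γ.θi s + π) := by rw [← e]; ring
    have e'' : γ.x s' = γ.x s + ‖γ.x s' - γ.x s‖ * cis (γ.θi s - π) := by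
      rw [cis_sub_pi, ← cis_add_pi]; exact e'
    constructor
    · rw [e']; exact mem_closure_sec t2 hnn hn t2.le le_rfl
    · rw [e'']; exact mem_closure_sec t1 hnn hn le_rfl t1.le
  · subst h
    have e : γ.x s' = γ.x s' + (0:ℝ) * cis (γ.θo s') := by simp
    rw [sub_self, norm_zero] at hn
    constructor
    · nth_rw 1 [e]; exact mem_closure_sec t2 le_rfl hn le_rfl t2.le
    · nth_rw 1 [e]; exact mem_closure_sec t1 le_rfl hn t1.le le_rfl
  · have e := dir_norm (h1 s' h (by linarith))
    have e' : γ.x s' = γ.x s + ‖γ.x s' - γ.x s‖ * cis (γ.θo s) := by rw [← e]; ring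
    constructor
    · rw [e']; exact mem_closure_sec t2 hnn hn le_rfl t2.le
    · rw [e']; exact mem_closure_sec t1 hnn hn t1.le le_rfl

theorem jordan_side {Ω Ω' : Set ℂ} (ho : IsOpen Ω) (ho' : IsOpen Ω') (hd : Disjoint Ω Ω')
    (hu : Ω ∪ Ω' = (range γ.x)ᶜ) (hne : Ω.Nonempty) (hne' : Ω'.Nonempty) (s : ℝ) :
    ∃ ε > 0, γ.secL s ε ⊆ Ω ∨ γ.secR s ε ⊆ Ω := by
  -- dichotomy at closure points
  have step : ∀ s, γ.x s ∈ closure Ω → ∃ ε > 0, γ.secL s ε ⊆ Ω ∨ γ.secR s ε ⊆ Ω := by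
    intro s hs
    obtain ⟨ε, hε, d1, d2, hcov⟩ := γ.local_secs s
    obtain ⟨w, hwΩ, hw⟩ := Metric.mem_closure_iff.1 hs ε hε
    have hwT : w ∉ range γ.x := by
      have : w ∈ (range γ.x)ᶜ := by rw [← hu]; exact Or.inl hwΩ
      exact this
    rw [dist_comm, Complex.dist_eq] at hw
    refine ⟨ε, hε, ?_⟩
    rcases hcov w hw hwT with h | h
    · left
      refine IsPreconnected.subset_left_of_subset_union ho ho' hd ?_ ⟨w, h, hwΩ⟩ (sec_preconn _ _ _ _)
      rw [hu]; exact d1.subset_compl_right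
    · right
      refine IsPreconnected.subset_left_of_subset_union ho ho' hd ?_ ⟨w, h, hwΩ⟩ (sec_preconn _ _ _ _)
      rw [hu]; exact d2.subset_compl_right
  have hS : {s | γ.x s ∈ closure Ω} = univ := by
    apply IsClopen.eq_univ (s := {s | γ.x s ∈ closure Ω})
    · refine ⟨isClosed_closure.preimage γ.xcont, ?_⟩
      rw [isOpen_iff_mem_nhds]
      intro s hs
      obtain ⟨ε, hε, h⟩ := step s hs
      obtain ⟨η, hη, hη'⟩ := γ.secL_closure (s := s) (ε := ε)
      have c1 : ∀ᶠ s' in nhds s, |s' - s| < η := by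
        filter_upwards [Metric.ball_mem_nhds s hη] with s' hs'
        rwa [Metric.mem_ball, Real.dist_eq] at hs'
      have c2 : ∀ᶠ s' in nhds s, ‖γ.x s' - γ.x s‖ < ε := by
        have : Continuous fun s' => ‖γ.x s' - γ.x s‖ := (γ.xcont.sub continuous_const).norm
        exact this.continuousAt.eventually (gt_mem_nhds (by simpa using hε))
      filter_upwards [c1, c2] with s' h1 h2
      obtain ⟨q1, q2⟩ := hη' s' h1 h2
      rcases h with h | h
      · exact closure_mono h q1
      · exact closure_mono h q2
    · by_contra hcon
      rw [not_nonempty_iff_eq_empty] at hcon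
      have hcl : closure Ω = Ω := by
        apply Subset.antisymm _ subset_closure
        intro w hw
        by_contra hwn
        have h1 : w ∉ Ω' := by
          intro h
          have := hd.closure_left ho'
          exact this.le_bot ⟨hw, h⟩
        have h2 : w ∉ (range γ.x)ᶜ := by
          rw [← hu]; rintro (h | h)
          · exact hwn h
          · exact h1 h
        rw [notMem_compl_iff] at h2
        obtain ⟨s, rfl⟩ := h2
        have : s ∈ {s | γ.x s ∈ closure Ω} := hw
        rw [hcon] at this
        exact this
      have : IsClopen Ω := ⟨closure_eq_iff_isClosed.1 hcl, ho⟩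
      have hun := this.eq_univ hne
      obtain ⟨w, hw⟩ := hne'
      exact hd.le_bot ⟨by rw [hun]; trivial, hw⟩
  exact step s (by have : s ∈ (univ : Set ℝ) := trivial; rwa [← hS] at this)

lemma secL_nonempty {s ε : ℝ} (h : 0 < ε) : (γ.secL s ε).Nonempty := by
  obtain ⟨t1, t2⟩ := γ.turn' s
  obtain ⟨φ, h1, h2⟩ := exists_between t2
  obtain ⟨r, h3, h4⟩ := exists_between h
  exact ⟨_, r, φ, h3, h4, h1, h2, rfl⟩

lemma secR_nonempty {s ε : ℝ} (h : 0 < ε) : (γ.secR s ε).Nonempty := by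
  obtain ⟨t1, t2⟩ := γ.turn' s
  obtain ⟨φ, h1, h2⟩ := exists_between t1
  obtain ⟨r, h3, h4⟩ := exists_between h
  exact ⟨_, r, φ, h3, h4, h1, h2, rfl⟩

theorem jordan3 {Ω1 Ω2 Ω3 : Set ℂ} (o1 : IsOpen Ω1) (o2 : IsOpen Ω2) (o3 : IsOpen Ω3)
    (d12 : Disjoint Ω1 Ω2) (d13 : Disjoint Ω1 Ω3) (d23 : Disjoint Ω2 Ω3)
    (hu : Ω1 ∪ Ω2 ∪ Ω3 = (range γ.x)ᶜ) (n1 : Ω1.Nonempty) (n2 : Ω2.Nonempty) (n3 : Ω3.Nonempty) :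
    False := by
  obtain ⟨e1, p1, h1⟩ := γ.jordan_side o1 (o2.union o3) (d12.union_right d13)
    (by rw [← union_assoc, hu]) n1 n2.inl 0
  obtain ⟨e2, p2, h2⟩ := γ.jordan_side o2 (o1.union o3) (d12.symm.union_right d23)
    (by rw [← hu]; ext; simp; tauto) n2 n1.inl 0
  obtain ⟨e3, p3, h3⟩ := γ.jordan_side o3 (o1.union o2) (d13.symm.union_right d23.symm)
    (by rw [← hu]; ext; simp; tauto) n3 n1.inl 0
  have aux : ∀ {A B : Set ℂ} {S : ℝ → Set ℂ}, (∀ {a b : ℝ}, a ≤ b → S a ⊆ S b) →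
      (∀ {a}, 0 < a → (S a).Nonempty) → ∀ {a b}, 0 < a → 0 < b → S a ⊆ A → S b ⊆ B →
      Disjoint A B → False := by
    intro A B S hm hne a b ha hb hA hB hd
    obtain ⟨w, hw⟩ := hne (lt_min ha hb)
    exact hd.le_bot ⟨hA (hm (min_le_left _ _) hw), hB (hm (min_le_right _ _) hw)⟩
  have aL := @fun A B => @aux A B (γ.secL 0) (fun h => sec_mono h) (fun h => γ.secL_nonempty h)
  have aR := @fun A B => @aux A B (γ.secR 0) (fun h => sec_mono h) (fun h => γ.secR_nonempty h)
  rcases h1 with h1 | h1 <;> rcases h2 with h2 | h2 <;> rcases h3 with h3 | h3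
  · exact aL _ _ p1 p2 h1 h2 d12
  · exact aL _ _ p1 p2 h1 h2 d12
  · exact aL _ _ p1 p3 h1 h3 d13
  · exact aR _ _ p2 p3 h2 h3 d23
  · exact aL _ _ p2 p3 h2 h3 d23
  · exact aR _ _ p1 p3 h1 h3 d13
  · exact aR _ _ p1 p2 h1 h2 d12
  · exact aR _ _ p1 p2 h1 h2 d12

end Loop
end MS
end

section
open Filter
set_option linter.all false
namespace MS

def Free (K : Set ℂ) (z : ℂ) (φ : ℝ) : Prop := ∀ r : ℝ, 0 < r → z + r * cis φ ∉ K

def FC (K : Set ℂ) (δ : ℝ) (z : ℂ) : Prop :=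
  ∃ ω : ℝ, ∀ φ, ω - δ / 2 < φ → φ < ω + δ / 2 → Free K z φ

lemma Free.int {K : Set ℂ} {z : ℂ} {φ : ℝ} (h : Free K z φ) (k : ℤ) :
    Free K z (φ + k * (2 * π)) := fun r hr => by rw [cis_int]; exact h r hr

lemma polar_near (z : ℂ) {r : ℝ} (hr : 0 < r) (φ : ℝ) {η : ℝ} (hη : 0 < η) :
    ∀ᶠ w in nhds (z + r * cis φ), ∃ r' φ' : ℝ, 0 < r' ∧ |φ' - φ| < η ∧ w = z + r' * cis φ' := by
  set g : ℂ → ℂ := fun w => (w - z) / (r * cis φ) with hg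
  have h0 : (r * cis φ : ℂ) ≠ 0 := (dir_mk hr φ).ne
  have hgc : Continuous g := by fun_prop
  have hg1 : g (z + r * cis φ) = 1 := by simp [hg, h0]
  have hca : ContinuousAt (fun w => (g w).arg) (z + r * cis φ) := by
    refine ContinuousAt.comp (g := Complex.arg) (f := g) ?_ hgc.continuousAt
    rw [hg1]; exact Complex.continuousAt_arg (by simp [Complex.one_mem_slitPlane])
  have e1 : ∀ᶠ w in nhds (z + r * cis φ), |(g w).arg| < η := by
    apply hca.abs.eventually_lt_const
    simpa [hg1] using hη
  have e2 : ∀ᶠ w in nhds (z + r * cis φ), g w ≠ 0 :=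
    hgc.continuousAt.eventually_ne (by rw [hg1]; exact one_ne_zero)
  filter_upwards [e1, e2] with w h1 h2
  obtain ⟨ρ, hρ, h3⟩ := (dir_arg h2).mul (dir_mk hr φ)
  refine ⟨ρ, (g w).arg + φ, hρ, by simpa using h1, ?_⟩
  rw [← h3, hg]
  simp only
  rw [div_mul_cancel₀ _ h0]
  ring

theorem FC_closed {K : Set ℂ} (hreg : K = closure (interior K)) {δ : ℝ} (hδ : 0 < δ) :
    IsClosed {z | FC K δ z} := by
  apply IsSeqClosed.isClosed
  intro u z hu hz
  have : ∀ k, ∃ ω ∈ Icc (0:ℝ) (2 * π), ∀ φ, ω - δ / 2 < φ → φ < ω + δ / 2 → Free K (u k) φ := by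
    intro k
    obtain ⟨ω, hω⟩ := hu k
    obtain ⟨m, ⟨h1, h2⟩, -⟩ := existsUnique_add_zsmul_mem_Ioc Real.two_pi_pos ω 0
    rw [zsmul_eq_mul] at h1 h2
    refine ⟨_, ⟨h1.le, by linarith⟩, fun φ g1 g2 => ?_⟩
    have := (hω (φ - m * (2 * π)) (by linarith) (by linarith)).int m
    rwa [sub_add_cancel] at this
  choose ω hω1 hω2 using this
  obtain ⟨ωs, -, σ, hσ, hlim⟩ := isCompact_Icc.tendsto_subseq hω1
  have hz' : Tendsto (u ∘ σ) atTop (nhds z) := hz.comp hσ.tendsto_atTop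
  -- interior version
  have hinter : ∀ φ, ωs - δ / 2 < φ → φ < ωs + δ / 2 → ∀ r : ℝ, 0 < r →
      z + r * cis φ ∉ interior K := by
    intro φ h1 h2 r hr hmem
    have e1 : ∀ᶠ k in atTop, u (σ k) + r * cis φ ∈ interior K :=
      (hz'.add_const (r * cis φ)).eventually (isOpen_interior.mem_nhds hmem)
    have e2 : ∀ᶠ k in atTop, ω (σ k) < φ + δ / 2 := hlim.eventually_lt_const (by linarith)
    have e3 : ∀ᶠ k in atTop, φ - δ / 2 < ω (σ k) := hlim.eventually_const_lt (by linarith)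
    obtain ⟨k, k1, k2, k3⟩ := (e1.and (e2.and e3)).exists
    exact hω2 (σ k) φ (by linarith) (by linarith) r hr (interior_subset k1)
  refine ⟨ωs, fun φ h1 h2 r hr hmem => ?_⟩
  rw [hreg] at hmem
  have := polar_near z hr φ (η := min (φ - (ωs - δ / 2)) (ωs + δ / 2 - φ))
    (lt_min (by linarith) (by linarith))
  obtain ⟨w, hw, r', φ', g1, g2, g3⟩ := (mem_closure_iff_frequently.1 hmem).and_eventually this |>.exists
  rw [lt_min_iff, abs_lt, abs_lt] at g2
  exact hinter φ' (by linarith) (by linarith) r' g1 (g3 ▸ hw)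

lemma ray_preconn (z : ℂ) (φ : ℝ) : IsPreconnected ((fun r : ℝ => z + r * cis φ) '' Ici 0) := by
  apply isPreconnected_Ici.image
  fun_prop

lemma free_of_frontier {K : Set ℂ} (hK : IsClosed K) {z : ℂ} (hz : z ∉ K) {φ : ℝ}
    (h : Free (frontier K) z φ) : Free K z φ := by
  intro r hr hmem
  have hsub : (fun r : ℝ => z + r * cis φ) '' Ici 0 ⊆ Kᶜ := by
    refine IsPreconnected.subset_left_of_subset_union hK.isOpen_compl (isOpen_interior (s := K)) ?_ ?_
      ⟨z, ⟨0, by simp⟩, hz⟩ (ray_preconn z φ)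
    · exact disjoint_compl_left.mono_right interior_subset
    · rintro _ ⟨r, hr, rfl⟩
      rcases (show (0:ℝ) ≤ r from hr).eq_or_lt with h0 | h0
      · left; simpa [← h0] using hz
      · by_contra hcon
        simp only [mem_union, mem_compl_iff, not_or, not_not] at hcon
        exact h r h0 ⟨subset_closure hcon.1, hcon.2⟩
  exact hsub ⟨r, hr.le, rfl⟩ hmem

/-- points with a free closed ray form an open set -/
lemma freeRay_open {K : Set ℂ} (hK : IsCompact K) : IsOpen {z | z ∉ K ∧ ∃ φ, Free K z φ} := by
  rw [isOpen_iff_mem_nhds]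
  rintro z ⟨hz, φ, hφ⟩
  obtain ⟨M, hM0, hM⟩ := hK.isBounded.exists_pos_norm_le
  set ρ := M + ‖z‖ + 2 with hρ
  have hC : IsCompact ((fun r : ℝ => z + r * cis φ) '' Icc 0 ρ) :=
    isCompact_Icc.image (by fun_prop)
  have hdis : Disjoint ((fun r : ℝ => z + r * cis φ) '' Icc 0 ρ) K := by
    rw [disjoint_left]
    rintro _ ⟨r, hr, rfl⟩ hmem
    rcases hr.1.eq_or_lt with h0 | h0
    · apply hz; simpa [← h0] using hmem
    · exact hφ r h0 hmem
  obtain ⟨d, hd, hd'⟩ := hdis.exists_thickenings hC hK.isClosed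
  have claim : ∀ z' ∈ Metric.ball z (min d 1), ∀ r : ℝ, 0 ≤ r → z' + r * cis φ ∉ K := by
    intro z' hz' r hr hmem
    rw [Metric.mem_ball, lt_min_iff] at hz'
    rcases le_or_gt r ρ with h | h
    · refine hd'.le_bot ⟨?_, Metric.self_subset_thickening hd _ hmem⟩
      rw [Metric.mem_thickening_iff]
      refine ⟨_, ⟨r, ⟨hr, h⟩, rfl⟩, ?_⟩
      simpa using hz'.1
    · have h1 := hM _ hmem
      have h2 : ‖(r * cis φ : ℂ)‖ = r := by simp [norm_cis, abs_of_nonneg hr]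
      have h3 : ‖z'‖ < ‖z‖ + 1 := by
        have := norm_sub_norm_le z' z
        rw [← Complex.dist_eq] at this
        linarith [hz'.2]
      have h4 := norm_sub_le (z' + r * cis φ) z'
      rw [add_sub_cancel_left, h2] at h4
      linarith
  filter_upwards [Metric.ball_mem_nhds z (lt_min hd one_pos)] with z' hz'
  refine ⟨?_, φ, fun r hr => claim z' hz' r hr.le⟩
  have := claim z' hz' 0 le_rfl
  simpa using this

/-- A polygon in the complex plane -/
structure PolyC (K : Set ℂ) (γ : Loop 1) : Prop where
  compact : IsCompact K
  regular : K = closure (interior K)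
  boundary : frontier K = range γ.x

namespace PolyC
variable {K : Set ℂ} {γ : Loop 1}

lemma nonempty_interior (P : PolyC K γ) : (interior K).Nonempty := by
  by_contra h
  rw [not_nonempty_iff_eq_empty] at h
  have h2 := P.regular
  rw [h, closure_empty] at h2
  have h3 := P.boundary
  rw [h2, frontier_empty] at h3
  have : γ.x 0 ∈ (∅ : Set ℂ) := by rw [h3]; exact ⟨0, rfl⟩
  exact this

lemma nonempty_compl (P : PolyC K γ) : (Kᶜ).Nonempty := by
  by_contra h
  rw [not_nonempty_iff_eq_empty, compl_empty_iff] at h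
  have := P.compact
  rw [h] at this
  exact noncompact_univ ℂ this

lemma cover (P : PolyC K γ) : interior K ∪ Kᶜ = (range γ.x)ᶜ := by
  rw [← P.boundary]
  have hc := P.compact.isClosed
  rw [frontier, hc.closure_eq]
  ext w; simp only [mem_union, mem_compl_iff, mem_diff]
  have := @interior_subset _ _ K w
  tauto

lemma preconn_compl (P : PolyC K γ) : IsPreconnected (Kᶜ) := by
  rw [isPreconnected_iff_subset_of_disjoint]
  intro u v hu hv hs hd
  by_contra hcon
  rw [not_or, not_subset, not_subset] at hcon
  obtain ⟨⟨a, ha1, ha2⟩, b, hb1, hb2⟩ := hcon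
  have ho := P.compact.isClosed.isOpen_compl
  refine γ.jordan3 (isOpen_interior (s := K)) (ho.inter hu) (ho.inter hv) ?_ ?_ ?_ ?_
    P.nonempty_interior ⟨b, hb1, (hs hb1).resolve_right hb2⟩ ⟨a, ha1, (hs ha1).resolve_left ha2⟩
  · exact (disjoint_compl_right.mono_left interior_subset).mono_right inter_subset_left
  · exact (disjoint_compl_right.mono_left interior_subset).mono_right inter_subset_left
  · rw [disjoint_iff_inter_eq_empty, ← inter_inter_distrib_left, hd]
  · rw [← P.cover, union_assoc, ← inter_union_distrib_left, inter_eq_left.2 hs]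

lemma preconn_interior (P : PolyC K γ) : IsPreconnected (interior K) := by
  rw [isPreconnected_iff_subset_of_disjoint]
  intro u v hu hv hs hd
  by_contra hcon
  rw [not_or, not_subset, not_subset] at hcon
  obtain ⟨⟨a, ha1, ha2⟩, b, hb1, hb2⟩ := hcon
  have ho := isOpen_interior (s := K)
  refine γ.jordan3 P.compact.isClosed.isOpen_compl (ho.inter hu) (ho.inter hv) ?_ ?_ ?_ ?_
    P.nonempty_compl ⟨b, hb1, (hs hb1).resolve_right hb2⟩ ⟨a, ha1, (hs ha1).resolve_left ha2⟩
  · exact (disjoint_compl_left.mono_right interior_subset).mono_right inter_subset_left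
  · exact (disjoint_compl_left.mono_right interior_subset).mono_right inter_subset_left
  · rw [disjoint_iff_inter_eq_empty, ← inter_inter_distrib_left, hd]
  · rw [← P.cover, union_assoc, ← inter_union_distrib_left, inter_eq_left.2 hs, union_comm]

lemma off (P : PolyC K γ) {z : ℂ} (hz : z ∉ K) (s : ℝ) : γ.x s - z ≠ 0 := by
  intro h
  apply hz
  have : γ.x s ∈ frontier K := by rw [P.boundary]; exact ⟨s, rfl⟩
  rw [← sub_eq_zero.1 h]
  exact P.compact.isClosed.frontier_subset this

/-- Angular lift around an exterior point with a free ray. -/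
lemma lift_of_free (P : PolyC K γ) {z : ℂ} (hz : z ∉ K) {ω : ℝ} (hω : Free K z ω) : ∃ F : ℝ → ℝ, Continuous F ∧
    (∀ s, Dir (γ.x s - z) (F s)) ∧ (∀ s, ω < F s ∧ F s < ω + 2 * π) ∧
    ∀ s, F (s + γ.n) = F s := by
  obtain ⟨G, hG, hG'⟩ := lift_exists isOpen_univ convex_univ (univ_nonempty (α := ℝ))
    (f := fun s => γ.x s - z) (γ.xcont.sub continuous_const).continuousOn (fun s _ => P.off hz s)
  obtain ⟨k, hk⟩ := branch isPreconnected_univ hG (ω := ω) (by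
    intro s _ k hk
    obtain ⟨r, hr, e⟩ := hG' s trivial
    rw [hk, cis_int] at e
    apply hω r hr
    rw [← e]
    have : γ.x s ∈ frontier K := by rw [P.boundary]; exact ⟨s, rfl⟩
    simpa using P.compact.isClosed.frontier_subset this)
  have hd : ∀ s, Dir (γ.x s - z) (G s - k * (2 * π)) := by
    intro s
    have := (hG' s trivial).add_int (-k)
    convert this using 1; push_cast; ring
  have hr : ∀ s, ω < G s - k * (2 * π) ∧ G s - k * (2 * π) < ω + 2 * π := by
    intro s
    have := hk s trivial
    constructor <;> linarith
  refine ⟨fun s => G s - k * (2 * π), (continuousOn_univ.1 hG).sub continuous_const, hd, hr, ?_⟩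
  intro s
  have h1 := hd (s + γ.n)
  rw [γ.xper] at h1
  have a := hr s
  have b := hr (s + γ.n)
  exact dir_unique_of_lt h1 (hd s) (by linarith) (by linarith)

lemma osc (P : PolyC K γ) {z : ℂ} {δ : ℝ} (hδ : δ ≤ π) (haco : γ.Aco δ) {F : ℝ → ℝ} (hF : Continuous F)
    (hper : ∀ s, F (s + γ.n) = F s) (hdir : ∀ s, Dir (γ.x s - z) (F s))
    {ω : ℝ} (hb : ∀ s, ω < F s ∧ F s < ω + 2 * π) : ∃ A B, A - B ≤ 2 * π - δ ∧
      ∀ s, B ≤ F s ∧ F s ≤ A := by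
  obtain ⟨s2, h2⟩ := Loop.exists_min_per γ.npos hF hper
  obtain ⟨s1, h1⟩ := Loop.exists_min_per (F := fun s => - F s) γ.npos hF.neg (fun s => by rw [hper])
  have h1' : ∀ s, F s ≤ F s1 := fun s => by have := h1 s; simp at this; exact this
  have hpi := Real.pi_pos
  have b1 := hb s1
  have b2 := hb s2
  refine ⟨F s1, F s2, ?_, fun s => ⟨h2 s, h1' s⟩⟩
  rcases γ.dich hδ haco hF hF hper hper hdir hdir h1' (fun s => by linarith [hb s]) h2
    (fun s => by linarith [hb s]) (by linarith) (by linarith) with h | h | h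
  · exact h
  · linarith [h2 s1]
  · linarith

lemma FC_of_free (P : PolyC K γ) {z : ℂ} {δ : ℝ} (hδ : δ ≤ π) (haco : γ.Aco δ) (hz : z ∉ K) {ω : ℝ}
    (hω : Free K z ω) : FC K δ z := by
  obtain ⟨F, hF, hdir, hb, hper⟩ := P.lift_of_free hz hω
  obtain ⟨A, B, hAB, hF'⟩ := P.osc hδ haco hF hper hdir hb
  refine ⟨A + δ / 2, fun φ h1 h2 => free_of_frontier P.compact.isClosed hz ?_⟩
  intro r hr hmem
  rw [P.boundary] at hmem
  obtain ⟨s, hs⟩ := hmem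
  have h3 := hdir s
  rw [hs, add_sub_cancel_left] at h3
  have := hF' s
  have := dir_unique_of_lt h3 (dir_mk hr φ) (by linarith) (by linarith)
  linarith

theorem FC_ext (P : PolyC K γ) {δ : ℝ} (hδ0 : 0 < δ) (hδ : δ ≤ π) (haco : γ.Aco δ) {z : ℂ} (hz : z ∉ interior K) :
    FC K δ z := by
  have hcl := FC_closed P.regular hδ0
  have key : Kᶜ ⊆ {z | z ∉ K ∧ ∃ φ, Free K z φ} := by
    refine IsPreconnected.subset_left_of_subset_union (freeRay_open P.compact) hcl.isOpen_compl
      ?_ ?_ ?_ P.preconn_compl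
    · rw [disjoint_left]
      rintro z ⟨h1, φ, h2⟩ h3
      exact h3 (P.FC_of_free hδ haco h1 h2)
    · intro z hz
      by_cases h : FC K δ z
      · left
        obtain ⟨ω, hω⟩ := h
        exact ⟨hz, ω, hω ω (by linarith) (by linarith)⟩
      · exact Or.inr h
    · obtain ⟨M, hM0, hM⟩ := P.compact.isBounded.exists_pos_norm_le
      have far : ∀ r : ℝ, 0 ≤ r → ((M + 1 : ℝ) : ℂ) + r * cis 0 ∉ K := by
        intro r hr hmem
        have := hM _ hmem
        rw [cis_zero, mul_one, ← Complex.ofReal_add, Complex.norm_real, Real.norm_eq_abs,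
          abs_of_pos (by linarith)] at this
        linarith
      have f0 := far 0 le_rfl
      rw [Complex.ofReal_zero, zero_mul, add_zero] at f0
      exact ⟨_, f0, f0, 0, fun r hr => far r hr.le⟩
  have h2 : closure Kᶜ ⊆ {z | FC K δ z} := by
    apply closure_minimal _ hcl
    intro z hz
    obtain ⟨h1, φ, h3⟩ := key hz
    exact P.FC_of_free hδ haco h1 h3
  apply h2
  rwa [closure_compl]

end PolyC
end MS
end

section
open Filter
set_option linter.all false
namespace MS

lemma Loop.free_bd {c : ℝ} (γ : Loop c) {s ω : ℝ} (h : Free (range γ.x) (γ.x s) ω) :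
    ∃ k : ℤ, (∀ s', s < s' → s' < s + γ.n → ω + k * (2 * π) < γ.H s s' ∧
        γ.H s s' < ω + k * (2 * π) + 2 * π) ∧
      (ω + k * (2 * π) < γ.θo s ∧ γ.θo s < ω + k * (2 * π) + 2 * π) ∧
      (ω + k * (2 * π) < γ.θi s + c * π ∧ γ.θi s + c * π < ω + k * (2 * π) + 2 * π) := by
  obtain ⟨k, hk⟩ := branch isPreconnected_Ioo (γ.H_cont_right s) (ω := ω) (by
    intro s' hs' k hk
    obtain ⟨r, hr, e⟩ := γ.Hdir s s' hs'.1 hs'.2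
    rw [hk, cis_int] at e
    apply h r hr
    exact ⟨s', by rw [← e]; ring⟩)
  have hn := γ.npos
  refine ⟨k, fun s' h1 h2 => hk s' ⟨h1, h2⟩, ?_, ?_⟩
  · obtain ⟨ε, hε, h⟩ := γ.Hout s
    obtain ⟨r, hr0, hr⟩ := exists_between (lt_min hε hn)
    rw [lt_min_iff] at hr
    rw [← h (s + r) (by linarith) (by linarith)]
    exact hk (s + r) ⟨by linarith, by linarith⟩
  · obtain ⟨ε, hε, hεn, h⟩ := γ.H_near_end s
    obtain ⟨r, hr0, hr⟩ := exists_between hε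
    rw [← h (s + γ.n - r) (by linarith) (by linarith)]
    exact hk _ ⟨by linarith, by linarith⟩

lemma Free.mono {K K' : Set ℂ} {z : ℂ} {φ : ℝ} (h : Free K z φ) (hs : K' ⊆ K) : Free K' z φ :=
  fun r hr hm => h r hr (hs hm)

lemma FC.free {K : Set ℂ} {δ : ℝ} (hδ : 0 < δ) {z : ℂ} (h : FC K δ z) : ∃ ω, Free K z ω := by
  obtain ⟨ω, h⟩ := h
  exact ⟨ω, h ω (by linarith) (by linarith)⟩

lemma PolyC.range_sub {K : Set ℂ} {γ : Loop 1} (P : PolyC K γ) : range γ.x ⊆ K := by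
  rw [← P.boundary]; exact P.compact.isClosed.frontier_subset

lemma PolyC.sides {K : Set ℂ} {γ : Loop 1} (P : PolyC K γ) {δ : ℝ} (hδ0 : 0 < δ) (hδ : δ ≤ π)
    (haco : γ.Aco δ) (s : ℝ) : ∃ ε > 0, γ.secL s ε ⊆ interior K ∧ γ.secR s ε ⊆ Kᶜ := by
  have hbd : γ.x s ∈ frontier K := by rw [P.boundary]; exact ⟨s, rfl⟩
  obtain ⟨ω, hω⟩ := (P.FC_ext hδ0 hδ haco hbd.2).free hδ0
  obtain ⟨k, h1, h2, h3⟩ := γ.free_bd (hω.mono P.range_sub)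
  obtain ⟨ε, hε, d1, d2, -⟩ := γ.local_secs s
  have hdis : Disjoint (Kᶜ) (interior K) := disjoint_compl_left.mono_right interior_subset
  have hR : γ.secR s ε ⊆ Kᶜ := by
    refine IsPreconnected.subset_left_of_subset_union P.compact.isClosed.isOpen_compl
      (isOpen_interior (s := K)) hdis ?_ ?_ (sec_preconn _ _ _ _)
    · rw [union_comm, P.cover]; exact d2.subset_compl_right
    · refine ⟨γ.x s + (ε / 2 : ℝ) * cis (ω + k * (2 * π)), ⟨ε / 2, _, by linarith, by linarith,
        by linarith, by linarith, rfl⟩, ?_⟩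
      rw [cis_int]
      exact hω _ (by linarith)
  obtain ⟨ε', hε', h⟩ := γ.jordan_side isOpen_interior P.compact.isClosed.isOpen_compl hdis.symm
    P.cover P.nonempty_interior P.nonempty_compl s
  have hL : γ.secL s ε' ⊆ interior K := by
    refine h.resolve_right (fun h => ?_)
    obtain ⟨w, hw⟩ := γ.secR_nonempty (s := s) (lt_min hε hε')
    exact hR (sec_mono (min_le_left _ _) hw)
      (interior_subset (h (sec_mono (min_le_right _ _) hw)))
  exact ⟨min ε ε', lt_min hε hε', (sec_mono (min_le_right _ _)).trans hL,
    (sec_mono (min_le_left _ _)).trans hR⟩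

structure Sys (δ : ℝ) (K L : Set ℂ) (γ ζ : Loop 1) : Prop where
  hδ0 : 0 < δ
  hδ : δ ≤ π
  P : PolyC K γ
  Q : PolyC L ζ
  aK : γ.Aco δ
  aL : ζ.Aco δ

lemma Sys.swap {δ K L γ ζ} (S : Sys δ K L γ ζ) : Sys δ L K ζ γ :=
  ⟨S.hδ0, S.hδ, S.Q, S.P, S.aL, S.aK⟩

lemma Sys.single {δ K L γ ζ} (S : Sys δ K L γ ζ) {z : ℂ} (hz : z ∉ K + L) {F : ℝ → ℝ → ℝ}
    (hF : Continuous fun p : ℝ × ℝ => F p.1 p.2)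
    (hdir : ∀ s t, Dir (γ.x s + ζ.x t - z) (F s t)) (t : ℝ) :
    (∀ s, F (s + γ.n) t = F s t) ∧ ∀ s s', F s t - F s' t ≤ 2 * π - δ := by
  have hm : z - ζ.x t ∉ K := fun h => hz ⟨_, h, _, S.Q.range_sub ⟨t, rfl⟩, by simp⟩
  have hFt : Continuous fun s => F s t := hF.comp (by fun_prop : Continuous fun s : ℝ => (s, t))
  have hd : ∀ s, Dir (γ.x s - (z - ζ.x t)) (F s t) := fun s => by
    have := hdir s t
    convert this using 1; ring
  obtain ⟨ω, hω⟩ := (S.P.FC_ext S.hδ0 S.hδ S.aK (fun h => hm (interior_subset h))).free S.hδ0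
  obtain ⟨G, hG, hGd, hGb, hGp⟩ := S.P.lift_of_free hm hω
  obtain ⟨A, B, hAB, hG'⟩ := S.P.osc S.hδ S.aK hG hGp hGd hGb
  obtain ⟨k, hk⟩ := lift_unique isPreconnected_univ hFt.continuousOn hG.continuousOn
    (fun s _ => hd s) (fun s _ => hGd s)
  constructor
  · intro s
    rw [hk _ trivial, hk _ trivial, hGp]
  · intro s s'
    rw [hk _ trivial, hk _ trivial]
    linarith [hG' s, hG' s']

/-- Exclusion of mutual enclosure. -/
lemma encl {x m : ℝ → ℂ} (hx : Continuous x) (hm : Continuous m) {F : ℝ → ℝ → ℝ}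
    (hF : Continuous fun p : ℝ × ℝ => F p.1 p.2) (hdir : ∀ s t, Dir (x s - m t) (F s t))
    {q : ℂ} {s1 s2 t1 ts : ℝ} (h1 : ∀ t, (q - m t) / (x s1 - m t) ∈ Complex.slitPlane)
    (h2 : ∀ t, (x s2 - m t) / (q - m t) ∈ Complex.slitPlane)
    (hΦ : F s1 t1 - F s2 t1 + Complex.arg ((q - m t1) / (x s1 - m t1)) +
      Complex.arg ((x s2 - m t1) / (q - m t1)) ≠ 0)
    (hfar : ∀ s, ‖x s - q‖ ≤ ‖m ts - q‖) : False := by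
  have hq : ∀ t, q - m t ≠ 0 := fun t h0 => by
    have := h1 t; rw [h0, zero_div] at this; exact Complex.zero_notMem_slitPlane this
  have hxm : ∀ s t, x s - m t ≠ 0 := fun s t => (hdir s t).ne
  set Φ : ℝ → ℝ := fun t => F s1 t - F s2 t + Complex.arg ((q - m t) / (x s1 - m t)) +
      Complex.arg ((x s2 - m t) / (q - m t)) with hΦdef
  have hFs : ∀ s, Continuous fun t => F s t := fun s =>
    hF.comp (by fun_prop : Continuous fun t : ℝ => (s, t))
  have hc : Continuous Φ := by
    have c1 : Continuous fun t => (q - m t) / (x s1 - m t) :=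
      (continuous_const.sub hm).div (continuous_const.sub hm) (hxm s1)
    have c2 : Continuous fun t => (x s2 - m t) / (q - m t) :=
      (continuous_const.sub hm).div (continuous_const.sub hm) hq
    have a1 : Continuous fun t => Complex.arg ((q - m t) / (x s1 - m t)) :=
      continuous_iff_continuousAt.2 fun t =>
        ContinuousAt.comp (g := Complex.arg) (Complex.continuousAt_arg (h1 t)) c1.continuousAt
    have a2 : Continuous fun t => Complex.arg ((x s2 - m t) / (q - m t)) :=
      continuous_iff_continuousAt.2 fun t =>
        ContinuousAt.comp (g := Complex.arg) (Complex.continuousAt_arg (h2 t)) c2.continuousAt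
    exact (((hFs s1).sub (hFs s2)).add a1).add a2
  obtain ⟨k, hk⟩ := int_const isPreconnected_univ hc.continuousOn (fun t _ => by
    have d1 := dir_arg (div_ne_zero (hq t) (hxm s1 t))
    have d2 := dir_arg (div_ne_zero (hxm s2 t) (hq t))
    have d := (((hdir s1 t).div (hdir s2 t)).mul d1).mul d2
    have e : (x s1 - m t) / (x s2 - m t) * ((q - m t) / (x s1 - m t)) * ((x s2 - m t) / (q - m t))
        = 1 := by
      have := hq t
      have := hxm s1 t
      have := hxm s2 t
      field_simp
    rw [e] at d
    obtain ⟨k, hk⟩ := d.unique (by simpa [cis_zero] using dir_cis 0)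
    exact ⟨k, by simpa [hΦdef] using hk⟩)
  -- evaluation at the farthest point
  have hts : Φ ts = 0 := by
    have hre : ∀ s, 0 < ((x s - m ts) / (q - m ts)).re := by
      intro s
      have h0 := hq ts
      set a := x s - m ts with ha
      set b := q - m ts with hb
      have h3 : ‖a - b‖ ≤ ‖b‖ := by
        have := hfar s
        rw [show x s - q = a - b by simp [ha, hb], ← norm_neg (m ts - q), neg_sub] at this
        exact this
      have h4 : 0 < a.re * b.re + a.im * b.im := by
        have h5 : ‖a - b‖ ^ 2 ≤ ‖b‖ ^ 2 := by gcongr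
        have h6 : 0 < Complex.normSq a := Complex.normSq_pos.2 (hxm s ts)
        rw [← Complex.normSq_eq_norm_sq, ← Complex.normSq_eq_norm_sq] at h5
        simp only [Complex.normSq_apply, Complex.sub_re, Complex.sub_im] at h5 h6
        nlinarith
      rw [Complex.div_re, ← add_div]
      exact div_pos h4 (Complex.normSq_pos.2 h0)
    have hcg : Continuous fun s => (x s - m ts) / (q - m ts) :=
      (hx.sub continuous_const).div_const _
    have hG : Continuous fun s => Complex.arg ((x s - m ts) / (q - m ts)) :=
      continuous_iff_continuousAt.2 fun s =>
        ContinuousAt.comp (g := Complex.arg) (Complex.continuousAt_arg (Or.inl (hre s)))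
          hcg.continuousAt
    have hFt : Continuous fun s => F s ts := hF.comp (by fun_prop : Continuous fun s : ℝ => (s, ts))
    obtain ⟨l, hl⟩ := lift_unique (f := fun s => x s - m ts) isPreconnected_univ hFt.continuousOn
      (hG.add (continuous_const (y := Complex.arg (q - m ts)))).continuousOn
      (fun s _ => hdir s ts) (fun s _ => by
        have := (dir_arg (div_ne_zero (hxm s ts) (hq ts))).mul (dir_arg (hq ts))
        rwa [div_mul_cancel₀ _ (hq ts)] at this)
    have e1 := hl s1 trivial
    have e2 := hl s2 trivial
    have e3 : Complex.arg ((q - m ts) / (x s1 - m ts)) =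
        - Complex.arg ((x s1 - m ts) / (q - m ts)) := by
      rw [← inv_div, Complex.arg_inv, if_neg]
      intro h
      have := hre s1
      have h5 := Complex.arg_eq_pi_iff.1 h
      linarith [h5.1]
    simp only [hΦdef]
    rw [e3, e1, e2]; simp only [Pi.add_apply]; ring
  have e1 := hk ts trivial
  have e2 := hk t1 trivial
  rw [hts] at e1
  rw [← e1] at e2
  exact hΦ e2

end MS
end

section
open Filter
set_option linter.all false
namespace MS

lemma exists_max_min {F g : ℝ → ℝ → ℝ} {n m : ℝ} (hn : 0 < n) (hm : 0 < m)
    (hF : Continuous fun p : ℝ × ℝ => F p.1 p.2) (hg : Continuous fun p : ℝ × ℝ => g p.1 p.2)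
    (F1 : ∀ s t, F (s + n) t = F s t) (F2 : ∀ s t, F s (t + m) = F s t)
    (g1 : ∀ s t, g (s + n) t = g s t) (g2 : ∀ s t, g s (t + m) = g s t) :
    ∃ s1 t1, (∀ s t, F s t ≤ F s1 t1) ∧ ∀ s t, F s t = F s1 t1 → g s1 t1 ≤ g s t := by
  have red : ∀ s t, ∃ s' ∈ Icc 0 n, ∃ t' ∈ Icc 0 m, F s' t' = F s t ∧ g s' t' = g s t := by
    intro s t
    obtain ⟨k, hk, -⟩ := existsUnique_add_zsmul_mem_Ico hn s 0
    obtain ⟨l, hl, -⟩ := existsUnique_add_zsmul_mem_Ico hm t 0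
    rw [zero_add] at hk hl
    refine ⟨_, ⟨hk.1, hk.2.le⟩, _, ⟨hl.1, hl.2.le⟩, ?_, ?_⟩
    · exact ((show Function.Periodic (fun s => F s (t + l • m)) n from fun s => F1 s _).zsmul k s).trans
        ((show Function.Periodic (fun t => F s t) m from fun t => F2 s _).zsmul l t)
    · exact ((show Function.Periodic (fun s => g s (t + l • m)) n from fun s => g1 s _).zsmul k s).trans
        ((show Function.Periodic (fun t => g s t) m from fun t => g2 s _).zsmul l t)
  have hc : IsCompact ((Icc 0 n) ×ˢ (Icc 0 m)) := isCompact_Icc.prod isCompact_Icc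
  obtain ⟨p, hp, hpmax⟩ := hc.exists_isMaxOn ⟨(0, 0), ⟨⟨le_rfl, hn.le⟩, ⟨le_rfl, hm.le⟩⟩⟩ hF.continuousOn
  have hc2 : IsCompact (((Icc 0 n) ×ˢ (Icc 0 m)) ∩ {p' : ℝ × ℝ | F p'.1 p'.2 = F p.1 p.2}) :=
    hc.inter_right (isClosed_eq hF continuous_const)
  obtain ⟨r, hr, hrmin⟩ := hc2.exists_isMinOn ⟨p, hp, rfl⟩ hg.continuousOn
  refine ⟨r.1, r.2, fun s t => ?_, fun s t hst => ?_⟩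
  · obtain ⟨s', hs', t', ht', e, -⟩ := red s t
    rw [← e, hr.2]
    exact hpmax (show (s', t') ∈ _ from ⟨hs', ht'⟩)
  · obtain ⟨s', hs', t', ht', e, e'⟩ := red s t
    rw [← e']
    exact hrmin (show (s', t') ∈ _ from ⟨⟨hs', ht'⟩, by simp only [mem_setOf_eq]; rw [e, hst]; exact hr.2⟩)

lemma not_slit {w : ℂ} (h : w ∉ Complex.slitPlane) : ∃ ρ : ℝ, 0 ≤ ρ ∧ w = -ρ := by
  rw [Complex.mem_slitPlane_iff, not_or, not_not, not_lt] at h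
  exact ⟨-w.re, by linarith [h.1], by apply Complex.ext <;> simp [h.2]⟩

lemma encl_core {x m : ℝ → ℂ} (hx : Continuous x) (hm : Continuous m) {F : ℝ → ℝ → ℝ}
    (hF : Continuous fun p : ℝ × ℝ => F p.1 p.2) (hdir : ∀ s t, Dir (x s - m t) (F s t))
    {s1 s2 t1 t2 ts : ℝ} {α μ : ℝ} (ha0 : 0 < α) (ha1 : α < 1) (hm0 : 0 < μ) (hm1 : μ < 1)
    (N1 : ∀ t (κ : ℝ), 0 < κ → κ < 1 → x s1 - m t ≠ κ * (x s1 - m t1))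
    (N2 : ∀ t (κ : ℝ), 0 < κ → κ < 1 → x s2 - m t ≠ κ * (x s2 - m t2))
    (hD : x s2 - m t1 = α * (x s1 - m t1) + μ * (x s2 - m t2))
    (l1 : F s1 t1 - 2 * π < F s2 t1) (l2 : F s2 t1 < F s1 t1 - π)
    {q : ℂ} (hq : q = m t1 + α * (x s1 - m t1))
    (hfar : ∀ s, ‖x s - q‖ ≤ ‖m ts - q‖) : False := by
  have hxm : ∀ s t, x s - m t ≠ 0 := fun s t => (hdir s t).ne
  have e1 : x s1 - q = (1 - α : ℝ) * (x s1 - m t1) := by rw [hq]; push_cast; ring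
  have e2 : x s2 - q = μ * (x s2 - m t2) := by
    rw [hq, ← sub_sub, hD]; ring
  have hqm : ∀ t, q - m t ≠ 0 := fun t h => by
    rw [sub_eq_zero] at h
    exact N2 t μ hm0 hm1 (by rw [← e2, h])
  refine encl hx hm hF hdir (q := q) (s1 := s1) (s2 := s2) (t1 := t1) (ts := ts) ?_ ?_ ?_ hfar
  · intro t
    by_contra h
    obtain ⟨ρ, hρ, e⟩ := not_slit h
    rw [div_eq_iff (hxm s1 t)] at e
    have h1 : (1 + ρ : ℂ) ≠ 0 := by exact_mod_cast (by linarith : (1 + ρ : ℝ) ≠ 0)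
    refine N1 t ((1 - α) / (1 + ρ)) (by apply div_pos <;> linarith)
      (by rw [div_lt_one (by linarith)]; linarith) ?_
    push_cast
    rw [div_mul_eq_mul_div, eq_div_iff h1]
    push_cast at e1
    rw [← e1]
    linear_combination e
  · intro t
    by_contra h
    obtain ⟨ρ, hρ, e⟩ := not_slit h
    rw [div_eq_iff (hqm t)] at e
    have h1 : (1 + ρ : ℂ) ≠ 0 := by exact_mod_cast (by linarith : (1 + ρ : ℝ) ≠ 0)
    have hρ0 : 0 < ρ := by
      rcases hρ.eq_or_lt with h0 | h0
      · rw [← h0] at e; simp at e; exact absurd e (hxm s2 t)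
      · exact h0
    refine N2 t (ρ * μ / (1 + ρ)) (by positivity)
      (by rw [div_lt_one (by linarith)]; nlinarith) ?_
    push_cast
    rw [div_mul_eq_mul_div, eq_div_iff h1, mul_assoc, ← e2]
    linear_combination e
  · have a1 : Complex.arg ((q - m t1) / (x s1 - m t1)) = 0 := by
      rw [hq, add_sub_cancel_left, mul_div_cancel_right₀ _ (hxm s1 t1)]
      exact Complex.arg_ofReal_of_nonneg ha0.le
    have a2 : Complex.arg ((x s2 - m t1) / (q - m t1)) = F s2 t1 - F s1 t1 + 2 * π := by
      have d : Dir (q - m t1) (F s1 t1) := by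
        rw [hq, add_sub_cancel_left]; exact (hdir s1 t1).smul ha0
      have d2 := ((hdir s2 t1).div d).add_two_pi
      obtain ⟨k, hk⟩ := (dir_arg d2.ne).unique d2
      have hp := Real.pi_pos
      have u1 := Complex.neg_pi_lt_arg ((x s2 - m t1) / (q - m t1))
      have u2 := Complex.arg_le_pi ((x s2 - m t1) / (q - m t1))
      have hk0 : k = 0 := by
        have i1 : (k : ℝ) < 1 := by nlinarith
        have i2 : (-1 : ℝ) < k := by nlinarith
        have i1' : k < 1 := by exact_mod_cast i1
        have i2' : -1 < k := by exact_mod_cast i2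
        omega
      rw [hk, hk0]; simp
    rw [a1, a2]
    have := Real.pi_pos
    intro h; linarith

lemma cone_id (C A W : ℝ) : (sin (W - A) : ℂ) * cis C = sin (W - C) * cis A + sin (C - A) * cis W := by
  apply Complex.ext
  · simp only [Complex.add_re, Complex.re_ofReal_mul, cis_re, ← Complex.ofReal_sin, ← Complex.ofReal_sub, sin_sub]
    ring
  · simp only [Complex.add_im, Complex.im_ofReal_mul, cis_im, ← Complex.ofReal_sin, ← Complex.ofReal_sub, sin_sub]
    ring

lemma dir_eq_of_lt {w : ℂ} {a b : ℝ} (ha : Dir w a) (hb : Dir w b) (h1 : a - b < 2 * π)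
    (h2 : b - a < 2 * π) : a = b := by
  obtain ⟨k, hk⟩ := ha.unique hb
  have hp := Real.pi_pos
  have i1 : (k : ℝ) < 1 := by nlinarith
  have i2 : (-1 : ℝ) < k := by nlinarith
  have i1' : k < 1 := by exact_mod_cast i1
  have i2' : -1 < k := by exact_mod_cast i2
  have : k = 0 := by omega
  rw [hk, this]; simp

lemma exists_far {x : ℝ → ℂ} {n : ℝ} (hn : 0 < n) (hx : Continuous x) (hp : ∀ s, x (s + n) = x s)
    (q : ℂ) : ∃ s0, ∀ s, ‖x s - q‖ ≤ ‖x s0 - q‖ := by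
  obtain ⟨s0, h⟩ := Loop.exists_min_per (F := fun s => - ‖x s - q‖) hn
    ((hx.sub continuous_const).norm.neg) (fun s => by rw [hp])
  exact ⟨s0, fun s => by have := h s; linarith⟩

theorem Sys.osc2 {δ K L γ ζ} (S : Sys δ K L γ ζ) {z : ℂ} (hz : z ∉ K + L) {F : ℝ → ℝ → ℝ}
    (hF : Continuous fun p : ℝ × ℝ => F p.1 p.2)
    (hdir : ∀ s t, Dir (γ.x s + ζ.x t - z) (F s t)) :
    ∃ A B, A - B ≤ 2 * π - δ ∧ ∀ s t, B ≤ F s t ∧ F s t ≤ A := by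
  have hpi := Real.pi_pos
  have hδ0 := S.hδ0
  have hδ := S.hδ
  have hF' : Continuous fun p : ℝ × ℝ => F p.2 p.1 :=
    hF.comp (by fun_prop : Continuous fun p : ℝ × ℝ => (p.2, p.1))
  have hz' : z ∉ L + K := by rwa [add_comm]
  have sK := S.single hz hF hdir
  have sL := S.swap.single hz' (F := fun t s => F s t) hF' (fun t s => by
    have := hdir s t; rwa [add_comm (γ.x s)] at this)
  have hxc := γ.xcont
  have hyc := ζ.xcont
  have gc : Continuous fun p : ℝ × ℝ => ‖γ.x p.1 + ζ.x p.2 - z‖ := by fun_prop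
  obtain ⟨s1, t1, hmax, hmaxg⟩ := exists_max_min (g := fun s t => ‖γ.x s + ζ.x t - z‖) γ.npos ζ.npos hF gc
    (fun s t => (sK t).1 s) (fun s t => (sL s).1 t) (fun s t => by simp [γ.xper])
    (fun s t => by simp [ζ.xper])
  obtain ⟨s2, t2, hmin, hming⟩ := exists_max_min (F := fun s t => - F s t) (g := fun s t => ‖γ.x s + ζ.x t - z‖) γ.npos ζ.npos hF.neg gc
    (fun s t => by simp [(sK t).1 s]) (fun s t => by simpa using (sL s).1 t) (fun s t => by simp [γ.xper])
    (fun s t => by simp [ζ.xper])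
  have hmin : ∀ s t, F s2 t2 ≤ F s t := fun s t => by have := hmin s t; linarith
  have hming : ∀ s t, F s t = F s2 t2 → ‖γ.x s2 + ζ.x t2 - z‖ ≤ ‖γ.x s + ζ.x t - z‖ :=
    fun s t h => hming s t (by rw [h])
  refine ⟨F s1 t1, F s2 t2, ?_, fun s t => ⟨hmin s t, hmax s t⟩⟩
  have hFt : ∀ t, Continuous fun s => F s t := fun t =>
    hF.comp (by fun_prop : Continuous fun s : ℝ => (s, t))
  have hFs : ∀ s, Continuous fun t => F s t := fun s =>
    hF.comp (by fun_prop : Continuous fun t : ℝ => (s, t))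
  have oK : ∀ t s s', F s t - F s' t ≤ 2 * π - δ := fun t => (sK t).2
  have oL : ∀ s t t', F s t - F s t' ≤ 2 * π - δ := fun s => (sL s).2
  have dK := Loop.dich γ hδ S.aK (z1 := z - ζ.x t1) (z2 := z - ζ.x t2) (hFt t1) (hFt t2) (sK t1).1 (sK t2).1
    (fun s => by have := hdir s t1; rwa [show γ.x s - (z - ζ.x t1) = γ.x s + ζ.x t1 - z by ring])
    (fun s => by have := hdir s t2; rwa [show γ.x s - (z - ζ.x t2) = γ.x s + ζ.x t2 - z by ring])
    (s1 := s1) (s2 := s2) (fun s => hmax s t1) (fun s => by linarith [oK t1 s1 s])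
    (fun s => hmin s t2) (fun s => by linarith [oK t2 s s2]) (by linarith [oL s2 t1 t2])
    (by linarith [oL s1 t1 t2])
  have dL := Loop.dich ζ hδ S.aL (z1 := z - γ.x s1) (z2 := z - γ.x s2) (hFs s1) (hFs s2) (sL s1).1 (sL s2).1
    (fun t => by have := hdir s1 t; rwa [show ζ.x t - (z - γ.x s1) = γ.x s1 + ζ.x t - z by ring])
    (fun t => by have := hdir s2 t; rwa [show ζ.x t - (z - γ.x s2) = γ.x s2 + ζ.x t - z by ring])
    (s1 := t1) (s2 := t2) (fun t => hmax s1 t) (fun t => by linarith [oL s1 t1 t])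
    (fun t => hmin s2 t) (fun t => by linarith [oL s2 t t2]) (by linarith [oK t2 s1 s2])
    (by linarith [oK t1 s1 s2])
  by_contra hcon
  have h3 : 3 * π ≤ F s1 t1 - F s2 t2 := by
    rcases dK with h | h | h
    · exact absurd h hcon
    · rcases dL with h' | h' | h'
      · exact absurd h' hcon
      · linarith
      · exact h'
    · exact h
  -- now exclude
  have C1 := oL s1 t1 t2
  have C2 := oK t2 s1 s2
  have D1 := oK t1 s1 s2
  have D2 := oL s2 t1 t2
  set A := F s1 t1 with hA
  set B := F s2 t2 with hB
  set C := F s1 t2 with hC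
  set D := F s2 t1 with hD
  set a := ‖γ.x s1 + ζ.x t1 - z‖ with ha
  set b := ‖γ.x s2 + ζ.x t2 - z‖ with hb
  set c := ‖γ.x s1 + ζ.x t2 - z‖ with hc
  set d := ‖γ.x s2 + ζ.x t1 - z‖ with hd
  have ea := dir_norm (hdir s1 t1)
  have eb := dir_norm (hdir s2 t2)
  have ec := dir_norm (hdir s1 t2)
  have ed := dir_norm (hdir s2 t1)
  have pa : 0 < a := norm_pos_iff.2 (hdir s1 t1).ne
  have pb : 0 < b := norm_pos_iff.2 (hdir s2 t2).ne
  have pc : 0 < c := norm_pos_iff.2 (hdir s1 t2).ne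
  have pd : 0 < d := norm_pos_iff.2 (hdir s2 t1).ne
  rw [← ha, ← hA] at ea
  rw [← hb, ← hB] at eb
  rw [← hc, ← hC] at ec
  rw [← hd, ← hD] at ed
  have rel : (a : ℂ) * cis A + b * cis B = c * cis C + d * cis D := by
    rw [← ea, ← eb, ← ec, ← ed]; ring
  have x1 : a * sin (A - A) + b * sin (B - A) = c * sin (C - A) + d * sin (D - A) := by
    have := congrArg (fun w => (w * cis (-A)).im) rel
    simpa only [add_mul, mul_assoc, ← cis_add, Complex.add_im, Complex.im_ofReal_mul, cis_im,
      ← sub_eq_add_neg] using this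
  have x2 : a * sin (A - B) + b * sin (B - B) = c * sin (C - B) + d * sin (D - B) := by
    have := congrArg (fun w => (w * cis (-B)).im) rel
    simpa only [add_mul, mul_assoc, ← cis_add, Complex.add_im, Complex.im_ofReal_mul, cis_im,
      ← sub_eq_add_neg] using this
  simp only [sub_self, sin_zero, mul_zero, zero_add, add_zero] at x1 x2
  have s_CA : 0 < sin (C - A) := by
    rw [← sin_add_two_pi]; exact sin_pos_of (by linarith) (by linarith)
  have s_DA : 0 < sin (D - A) := by
    rw [← sin_add_two_pi]; exact sin_pos_of (by linarith) (by linarith)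
  have s_BC : 0 < sin (B - C) := by
    rw [← sin_add_two_pi]; exact sin_pos_of (by linarith) (by linarith)
  have s_BD : 0 < sin (B - D) := by
    rw [← sin_add_two_pi]; exact sin_pos_of (by linarith) (by linarith)
  have s_BA : 0 < sin (B - A) := by
    have : 0 < b * sin (B - A) := by rw [x1]; positivity
    exact (mul_pos_iff_of_pos_left pb).1 this
  have y2 : a * sin (B - A) = c * sin (B - C) + d * sin (B - D) := by
    rw [← neg_sub A B, ← neg_sub C B, ← neg_sub D B, sin_neg, sin_neg, sin_neg]; linarith
  set σ := sin (B - A) with hσ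
  set α := d * sin (B - D) / (a * σ) with hα
  set μ := d * sin (D - A) / (b * σ) with hμ
  set α' := c * sin (B - C) / (a * σ) with hα'
  set μ' := c * sin (C - A) / (b * σ) with hμ'
  have sα : α + α' = 1 := by
    rw [hα, hα', ← add_div, div_eq_one_iff_eq (by positivity)]; linarith
  have sμ : μ + μ' = 1 := by
    rw [hμ, hμ', ← add_div, div_eq_one_iff_eq (by positivity)]; linarith
  have pα : 0 < α := by positivity
  have pα' : 0 < α' := by positivity
  have pμ : 0 < μ := by positivity
  have pμ' : 0 < μ' := by positivity
  have na : (a : ℂ) ≠ 0 := by exact_mod_cast pa.ne'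
  have nb : (b : ℂ) ≠ 0 := by exact_mod_cast pb.ne'
  have nσ : (σ : ℂ) ≠ 0 := by exact_mod_cast s_BA.ne'
  have vD : γ.x s2 + ζ.x t1 - z = α * (γ.x s1 + ζ.x t1 - z) + μ * (γ.x s2 + ζ.x t2 - z) := by
    rw [ea, eb, ed, hα, hμ]
    have := cone_id D A B
    rw [← hσ] at this
    generalize sin (B - D) = u1 at this ⊢
    generalize sin (D - A) = u2 at this ⊢
    push_cast
    field_simp
    linear_combination d * this
  have vC : γ.x s1 + ζ.x t2 - z = α' * (γ.x s1 + ζ.x t1 - z) + μ' * (γ.x s2 + ζ.x t2 - z) := by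
    have e1 : (α' : ℂ) = 1 - α := by rw [eq_sub_iff_add_eq, add_comm]; exact_mod_cast sα
    have e2 : (μ' : ℂ) = 1 - μ := by rw [eq_sub_iff_add_eq, add_comm]; exact_mod_cast sμ
    rw [e1, e2]
    linear_combination -vD
  have N1 : ∀ s t (κ : ℝ), (F s t - A < 2 * π) → (A - F s t < 2 * π) → 0 < κ → κ < 1 →
      γ.x s + ζ.x t - z ≠ κ * (γ.x s1 + ζ.x t1 - z) := by
    intro s t κ i1 i2 hκ0 hκ1 e
    have dd := (hdir s1 t1).smul hκ0
    rw [← e] at dd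
    have := hmaxg s t (dir_eq_of_lt (hdir s t) dd i1 i2)
    rw [e, norm_mul, Complex.norm_real, Real.norm_of_nonneg hκ0.le] at this
    change a ≤ κ * a at this
    nlinarith
  have N2 : ∀ s t (κ : ℝ), (F s t - B < 2 * π) → (B - F s t < 2 * π) → 0 < κ → κ < 1 →
      γ.x s + ζ.x t - z ≠ κ * (γ.x s2 + ζ.x t2 - z) := by
    intro s t κ i1 i2 hκ0 hκ1 e
    have dd := (hdir s2 t2).smul hκ0
    rw [← e] at dd
    have := hming s t (dir_eq_of_lt (hdir s t) dd i1 i2)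
    rw [e, norm_mul, Complex.norm_real, Real.norm_of_nonneg hκ0.le] at this
    change b ≤ κ * b at this
    nlinarith
  set q := (z - ζ.x t1) + α * (γ.x s1 + ζ.x t1 - z) with hq
  obtain ⟨ss, hss⟩ := exists_far γ.npos γ.xcont γ.xper q
  obtain ⟨ts, hts⟩ := exists_far ζ.npos ζ.xcont ζ.xper (z - q)
  have rw1 : ∀ t, ‖(z - ζ.x t) - q‖ = ‖ζ.x t - (z - q)‖ := fun t => by
    rw [← norm_neg]; congr 1; ring
  have rw2 : ∀ s, ‖(z - γ.x s) - (z - q)‖ = ‖γ.x s - q‖ := fun t => by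
    rw [← norm_neg]; congr 1; ring
  rcases le_total ‖γ.x ss - q‖ ‖ζ.x ts - (z - q)‖ with hle | hle
  · refine encl_core (x := γ.x) (m := fun t => z - ζ.x t) hxc (by fun_prop) hF
      (fun s t => by have := hdir s t; rwa [show γ.x s - (z - ζ.x t) = γ.x s + ζ.x t - z by ring])
      (s1 := s1) (s2 := s2) (t1 := t1) (t2 := t2) (ts := ts) pα (by linarith) pμ (by linarith)
      ?_ ?_ ?_ (by linarith) (by linarith) (q := q) ?_ ?_
    · intro t κ h1 h2
      rw [← sub_add, ← sub_add, sub_add_eq_add_sub, sub_add_eq_add_sub]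
      exact N1 s1 t κ (by linarith [oL s1 t t1]) (by linarith [oL s1 t1 t]) h1 h2
    · intro t κ h1 h2
      rw [← sub_add, ← sub_add, sub_add_eq_add_sub, sub_add_eq_add_sub]
      exact N2 s2 t κ (by linarith [oL s2 t t2]) (by linarith [oL s2 t2 t]) h1 h2
    · linear_combination vD
    · rw [hq]; ring
    · intro s
      simp only [rw1]
      exact (hss s).trans hle
  · refine encl_core (x := ζ.x) (m := fun s => z - γ.x s) hyc (by fun_prop) hF'
      (fun t s => by have := hdir s t; rwa [show ζ.x t - (z - γ.x s) = γ.x s + ζ.x t - z by ring])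
      (s1 := t1) (s2 := t2) (t1 := s1) (t2 := s2) (ts := ss) pα' (by linarith) pμ' (by linarith)
      ?_ ?_ ?_ (by linarith) (by linarith) (q := z - q) ?_ ?_
    · intro s κ h1 h2
      have := N1 s t1 κ (by linarith [oK t1 s s1]) (by linarith [oK t1 s1 s]) h1 h2
      intro h; apply this; linear_combination h
    · intro s κ h1 h2
      have := N2 s t2 κ (by linarith [oK t2 s s2]) (by linarith [oK t2 s2 s]) h1 h2
      intro h; apply this; linear_combination h
    · linear_combination vC
    · have e1 : (α' : ℂ) = 1 - α := by rw [eq_sub_iff_add_eq, add_comm]; exact_mod_cast sα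
      rw [hq, e1]; ring
    · intro t
      simp only [rw2]
      exact (hts t).trans hle

end MS
end

section
open Filter
set_option linter.all false
namespace MS

/-- Regular compact sets all of whose exterior points see infinity in a cone. -/
structure Reg (δ : ℝ) (N : Set ℂ) : Prop where
  hδ0 : 0 < δ
  compact : IsCompact N
  regular : N = closure (interior N)
  nonempty : (interior N).Nonempty
  conn : IsPreconnected (interior N)
  fc : ∀ z, z ∉ interior N → FC N δ z

lemma PolyC.reg {K : Set ℂ} {γ : Loop 1} (P : PolyC K γ) {δ : ℝ} (hδ0 : 0 < δ) (hδ : δ ≤ π)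
    (haco : γ.Aco δ) : Reg δ K :=
  ⟨hδ0, P.compact, P.regular, P.nonempty_interior, P.preconn_interior,
    fun z hz => P.FC_ext hδ0 hδ haco hz⟩

lemma frontier_add {K L : Set ℂ} (hK : IsCompact K) (hL : IsCompact L) :
    frontier (K + L) ⊆ frontier K + frontier L := by
  intro z hz
  have hz1 : z ∈ K + L := (hK.add hL).isClosed.frontier_subset hz
  obtain ⟨k, hk, l, hl, rfl⟩ := hz1
  refine ⟨k, ?_, l, ?_, rfl⟩
  · refine ⟨subset_closure hk, fun hi => hz.2 ?_⟩
    have : interior K + L ⊆ interior (K + L) :=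
      interior_maximal (add_subset_add_right interior_subset) isOpen_interior.add_right
    exact this ⟨k, hi, l, hl, rfl⟩
  · refine ⟨subset_closure hl, fun hi => hz.2 ?_⟩
    have : K + interior L ⊆ interior (K + L) :=
      interior_maximal (add_subset_add_left interior_subset) isOpen_interior.add_left
    exact this ⟨k, hk, l, hi, rfl⟩

theorem Sys.reg {δ K L γ ζ} (S : Sys δ K L γ ζ) : Reg δ (K + L) := by
  have hc : IsCompact (K + L) := S.P.compact.add S.Q.compact
  have hG : interior K + interior L ⊆ interior (K + L) :=
    interior_maximal (add_subset_add interior_subset interior_subset) isOpen_interior.add_right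
  have hcl : K + L ⊆ closure (interior K + interior L) := by
    rintro _ ⟨k, hk, l, hl, rfl⟩
    rw [S.P.regular] at hk
    rw [S.Q.regular] at hl
    exact map_mem_closure₂ continuous_add hk hl (fun a ha b hb => ⟨a, ha, b, hb, rfl⟩)
  have hreg : K + L = closure (interior (K + L)) := by
    apply Subset.antisymm
    · exact hcl.trans (closure_mono hG)
    · exact closure_minimal interior_subset hc.isClosed
  have hGc : IsPreconnected (interior K + interior L) := by
    have := (S.P.preconn_interior.prod S.Q.preconn_interior).image (fun p : ℂ × ℂ => p.1 + p.2)
      continuous_add.continuousOn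
    rwa [image_prod, image2_add] at this
  refine ⟨S.hδ0, hc, hreg, ?_, ?_, ?_⟩
  · obtain ⟨k, hk⟩ := S.P.nonempty_interior
    obtain ⟨l, hl⟩ := S.Q.nonempty_interior
    exact ⟨k + l, hG ⟨k, hk, l, hl, rfl⟩⟩
  · exact hGc.subset_closure hG (interior_subset.trans hcl)
  · have key : (K + L)ᶜ ⊆ {z | FC (K + L) δ z} := by
      intro z hz
      have off : ∀ s t, γ.x s + ζ.x t - z ≠ 0 := fun s t h => hz
        ⟨_, S.P.range_sub ⟨s, rfl⟩, _, S.Q.range_sub ⟨t, rfl⟩, sub_eq_zero.1 h⟩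
      have hxc := γ.xcont
      have hyc := ζ.xcont
      obtain ⟨F, hF, hd⟩ := lift_exists isOpen_univ convex_univ (univ_nonempty (α := ℝ × ℝ))
        (f := fun p => γ.x p.1 + ζ.x p.2 - z) (by fun_prop) (fun p _ => off p.1 p.2)
      obtain ⟨A, B, hAB, h⟩ := S.osc2 hz (F := fun s t => F (s, t))
        (by simpa using continuousOn_univ.1 hF) (fun s t => hd (s, t) trivial)
      refine ⟨A + δ / 2, fun φ h1 h2 => free_of_frontier hc.isClosed hz ?_⟩
      intro r hr hmem
      obtain ⟨k, hk, l, hl, e⟩ := frontier_add S.P.compact S.Q.compact hmem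
      rw [S.P.boundary] at hk
      rw [S.Q.boundary] at hl
      obtain ⟨s, rfl⟩ := hk
      obtain ⟨t, rfl⟩ := hl
      have d1 := hd (s, t) trivial
      have d2 : Dir (γ.x s + ζ.x t - z) φ := by
        simp only at e
        rw [e, add_sub_cancel_left]; exact dir_mk hr φ
      have := h s t
      have := S.hδ0
      have h3 := dir_eq_of_lt d1 d2 (by simp only at *; linarith) (by simp only at *; linarith)
      simp only at *
      linarith
    intro z hz
    have hcl2 := FC_closed hreg S.hδ0
    have := closure_minimal key hcl2
    rw [closure_compl] at this
    exact this hz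

namespace Reg
variable {δ : ℝ} {N : Set ℂ}

lemma free (R : Reg δ N) {z : ℂ} (hz : z ∉ interior N) : ∃ ω, Free N z ω := (R.fc z hz).free R.hδ0

lemma preconn_compl (R : Reg δ N) : IsPreconnected (Nᶜ) := by
  obtain ⟨M, hM0, hM⟩ := R.compact.isBounded.exists_pos_norm_le
  -- outside of the big disc
  have hout : IsPreconnected ((fun p : ℝ × ℝ => (p.1 : ℂ) * cis p.2) '' (Ioi M ×ˢ univ)) := by
    apply (isPreconnected_Ioi.prod isPreconnected_univ).image
    have := cis_cont
    exact Continuous.continuousOn (by fun_prop)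
  set O := (fun p : ℝ × ℝ => (p.1 : ℂ) * cis p.2) '' (Ioi M ×ˢ univ) with hO
  have hOm : ∀ w : ℂ, M < ‖w‖ → w ∈ O := fun w hw =>
    ⟨(‖w‖, w.arg), ⟨hw, trivial⟩, (dir_norm (dir_arg (norm_pos_iff.1 (hM0.trans hw)))).symm⟩
  have hON : O ⊆ Nᶜ := by
    rintro _ ⟨⟨r, φ⟩, ⟨hr, -⟩, rfl⟩ hm
    have := hM _ hm
    simp only [mem_Ioi] at hr
    simp [norm_cis, abs_of_pos (hM0.trans hr)] at this
    linarith
  apply isPreconnected_of_forall ((M + 1 : ℝ) : ℂ)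
  intro z hz
  obtain ⟨ω, hω⟩ := R.free (fun h => hz (interior_subset h))
  refine ⟨O ∪ (fun r : ℝ => z + r * cis ω) '' Ici 0, ?_, ?_, ?_, ?_⟩
  · apply union_subset hON
    rintro _ ⟨r, hr, rfl⟩
    rcases (mem_Ici.1 hr).eq_or_lt with h | h
    · simpa [← h] using hz
    · exact hω r h
  · left; apply hOm
    rw [Complex.norm_real, Real.norm_of_nonneg] <;> linarith
  · right; exact ⟨0, by simp, by simp⟩
  · refine IsPreconnected.union (z + (‖z‖ + M + 1 : ℝ) * cis ω) ?_ ?_ hout (ray_preconn z ω)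
    · apply hOm
      have h1 : ‖((‖z‖ + M + 1 : ℝ) : ℂ) * cis ω‖ = ‖z‖ + M + 1 := by
        rw [norm_mul, norm_cis, mul_one, Complex.norm_real, Real.norm_of_nonneg (by positivity)]
      have h2 := norm_sub_le (z + (‖z‖ + M + 1 : ℝ) * cis ω) z
      rw [add_sub_cancel_left, h1] at h2
      linarith
    · exact ⟨_, by simp; positivity, rfl⟩

end Reg
end MS
end

section
open Filter
set_option linter.all false
namespace MS

lemma FC_limit {K : Set ℂ} (hreg : K = closure (interior K)) {δ : ℝ} (hδ : 0 < δ) {u : ℕ → ℂ} {z : ℂ}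
    (hu : ∀ k, FC K δ (u k)) (hz : Tendsto u atTop (nhds z)) :
    ∃ ωs, (∀ φ, ωs - δ / 2 < φ → φ < ωs + δ / 2 → Free K z φ) ∧
      ∀ φ, ωs - δ / 2 < φ → φ < ωs + δ / 2 → ∃ᶠ k in atTop, Free K (u k) φ := by
  have : ∀ k, ∃ ω ∈ Icc (0:ℝ) (2 * π), ∀ φ, ω - δ / 2 < φ → φ < ω + δ / 2 → Free K (u k) φ := by
    intro k
    obtain ⟨ω, hω⟩ := hu k
    obtain ⟨m, ⟨h1, h2⟩, -⟩ := existsUnique_add_zsmul_mem_Ioc Real.two_pi_pos ω 0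
    rw [zsmul_eq_mul] at h1 h2
    refine ⟨_, ⟨h1.le, by linarith⟩, fun φ g1 g2 => ?_⟩
    have := (hω (φ - m * (2 * π)) (by linarith) (by linarith)).int m
    rwa [sub_add_cancel] at this
  choose ω hω1 hω2 using this
  obtain ⟨ωs, -, σ, hσ, hlim⟩ := isCompact_Icc.tendsto_subseq hω1
  have hfr : ∀ φ, ωs - δ / 2 < φ → φ < ωs + δ / 2 → ∃ᶠ k in atTop, Free K (u k) φ := by
    intro φ h1 h2
    have e2 : ∀ᶠ k in atTop, ω (σ k) < φ + δ / 2 := hlim.eventually_lt_const (by linarith)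
    have e3 : ∀ᶠ k in atTop, φ - δ / 2 < ω (σ k) := hlim.eventually_const_lt (by linarith)
    apply hσ.tendsto_atTop.frequently
    apply Eventually.frequently
    filter_upwards [e2, e3] with k k2 k3
    exact hω2 (σ k) φ (by linarith) (by linarith)
  refine ⟨ωs, ?_, hfr⟩
  have hinter : ∀ φ, ωs - δ / 2 < φ → φ < ωs + δ / 2 → ∀ r : ℝ, 0 < r →
      z + r * cis φ ∉ interior K := by
    intro φ h1 h2 r hr hmem
    have e1 : ∀ᶠ k in atTop, u k + r * cis φ ∈ interior K :=
      (hz.add_const (r * cis φ)).eventually (isOpen_interior.mem_nhds hmem)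
    obtain ⟨k, k1, k2⟩ := ((hfr φ h1 h2).and_eventually e1).exists
    exact k1 r hr (interior_subset k2)
  intro φ h1 h2 r hr hmem
  rw [hreg] at hmem
  have := polar_near z hr φ (η := min (φ - (ωs - δ / 2)) (ωs + δ / 2 - φ))
    (lt_min (by linarith) (by linarith))
  obtain ⟨w, hw, r', φ', g1, g2, g3⟩ := (mem_closure_iff_frequently.1 hmem).and_eventually this |>.exists
  rw [lt_min_iff, abs_lt, abs_lt] at g2
  exact hinter φ' (by linarith) (by linarith) r' g1 (g3 ▸ hw)

/-- infinite open sector -/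
def isec (z : ℂ) (a b : ℝ) : Set ℂ := {w | ∃ r φ : ℝ, 0 < r ∧ a < φ ∧ φ < b ∧ w = z + r * cis φ}

lemma isec_open (z : ℂ) (a b : ℝ) : IsOpen (isec z a b) := by
  rw [isOpen_iff_mem_nhds]
  rintro _ ⟨r, φ, hr, h1, h2, rfl⟩
  filter_upwards [polar_near z hr φ (η := min (φ - a) (b - φ)) (lt_min (by linarith) (by linarith))]
  rintro w ⟨r', φ', g1, g2, g3⟩
  rw [lt_min_iff, abs_lt, abs_lt] at g2
  exact ⟨r', φ', g1, by linarith, by linarith, g3⟩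

lemma isec_disj (z : ℂ) {a b c : ℝ} (h : c ≤ a + 2 * π) : Disjoint (isec z a b) (isec z b c) := by
  rw [disjoint_left]
  rintro w ⟨r, φ, hr, h1, h2, rfl⟩ ⟨r', φ', hr', h1', h2', e⟩
  have e' : (r : ℂ) * cis φ = r' * cis φ' := add_left_cancel e
  have d1 := dir_mk hr φ
  have d2 := dir_mk hr' φ'
  rw [← e'] at d2
  have := dir_eq_of_lt d1 d2 (by linarith [Real.pi_pos]) (by linarith)
  linarith

/-- direction `φ` is parallel to a line of the arrangement through `z` -/
def TDir (ls : Finset (ℂ × ℂ)) (z : ℂ) (φ : ℝ) : Prop :=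
  ∃ p ∈ ls, (∃ t : ℝ, z = p.1 + t * p.2) ∧ ∃ t : ℝ, cis φ = t * p.2

def OnLines (ls : Finset (ℂ × ℂ)) (N : Set ℂ) : Prop :=
  (∀ p ∈ ls, p.2 ≠ 0) ∧ ∀ w ∈ frontier N, ∃ p ∈ ls, ∃ t : ℝ, w = p.1 + t * p.2

lemma line_closed (a d : ℂ) : IsClosed {w : ℂ | ∃ t : ℝ, w = a + t * d} := by
  have h : IsClosed ((ℝ ∙ d : Submodule ℝ ℂ) : Set ℂ) := Submodule.closed_of_finiteDimensional _
  have : {w : ℂ | ∃ t : ℝ, w = a + t * d} = (fun w => w - a) ⁻¹' ((ℝ ∙ d : Submodule ℝ ℂ) : Set ℂ) := by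
    ext w
    simp only [mem_setOf_eq, mem_preimage, SetLike.mem_coe, Submodule.mem_span_singleton]
    refine exists_congr fun t => ?_
    rw [Complex.real_smul]
    constructor
    · rintro rfl; ring
    · intro h; rw [h]; ring
  rw [this]
  exact h.preimage (by fun_prop)

lemma tdir_of {ls : Finset (ℂ × ℂ)} {N : Set ℂ} (h : OnLines ls N) (z : ℂ) :
    ∃ ρ > 0, ∀ r φ : ℝ, 0 < r → r < ρ → z + r * cis φ ∈ frontier N → TDir ls z φ := by
  have : ∀ᶠ w in nhds z, ∀ p ∈ ls, (∃ t : ℝ, w = p.1 + t * p.2) → ∃ t : ℝ, z = p.1 + t * p.2 := by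
    rw [Filter.eventually_all_finset]
    intro p hp
    by_cases hz : ∃ t : ℝ, z = p.1 + t * p.2
    · exact Eventually.of_forall fun w _ => hz
    · filter_upwards [(line_closed p.1 p.2).isOpen_compl.mem_nhds hz] with w hw hw'
      exact absurd hw' hw
  obtain ⟨ρ, hρ, hb⟩ := Metric.eventually_nhds_iff.1 this
  refine ⟨ρ, hρ, fun r φ hr hr' hm => ?_⟩
  obtain ⟨p, hp, t, ht⟩ := h.2 _ hm
  obtain ⟨t', ht'⟩ := hb (y := z + r * cis φ) (by simp [norm_cis, abs_of_pos hr, hr']) p hp ⟨t, ht⟩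
  refine ⟨p, hp, ⟨t', ht'⟩, (t - t') / r, ?_⟩
  have hr0 : (r : ℂ) ≠ 0 := by exact_mod_cast hr.ne'
  push_cast
  rw [div_mul_eq_mul_div, eq_div_iff hr0]
  linear_combination ht - ht'

lemma tdir_discrete {ls : Finset (ℂ × ℂ)} (h : ∀ p ∈ ls, p.2 ≠ 0) (z : ℂ) (φ : ℝ) :
    ∃ η > 0, ∀ φ', |φ' - φ| < η → φ' ≠ φ → ¬ TDir ls z φ' := by
  have : ∀ᶠ φ' in nhds φ, ∀ p ∈ ls, (∃ t : ℝ, cis φ' = t * p.2) → φ' = φ := by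
    rw [Filter.eventually_all_finset]
    intro p hp
    have hsin : ∀ ψ, (∃ t : ℝ, cis ψ = t * p.2) → sin (ψ - p.2.arg) = 0 := by
      rintro ψ ⟨t, ht⟩
      rw [dir_norm (dir_arg (h p hp))] at ht
      have := congrArg (fun w => (w * cis (-p.2.arg)).im) ht
      simp only [mul_assoc, ← cis_add, cis_im, Complex.im_ofReal_mul, ← sub_eq_add_neg, sub_self,
        sin_zero, mul_zero] at this
      exact this
    by_cases h0 : sin (φ - p.2.arg) = 0
    · have : ∀ᶠ φ' in nhds φ, |φ' - φ| < π := by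
        have := Metric.ball_mem_nhds φ Real.pi_pos
        filter_upwards [this] with x hx
        exact hx
      filter_upwards [this] with φ' h1 h2
      have h3 := hsin φ' h2
      have : sin (φ' - φ) = 0 := by
        rw [show φ' - φ = (φ' - p.2.arg) - (φ - p.2.arg) by ring, sin_sub, h0, h3]; simp
      rw [abs_lt] at h1
      linarith [zero_of_sin h1.1 h1.2 this]
    · have hc : Continuous fun ψ : ℝ => sin (ψ - p.2.arg) := by fun_prop
      filter_upwards [hc.continuousAt.eventually_ne h0] with φ' h1 h2
      exact absurd (hsin _ h2) h1
  obtain ⟨η, hη, hb⟩ := Metric.eventually_nhds_iff.1 this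
  exact ⟨η, hη, fun φ' h1 h2 ⟨p, hp, _, h3⟩ => h2 (hb (y := φ') h1 p hp h3)⟩

lemma off_frontier {N : Set ℂ} (hN : IsClosed N) {S : Set ℂ} (hS : IsPreconnected S)
    (h : ∀ w ∈ S, w ∉ frontier N) : S ⊆ interior N ∨ S ⊆ Nᶜ := by
  have hd : Disjoint (interior N) (Nᶜ) := disjoint_compl_right.mono_left interior_subset
  have hs : S ⊆ interior N ∪ Nᶜ := by
    intro w hw
    have := h w hw
    rw [frontier, hN.closure_eq] at this
    by_cases hwN : w ∈ N
    · left; by_contra hc; exact this ⟨hwN, hc⟩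
    · right; exact hwN
  rcases S.eq_empty_or_nonempty with h0 | ⟨w, hw⟩
  · left; simp [h0]
  rcases hs hw with h1 | h1
  · left; exact hS.subset_left_of_subset_union isOpen_interior hN.isOpen_compl hd hs ⟨w, hw, h1⟩
  · right; exact hS.subset_right_of_subset_union isOpen_interior hN.isOpen_compl hd hs ⟨w, hw, h1⟩

lemma loc3 {N : Set ℂ} (hN : IsClosed N) (hreg : N = closure (interior N))
    {z : ℂ} {ρ : ℝ} {φ η : ℝ} (hη : 0 < η)
    (h : ∀ r φ' : ℝ, 0 < r → r < ρ → |φ' - φ| < η → φ' ≠ φ → z + r * cis φ' ∉ frontier N) :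
    (∀ r φ' : ℝ, 0 < r → r < ρ → |φ' - φ| < η → z + r * cis φ' ∈ interior N) ∨
    (∀ r φ' : ℝ, 0 < r → r < ρ → |φ' - φ| < η → z + r * cis φ' ∈ Nᶜ) ∨
    ((∀ r, 0 < r → r < ρ → z + r * cis φ ∈ frontier N) ∧
      (((∀ r φ' : ℝ, 0 < r → r < ρ → φ - η < φ' → φ' < φ → z + r * cis φ' ∈ Nᶜ) ∧
        (∀ r φ' : ℝ, 0 < r → r < ρ → φ < φ' → φ' < φ + η → z + r * cis φ' ∈ interior N)) ∨
       ((∀ r φ' : ℝ, 0 < r → r < ρ → φ - η < φ' → φ' < φ → z + r * cis φ' ∈ interior N) ∧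
        (∀ r φ' : ℝ, 0 < r → r < ρ → φ < φ' → φ' < φ + η → z + r * cis φ' ∈ Nᶜ)))) := by
  have hL := off_frontier hN (sec_preconn z ρ (φ - η) φ) (by
    rintro _ ⟨r, φ', h1, h2, h3, h4, rfl⟩
    exact h r φ' h1 h2 (by rw [abs_lt]; constructor <;> linarith) h4.ne)
  have hR := off_frontier hN (sec_preconn z ρ φ (φ + η)) (by
    rintro _ ⟨r, φ', h1, h2, h3, h4, rfl⟩
    exact h r φ' h1 h2 (by rw [abs_lt]; constructor <;> linarith) h3.ne')
  have clL : ∀ r : ℝ, 0 < r → r < ρ → z + r * cis φ ∈ closure (sec z ρ (φ - η) φ) :=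
    fun r h1 h2 => mem_closure_sec (by linarith) h1.le h2 (by linarith) le_rfl
  have clR : ∀ r : ℝ, 0 < r → r < ρ → z + r * cis φ ∈ closure (sec z ρ φ (φ + η)) :=
    fun r h1 h2 => mem_closure_sec (by linarith) h1.le h2 le_rfl (by linarith)
  have split : ∀ A : Set ℂ, sec z ρ (φ - η) φ ⊆ A → sec z ρ φ (φ + η) ⊆ A →
      (∀ r : ℝ, 0 < r → r < ρ → z + r * cis φ ∈ A) →
      ∀ r φ' : ℝ, 0 < r → r < ρ → |φ' - φ| < η → z + r * cis φ' ∈ A := by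
    intro A h1 h2 h3 r φ' g1 g2 g3
    rw [abs_lt] at g3
    rcases lt_trichotomy φ' φ with g | g | g
    · exact h1 ⟨r, φ', g1, g2, by linarith, g, rfl⟩
    · rw [g]; exact h3 r g1 g2
    · exact h2 ⟨r, φ', g1, g2, g, by linarith, rfl⟩
  have nb : ∀ r : ℝ, 0 < r → r < ρ → ∀ᶠ w in nhds (z + r * cis φ),
      ∃ r' φ', 0 < r' ∧ r' < ρ ∧ |φ' - φ| < η ∧ w = z + r' * cis φ' := by
    intro r h1 h2
    have e : z + r * cis φ ∈ Metric.ball z ρ := by simp [norm_cis, abs_of_pos h1, h2]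
    filter_upwards [polar_near z h1 φ hη, Metric.isOpen_ball.mem_nhds e] with w ⟨r', φ', g1, g2, g3⟩ hb
    refine ⟨r', φ', g1, ?_, g2, g3⟩
    rw [g3] at hb
    simpa [norm_cis, abs_of_pos g1] using hb
  rcases hL with hL | hL <;> rcases hR with hR | hR
  · left
    have hN' : ∀ r φ' : ℝ, 0 < r → r < ρ → |φ' - φ| < η → z + r * cis φ' ∈ N :=
      split N (hL.trans interior_subset) (hR.trans interior_subset) (fun r h1 h2 =>
        closure_minimal (hL.trans interior_subset) hN (clL r h1 h2))
    refine split _ hL hR (fun r h1 h2 => ?_)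
    rw [mem_interior_iff_mem_nhds]
    filter_upwards [nb r h1 h2]
    rintro w ⟨r', φ', g1, g2, g3, rfl⟩
    exact hN' r' φ' g1 g2 g3
  · right; right
    refine ⟨fun r h1 h2 => ⟨?_, ?_⟩, Or.inr ⟨fun r φ' h1 h2 h3 h4 => hL ⟨r, φ', h1, h2, h3, h4, rfl⟩,
      fun r φ' h1 h2 h3 h4 => hR ⟨r, φ', h1, h2, h3, h4, rfl⟩⟩⟩
    · exact closure_mono (hL.trans interior_subset) (clL r h1 h2)
    · have := closure_mono hR (clR r h1 h2)
      rwa [closure_compl] at this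
  · right; right
    refine ⟨fun r h1 h2 => ⟨?_, ?_⟩, Or.inl ⟨fun r φ' h1 h2 h3 h4 => hL ⟨r, φ', h1, h2, h3, h4, rfl⟩,
      fun r φ' h1 h2 h3 h4 => hR ⟨r, φ', h1, h2, h3, h4, rfl⟩⟩⟩
    · exact closure_mono (hR.trans interior_subset) (clR r h1 h2)
    · have := closure_mono hL (clL r h1 h2)
      rwa [closure_compl] at this
  · right; left
    have hi : ∀ r φ' : ℝ, 0 < r → r < ρ → |φ' - φ| < η → z + r * cis φ' ∈ (interior N)ᶜ :=
      split _ (hL.trans (compl_subset_compl.2 interior_subset))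
        (hR.trans (compl_subset_compl.2 interior_subset)) (fun r h1 h2 => by
        have := closure_mono hL (clL r h1 h2)
        rwa [closure_compl] at this)
    refine split _ hL hR (fun r h1 h2 hm => ?_)
    rw [hreg] at hm
    obtain ⟨w, hw, r', φ', g1, g2, g3, g4⟩ :=
      (mem_closure_iff_frequently.1 hm).and_eventually (nb r h1 h2) |>.exists
    exact hi r' φ' g1 g2 g3 (g4 ▸ hw)

end MS
end

section
open Filter
set_option linter.all false
namespace MS

structure LS (N : Set ℂ) (z : ℂ) (b a ρ : ℝ) : Prop where
  hρ : 0 < ρ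
  hba : b < a
  hab : a < b + 2 * π
  int : ∀ r φ : ℝ, 0 < r → r < ρ → b < φ → φ < a → z + r * cis φ ∈ interior N
  ext : ∀ r φ : ℝ, 0 < r → r < ρ → a < φ → φ < b + 2 * π → z + r * cis φ ∈ Nᶜ
  fb : ∀ r : ℝ, 0 < r → r < ρ → z + r * cis b ∈ frontier N
  fa : ∀ r : ℝ, 0 < r → r < ρ → z + r * cis a ∈ frontier N

lemma ls_hit {N : Set ℂ} (hN : IsClosed N) {z : ℂ} {ρ φ0 ψ C : ℝ} (hρ : 0 < ρ)
    (hf : ∃ᶠ k : ℕ in atTop, Free N (z + ((ρ / (k + 2) : ℝ) : ℂ) * cis φ0) ψ)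
    (fb : ∀ r : ℝ, 0 < r → r < ρ → z + r * cis C ∈ frontier N)
    {c1 c2 c3 : ℝ} (h1 : 0 < c1) (h2 : 0 < c2) (h3 : 0 < c3)
    (h : (c1 : ℂ) * cis C = c2 * cis φ0 + c3 * cis ψ) : False := by
  have ht : Tendsto (fun k : ℕ => ρ / ((k : ℝ) + 2)) atTop (nhds 0) :=
    tendsto_const_nhds.div_atTop (tendsto_atTop_add_const_right _ _ tendsto_natCast_atTop_atTop)
  have e : ∀ᶠ k : ℕ in atTop, ρ / ((k : ℝ) + 2) < ρ * c2 / c1 := ht.eventually_lt_const (by positivity)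
  obtain ⟨k, k1, k2⟩ := (hf.and_eventually e).exists
  set t := ρ / ((k : ℝ) + 2) with hh
  have htp : 0 < t := by positivity
  refine k1 (t * c3 / c2) (by positivity) ?_
  have := fb (t * c1 / c2) (by positivity) (by
    rw [lt_div_iff₀ h1] at k2
    rw [div_lt_iff₀ h2]; exact k2)
  have h' := hN.frontier_subset this
  convert h' using 1
  have n2 : (c2 : ℂ) ≠ 0 := by exact_mod_cast h2.ne'
  push_cast
  field_simp
  linear_combination -(t:ℂ) * h

lemma Reg.ls {δ : ℝ} {N : Set ℂ} (R : Reg δ N) {ls : Finset (ℂ × ℂ)} (hls : OnLines ls N) {z : ℂ}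
    (hz : z ∈ frontier N) : ∃ b a ρ, LS N z b a ρ := by
  have hN := R.compact.isClosed
  obtain ⟨ρ, hρ, htd⟩ := tdir_of hls z
  choose η0 hη0 hd using tdir_discrete hls.1 z
  have L3 := fun φ => loc3 hN R.regular (z := z) (ρ := ρ) (φ := φ) (hη0 φ)
      (fun r φ' h1 h2 h3 h4 h5 => hd φ φ' h3 h4 (htd r φ' h1 h2 h5))
  have hzi : z ∉ interior N := fun h => hz.2 h
  -- exterior direction at one radius
  have extall : ∀ φ r0 : ℝ, 0 < r0 → r0 < ρ → z + r0 * cis φ ∉ N →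
      ∀ r : ℝ, 0 < r → r < ρ → z + r * cis φ ∈ Nᶜ := by
    intro φ r0 h1 h2 h3 r h4 h5
    have h := L3 φ
    have hη := hη0 φ
    generalize η0 φ = η at h hη
    rcases h with h | h | h
    · exact absurd (interior_subset (h r0 φ h1 h2 (by simpa using hη))) h3
    · exact h r φ h4 h5 (by simpa using hη)
    · exact absurd (hN.frontier_subset (h.1 r0 h1 h2)) h3
  obtain ⟨ω, hω⟩ := R.fc z hzi
  have hωf : Free N z ω := hω ω (by linarith [R.hδ0]) (by linarith [R.hδ0])
  have hωf2 : Free N z (ω + 2 * π) := by simpa using hωf.int 1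
  have hρ2 : 0 < ρ / 2 := by linarith
  have hρ3 : ρ / 2 < ρ := by linarith
  let Z := {φ ∈ Icc ω (ω + 2 * π) | z + ((ρ / 2 : ℝ) : ℂ) * cis φ ∈ N}
  have hZc : IsCompact Z := isCompact_Icc.inter_right
    (hN.preimage (f := fun φ => z + ((ρ / 2 : ℝ) : ℂ) * cis φ) (by have := cis_cont; fun_prop))
  have hZne : Z.Nonempty := by
    have h1 : z ∈ closure (interior N) := R.regular ▸ hN.frontier_subset hz
    obtain ⟨w, hw, hwb⟩ := Metric.mem_closure_iff.1 h1 ρ hρ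
    have hwz : w ≠ z := fun h => hzi (h ▸ hw)
    obtain ⟨φ, h2, h3, h4⟩ := polar_exists _ (sub_ne_zero.2 hwz) ω
    refine ⟨φ, ⟨h2.le, h3⟩, ?_⟩
    by_contra hc
    have hnp : 0 < ‖w - z‖ := norm_pos_iff.2 (sub_ne_zero.2 hwz)
    refine extall φ _ hρ2 hρ3 hc ‖w - z‖ hnp (by rwa [← dist_eq_norm, dist_comm]) ?_
    rw [← h4]; simpa using interior_subset hw
  obtain ⟨b, ⟨⟨hb1, hb2⟩, hb3⟩, hbm⟩ := hZc.exists_isLeast hZne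
  obtain ⟨a, ⟨⟨ha1, ha2⟩, ha3⟩, ham⟩ := hZc.exists_isGreatest hZne
  have hb1 : ω < b := lt_of_le_of_ne hb1 (fun h => hωf _ hρ2 (h ▸ hb3))
  have ha2 : a < ω + 2 * π := lt_of_le_of_ne ha2 (fun h => hωf2 _ hρ2 (h ▸ ha3))
  have hba' : b ≤ a := ham ⟨⟨hb1.le, hb2⟩, hb3⟩
  have extL : ∀ φ, ω ≤ φ → φ < b → ∀ r : ℝ, 0 < r → r < ρ → z + r * cis φ ∈ Nᶜ := by
    intro φ h1 h2
    refine extall φ _ hρ2 hρ3 fun h => ?_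
    exact absurd (hbm ⟨⟨h1, by linarith⟩, h⟩) (by linarith)
  have extR : ∀ φ, a < φ → φ ≤ ω + 2 * π → ∀ r : ℝ, 0 < r → r < ρ → z + r * cis φ ∈ Nᶜ := by
    intro φ h1 h2
    refine extall φ _ hρ2 hρ3 fun h => ?_
    exact absurd (ham ⟨⟨by linarith, h2⟩, h⟩) (by linarith)
  obtain ⟨η, hη, hfb, hib⟩ : ∃ η > 0, (∀ r : ℝ, 0 < r → r < ρ → z + r * cis b ∈ frontier N) ∧
      (∀ r φ' : ℝ, 0 < r → r < ρ → b < φ' → φ' < b + η → z + r * cis φ' ∈ interior N) := by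
    have h := L3 b
    have hη := hη0 b
    generalize η0 b = η at h hη
    obtain ⟨φ', h1, h2, h3⟩ : ∃ φ', ω ≤ φ' ∧ b - η < φ' ∧ φ' < b := by
      obtain ⟨φ', h1, h2⟩ := exists_between (max_lt hb1 (show b - η < b by linarith))
      exact ⟨φ', ((le_max_left _ _).trans_lt h1).le, (le_max_right _ _).trans_lt h1, h2⟩
    have hx := extL φ' h1 h3 _ hρ2 hρ3
    rcases h with h | h | ⟨h, ⟨-, h'⟩ | ⟨h', -⟩⟩
    · exact absurd (interior_subset (h _ φ' hρ2 hρ3 (by rw [abs_lt]; constructor <;> linarith))) hx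
    · exact absurd hb3 (h _ b hρ2 hρ3 (by simpa using hη))
    · exact ⟨η, hη, h, h'⟩
    · exact absurd (interior_subset (h' _ φ' hρ2 hρ3 h2 h3)) hx
  obtain ⟨η', hη', hfa, hia⟩ : ∃ η > 0, (∀ r : ℝ, 0 < r → r < ρ → z + r * cis a ∈ frontier N) ∧
      (∀ r φ' : ℝ, 0 < r → r < ρ → a - η < φ' → φ' < a → z + r * cis φ' ∈ interior N) := by
    have h := L3 a
    have hη := hη0 a
    generalize η0 a = η at h hη
    obtain ⟨φ', h1, h2, h3⟩ : ∃ φ', φ' ≤ ω + 2 * π ∧ φ' < a + η ∧ a < φ' := by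
      obtain ⟨φ', h1, h2⟩ := exists_between (lt_min ha2 (show a < a + η by linarith))
      exact ⟨φ', (h2.trans_le (min_le_left _ _)).le, h2.trans_le (min_le_right _ _), h1⟩
    have hx := extR φ' h3 h1 _ hρ2 hρ3
    rcases h with h | h | ⟨h, ⟨-, h'⟩ | ⟨h', -⟩⟩
    · exact absurd (interior_subset (h _ φ' hρ2 hρ3 (by rw [abs_lt]; constructor <;> linarith))) hx
    · exact absurd ha3 (h _ a hρ2 hρ3 (by simpa using hη))
    · exact absurd (interior_subset (h' _ φ' hρ2 hρ3 h3 h2)) hx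
    · exact ⟨η, hη, h, h'⟩
  have hba : b < a := by
    obtain ⟨φ', h1, h2⟩ := exists_between (lt_min (show b < b + η by linarith) (hba'.trans_lt ha2))
    have := ham ⟨⟨by linarith, (h2.trans_le (min_le_right _ _)).le⟩,
      interior_subset (hib _ φ' hρ2 hρ3 h1 (h2.trans_le (min_le_left _ _)))⟩
    linarith
  refine ⟨b, a, ρ, hρ, hba, by linarith, ?_, ?_, hfb, hfa⟩
  · by_contra hcon
    push Not at hcon
    obtain ⟨r1, φ1, c1, c2, c3, c4, c5⟩ := hcon
    obtain ⟨φ0, d1, d2, d3⟩ : ∃ φ0, b < φ0 ∧ φ0 < a ∧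
        ∀ r : ℝ, 0 < r → r < ρ → z + r * cis φ0 ∈ Nᶜ := by
      have h := L3 φ1
      have hη := hη0 φ1
      generalize η0 φ1 = η at h hη
      rcases h with h | h | ⟨h, ⟨h', -⟩ | ⟨-, h'⟩⟩
      · exact absurd (h r1 φ1 c1 c2 (by simpa using hη)) c5
      · exact ⟨φ1, c3, c4, fun r h1 h2 => h r φ1 h1 h2 (by simpa using hη)⟩
      · obtain ⟨φ', h1, h2⟩ := exists_between (max_lt c3 (show φ1 - η < φ1 by linarith))
        rw [max_lt_iff] at h1
        exact ⟨φ', h1.1, by linarith, fun r g1 g2 => h' r φ' g1 g2 h1.2 h2⟩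
      · obtain ⟨φ', h1, h2⟩ := exists_between (lt_min c4 (show φ1 < φ1 + η by linarith))
        rw [lt_min_iff] at h2
        exact ⟨φ', by linarith, h2.1, fun r g1 g2 => h' r φ' g1 g2 h1 h2.2⟩
    let u : ℕ → ℂ := fun k => z + ((ρ / (k + 2) : ℝ) : ℂ) * cis φ0
    have hu : ∀ k, FC N δ (u k) := fun k => R.fc _ fun h => d3 (ρ / (k + 2)) (by positivity) (by
      rw [div_lt_iff₀ (by positivity)]; nlinarith [(Nat.cast_nonneg k : (0:ℝ) ≤ k)]) (interior_subset h)
    have ht : Tendsto u atTop (nhds z) := by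
      have ht : Tendsto (fun k : ℕ => ρ / ((k : ℝ) + 2)) atTop (nhds 0) :=
        tendsto_const_nhds.div_atTop (tendsto_atTop_add_const_right _ _ tendsto_natCast_atTop_atTop)
      have := ((Complex.continuous_ofReal.tendsto _).comp ht).mul_const (cis φ0) |>.const_add z
      simpa [u] using this
    obtain ⟨ωs', e1', e2'⟩ := FC_limit R.regular R.hδ0 hu ht
    obtain ⟨m, ⟨m1, m2⟩, -⟩ := existsUnique_add_zsmul_mem_Ioc Real.two_pi_pos ωs' (a - 2 * π)
    rw [zsmul_eq_mul] at m1 m2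
    obtain ⟨ωs, hωs⟩ : ∃ ωs, ωs = ωs' + m * (2 * π) := ⟨_, rfl⟩
    rw [← hωs] at m1 m2
    have e1 : Free N z ωs := by
      rw [hωs]; exact (e1' ωs' (by linarith [R.hδ0]) (by linarith [R.hδ0])).int m
    have e2 : ∀ φ, ωs - δ / 2 < φ → φ < ωs + δ / 2 → ∃ᶠ k in atTop, Free N (u k) φ := by
      intro φ h1 h2
      refine (e2' (φ - m * (2 * π)) (by linarith) (by linarith)).mono fun k hk => ?_
      have := hk.int m
      rwa [sub_add_cancel] at this
    have na : ωs ≠ a := fun h => e1 _ hρ2 (h ▸ hN.frontier_subset (hfa _ hρ2 hρ3))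
    have nb : ωs ≠ b := fun h => e1 _ hρ2 (h ▸ hN.frontier_subset (hfb _ hρ2 hρ3))
    have m2 : ωs < a := lt_of_le_of_ne (by linarith) na
    rcases lt_or_gt_of_ne nb with hlt | hgt
    · obtain ⟨ψ, p1, p2, p3, p4, p5⟩ : ∃ ψ, a - 2 * π < ψ ∧ ψ < b ∧ ωs - δ / 2 < ψ ∧ ψ < ωs + δ / 2 ∧
          φ0 - ψ ≠ π := by
        by_cases hne : φ0 - ωs = π
        · obtain ⟨ψ, q1, q2⟩ := exists_between (lt_min hlt (show ωs < ωs + δ / 2 by linarith [R.hδ0]))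
          rw [lt_min_iff] at q2
          exact ⟨ψ, by linarith, q2.1, by linarith [R.hδ0], q2.2, fun h => by linarith⟩
        · exact ⟨ωs, m1, hlt, by linarith [R.hδ0], by linarith [R.hδ0], hne⟩
      have hfr := e2 ψ p3 p4
      rcases lt_or_gt_of_ne p5 with hl | hg
      · refine ls_hit hN hρ hfr hfb (c1 := sin (φ0 - ψ)) (c2 := sin (b - ψ)) (c3 := sin (φ0 - b))
          (sin_pos_of_pos_of_lt_pi (by linarith) (by linarith))
          (sin_pos_of_pos_of_lt_pi (by linarith) (by linarith))
          (sin_pos_of_pos_of_lt_pi (by linarith) (by linarith)) ?_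
        rw [cone_id b ψ φ0]; ring
      · have : ∃ᶠ k in atTop, Free N (u k) (ψ + 2 * π) := by
          refine hfr.mono fun k hk => ?_
          simpa using hk.int 1
        refine ls_hit hN hρ this hfa (c1 := sin (ψ + 2 * π - φ0)) (c2 := sin (ψ + 2 * π - a))
          (c3 := sin (a - φ0))
          (sin_pos_of_pos_of_lt_pi (by linarith) (by linarith))
          (sin_pos_of_pos_of_lt_pi (by linarith) (by linarith))
          (sin_pos_of_pos_of_lt_pi (by linarith) (by linarith)) ?_
        exact cone_id a φ0 (ψ + 2 * π)
    · have hcov : interior N ⊆ isec z ω ωs ∪ isec z ωs (ω + 2 * π) := by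
        intro w hw
        have hwz : w ≠ z := fun h => hzi (h ▸ hw)
        obtain ⟨φ, h2, h3, h4⟩ := polar_exists _ (sub_ne_zero.2 hwz) ω
        have hnp : 0 < ‖w - z‖ := norm_pos_iff.2 (sub_ne_zero.2 hwz)
        have hw' : w = z + ‖w - z‖ * cis φ := by rw [← h4]; ring
        have h5 : φ ≠ ω + 2 * π := fun h => hωf2 _ hnp (by rw [← h, ← hw']; exact interior_subset hw)
        have h6 : φ ≠ ωs := fun h => e1 _ hnp (by rw [← h, ← hw']; exact interior_subset hw)
        rcases lt_or_gt_of_ne h6 with h | h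
        · exact Or.inl ⟨_, φ, hnp, h2, h, hw'⟩
        · exact Or.inr ⟨_, φ, hnp, h, lt_of_le_of_ne h3 h5, hw'⟩
      have hdis : Disjoint (isec z ω ωs) (isec z ωs (ω + 2 * π)) := isec_disj z le_rfl
      obtain ⟨φb, f1, f2⟩ := exists_between (lt_min hgt (show b < b + η by linarith))
      rw [lt_min_iff] at f2
      obtain ⟨φa, g1, g2⟩ := exists_between (max_lt m2 (show a - η' < a by linarith))
      rw [max_lt_iff] at g1
      have hsub := R.conn.subset_left_of_subset_union (isec_open _ _ _) (isec_open _ _ _) hdis hcov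
        ⟨_, hib _ φb hρ2 hρ3 f1 f2.2, _, φb, hρ2, by linarith, f2.1, rfl⟩
      exact disjoint_left.1 hdis (hsub (hia _ φa hρ2 hρ3 g1.2 g2))
        ⟨_, φa, hρ2, g1.1, by linarith, rfl⟩
  · intro r φ h1 h2 h3 h4
    rcases le_or_gt φ (ω + 2 * π) with h | h
    · exact extR φ h3 h r h1 h2
    · have := extL (φ - 2 * π) (by linarith) (by linarith) r h1 h2
      have e : cis (φ - 2 * π) = cis φ := by
        rw [← cis_two_pi, sub_add_cancel]
      rwa [e] at this

end MS
end

section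
open Filter
set_option linter.all false
namespace MS

def HP (N : Set ℂ) (w : ℂ) (φ : ℝ) : Prop :=
  ∃ ε > 0, ∀ v : ℂ, ‖v - w‖ < ε → (0 < ((v - w) * cis (-φ)).im → v ∈ interior N) ∧
    (((v - w) * cis (-φ)).im < 0 → v ∈ Nᶜ) ∧ (((v - w) * cis (-φ)).im = 0 → v ∈ frontier N)

lemma im_cis (r φ ψ : ℝ) : ((r : ℂ) * cis φ * cis (-ψ)).im = r * sin (φ - ψ) := by
  rw [mul_assoc, ← cis_add, Complex.im_ofReal_mul, cis_im, sub_eq_add_neg]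

lemma im_cis2 (z : ℂ) (r r' φ ψ : ℝ) :
    (((z + r * cis φ) - (z + r' * cis ψ)) * cis (-ψ)).im = r * sin (φ - ψ) := by
  have : (((z + r * cis φ) - (z + r' * cis ψ)) * cis (-ψ)) =
    (r * cis φ) * cis (-ψ) - r' * cis ψ * cis (-ψ) := by ring
  rw [this, Complex.sub_im, im_cis, im_cis]; simp

lemma HP.int {N : Set ℂ} {w : ℂ} {φ : ℝ} (h : HP N w φ) (k : ℤ) : HP N w (φ + k * (2 * π)) := by
  have e : cis (-(φ + k * (2 * π))) = cis (-φ) := by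
    have := cis_int (-φ) (-k)
    push_cast at this
    rw [← this]; congr 1; ring
  unfold HP at *
  rwa [e]

lemma HP.frontier {N : Set ℂ} {w : ℂ} {φ : ℝ} (h : HP N w φ) : w ∈ frontier N := by
  obtain ⟨ε, hε, h⟩ := h
  exact (h w (by simpa using hε)).2.2 (by simp)

lemma LS.shift {N : Set ℂ} {z : ℂ} {b a ρ : ℝ} (h : LS N z b a ρ) (k : ℤ) :
    LS N z (b + k * (2 * π)) (a + k * (2 * π)) ρ := by
  refine ⟨h.hρ, by linarith [h.hba], by linarith [h.hab], ?_, ?_, ?_, ?_⟩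
  · intro r φ h1 h2 h3 h4
    have := h.int r (φ - k * (2 * π)) h1 h2 (by linarith) (by linarith)
    rwa [← cis_int _ k, sub_add_cancel] at this
  · intro r φ h1 h2 h3 h4
    have := h.ext r (φ - k * (2 * π)) h1 h2 (by linarith) (by linarith)
    rwa [← cis_int _ k, sub_add_cancel] at this
  · intro r h1 h2; rw [cis_int]; exact h.fb r h1 h2
  · intro r h1 h2; rw [cis_int]; exact h.fa r h1 h2

lemma near_polar (z : ℂ) {r ρ φ η : ℝ} (h1 : 0 < r) (h2 : r < ρ) (hη : 0 < η) :
    ∃ ε > 0, ∀ w : ℂ, ‖w - (z + r * cis φ)‖ < ε →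
      ∃ r' φ' : ℝ, 0 < r' ∧ r' < ρ ∧ |φ' - φ| < η ∧ w = z + r' * cis φ' := by
  have e : z + r * cis φ ∈ Metric.ball z ρ := by simp [norm_cis, abs_of_pos h1, h2]
  have : ∀ᶠ w in nhds (z + r * cis φ), ∃ r' φ', 0 < r' ∧ r' < ρ ∧ |φ' - φ| < η ∧ w = z + r' * cis φ' := by
    filter_upwards [polar_near z h1 φ hη, Metric.isOpen_ball.mem_nhds e] with w ⟨r', φ', g1, g2, g3⟩ hb
    refine ⟨r', φ', g1, ?_, g2, g3⟩
    rw [g3] at hb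
    simpa [norm_cis, abs_of_pos g1] using hb
  obtain ⟨ε, hε, h⟩ := Metric.eventually_nhds_iff.1 this
  exact ⟨ε, hε, fun w hw => h (by rwa [dist_eq_norm])⟩

lemma LS.hpb {N : Set ℂ} {z : ℂ} {b a ρ : ℝ} (h : LS N z b a ρ) {r : ℝ} (h1 : 0 < r) (h2 : r < ρ) :
    HP N (z + r * cis b) b := by
  obtain ⟨ε, hε, hn⟩ := near_polar z (φ := b) (η := min (min (a - b) (b + 2 * π - a)) π) h1 h2
    (by have := h.hba; have := h.hab; have := Real.pi_pos; refine lt_min (lt_min ?_ ?_) ?_ <;> linarith)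
  refine ⟨ε, hε, fun v hv => ?_⟩
  obtain ⟨r', φ', g1, g2, g3, rfl⟩ := hn v hv
  rw [lt_min_iff, lt_min_iff, abs_lt, abs_lt, abs_lt] at g3
  obtain ⟨⟨⟨g3, g4⟩, g5, g6⟩, g7, g8⟩ := g3
  rw [im_cis2]
  refine ⟨fun k => ?_, fun k => ?_, fun k => ?_⟩
  · have := pos_of_sin g7 g8 (pos_of_mul_pos_right k g1.le)
    exact h.int r' φ' g1 g2 (by linarith) (by linarith)
  · have := neg_of_sin g7 g8 (by by_contra hc; nlinarith)
    have := h.ext r' (φ' + 2 * π) g1 g2 (by linarith) (by linarith)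
    rwa [cis_two_pi] at this
  · have := zero_of_sin g7 g8 (by rcases mul_eq_zero.1 k with k | k; linarith; exact k)
    rw [show φ' = b by linarith]
    exact h.fb r' g1 g2

lemma LS.hpa {N : Set ℂ} {z : ℂ} {b a ρ : ℝ} (h : LS N z b a ρ) {r : ℝ} (h1 : 0 < r) (h2 : r < ρ) :
    HP N (z + r * cis a) (a + π) := by
  obtain ⟨ε, hε, hn⟩ := near_polar z (φ := a) (η := min (min (a - b) (b + 2 * π - a)) π) h1 h2
    (by have := h.hba; have := h.hab; have := Real.pi_pos; refine lt_min (lt_min ?_ ?_) ?_ <;> linarith)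
  refine ⟨ε, hε, fun v hv => ?_⟩
  obtain ⟨r', φ', g1, g2, g3, rfl⟩ := hn v hv
  rw [lt_min_iff, lt_min_iff, abs_lt, abs_lt, abs_lt] at g3
  obtain ⟨⟨⟨g3, g4⟩, g5, g6⟩, g7, g8⟩ := g3
  have e : cis (-(a + π)) = - cis (-a) := by rw [← cis_sub_pi]; congr 1; ring
  rw [e, mul_neg, Complex.neg_im, im_cis2]
  refine ⟨fun k => ?_, fun k => ?_, fun k => ?_⟩
  · have := neg_of_sin g7 g8 (by by_contra hc; nlinarith)
    exact h.int r' φ' g1 g2 (by linarith) (by linarith)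
  · have := pos_of_sin g7 g8 (by by_contra hc; nlinarith)
    exact h.ext r' φ' g1 g2 (by linarith) (by linarith)
  · have := zero_of_sin g7 g8 (by rcases mul_eq_zero.1 (neg_eq_zero.1 k) with k | k; linarith; exact k)
    rw [show φ' = a by linarith]
    exact h.fa r' g1 g2

lemma HP.ls {N : Set ℂ} {w : ℂ} {φ : ℝ} (h : HP N w φ) : ∃ ρ, LS N w φ (φ + π) ρ := by
  obtain ⟨ε, hε, h⟩ := h
  have key : ∀ r φ' : ℝ, 0 < r → r < ε → _ := fun r φ' h1 h2 => h (w + r * cis φ') (by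
    simp [norm_cis, abs_of_pos h1, h2])
  simp only [add_sub_cancel_left, im_cis] at key
  have hp := Real.pi_pos
  refine ⟨ε, hε, by linarith, by linarith, ?_, ?_, ?_, ?_⟩
  · intro r φ' h1 h2 h3 h4
    exact (key r φ' h1 h2).1 (mul_pos h1 (sin_pos_of_pos_of_lt_pi (by linarith) (by linarith)))
  · intro r φ' h1 h2 h3 h4
    refine (key r φ' h1 h2).2.1 (mul_neg_of_pos_of_neg h1 ?_)
    have := sin_neg_of_neg_of_neg_pi_lt (x := φ' - φ - 2 * π) (by linarith) (by linarith)
    rwa [sin_sub_two_pi] at this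
  · intro r h1 h2
    exact (key r φ h1 h2).2.2 (by simp)
  · intro r h1 h2
    exact (key r (φ + π) h1 h2).2.2 (by simp)

lemma LS.hp {N : Set ℂ} {z : ℂ} {b ρ : ℝ} (h : LS N z b (b + π) ρ) (hz : z ∈ frontier N) : HP N z b := by
  refine ⟨ρ, h.hρ, fun v hv => ?_⟩
  by_cases hvz : v = z
  · subst hvz; simp [hz]
  obtain ⟨φ, h2, h3, h4⟩ := polar_exists _ (sub_ne_zero.2 hvz) b
  have hnp : 0 < ‖v - z‖ := norm_pos_iff.2 (sub_ne_zero.2 hvz)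
  have hw' : v = z + ‖v - z‖ * cis φ := by rw [← h4]; ring
  generalize ‖v - z‖ = r at *
  rw [h4, im_cis]
  subst hw'
  have hp := Real.pi_pos
  rcases lt_trichotomy φ (b + π) with g | g | g
  · have := sin_pos_of_pos_of_lt_pi (x := φ - b) (by linarith) (by linarith)
    have := mul_pos hnp this
    exact ⟨fun _ => h.int r φ hnp hv h2 g, fun k => by linarith, fun k => by linarith⟩
  · have : r * sin (φ - b) = 0 := by rw [g]; simp
    exact ⟨fun k => by linarith, fun k => by linarith, fun k => g ▸ h.fa r hnp hv⟩
  · rcases h3.lt_or_eq with g' | g'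
    · have := sin_neg_of_neg_of_neg_pi_lt (x := φ - b - 2 * π) (by linarith) (by linarith)
      rw [sin_sub_two_pi] at this
      have := mul_neg_of_pos_of_neg hnp this
      exact ⟨fun k => by linarith, fun k => h.ext r φ hnp hv g g', fun k => by linarith⟩
    · have : r * sin (φ - b) = 0 := by rw [g']; simp
      refine ⟨fun k => by linarith, fun k => by linarith, fun k => ?_⟩
      rw [g', cis_two_pi]; exact h.fb r hnp hv

lemma LS.unique0 {N : Set ℂ} (hN : IsClosed N) {z : ℂ} {b a ρ b' a' ρ' : ℝ} (h : LS N z b a ρ)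
    (h' : LS N z b' a' ρ') (h1 : b ≤ b') (h2 : b' < b + 2 * π) : b' = b ∧ a' = a := by
  obtain ⟨r, r0, r1⟩ := exists_between (lt_min h.hρ h'.hρ)
  rw [lt_min_iff] at r1
  obtain ⟨r1, r2⟩ := r1
  have fN : ∀ w, w ∈ Nᶜ → w ∈ frontier N → False := fun w g1 g2 => g1 (hN.frontier_subset g2)
  have fI : ∀ w, w ∈ interior N → w ∈ frontier N → False := fun w g1 g2 => g2.2 g1
  have hb : b' = b := by
    by_contra hne
    have hlt : b < b' := lt_of_le_of_ne h1 (Ne.symm hne)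
    rcases lt_trichotomy b' a with g | g | g
    · exact fI _ (h.int r b' r0 r1 hlt g) (h'.fb r r0 r2)
    · obtain ⟨φ, g1, g2⟩ := exists_between (max_lt hlt (show a' - 2 * π < b' by linarith [h'.hab]))
      rw [max_lt_iff] at g1
      have k1 := h.int r φ r0 r1 (by linarith) (by linarith)
      have k2 := h'.ext r (φ + 2 * π) r0 r2 (by linarith) (by linarith)
      rw [cis_two_pi] at k2
      exact k2 (interior_subset k1)
    · exact fN _ (h.ext r b' r0 r1 g h2) (h'.fb r r0 r2)
  refine ⟨hb, ?_⟩
  subst hb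
  rcases lt_trichotomy a' a with g | g | g
  · exact (fI _ (h.int r a' r0 r1 h'.hba g) (h'.fa r r0 r2)).elim
  · exact g
  · exact (fI _ (h'.int r a r0 r2 h.hba g) (h.fa r r0 r1)).elim

lemma LS.unique {N : Set ℂ} (hN : IsClosed N) {z : ℂ} {b a ρ b' a' ρ' : ℝ} (h : LS N z b a ρ)
    (h' : LS N z b' a' ρ') : ∃ k : ℤ, b' = b + k * (2 * π) ∧ a' = a + k * (2 * π) := by
  obtain ⟨m, ⟨m1, m2⟩, -⟩ := existsUnique_add_zsmul_mem_Ico Real.two_pi_pos b' b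
  rw [zsmul_eq_mul] at m1 m2
  obtain ⟨e1, e2⟩ := h.unique0 hN (h'.shift m) m1 m2
  exact ⟨-m, by push_cast; linarith, by push_cast; linarith⟩

lemma HP.unique {N : Set ℂ} (hN : IsClosed N) {w : ℂ} {φ φ' : ℝ} (h : HP N w φ) (h' : HP N w φ') :
    ∃ k : ℤ, φ' = φ + k * (2 * π) := by
  obtain ⟨_, h⟩ := h.ls
  obtain ⟨_, h'⟩ := h'.ls
  obtain ⟨k, e, -⟩ := h.unique hN h'
  exact ⟨k, e⟩

lemma odd_ne (k m : ℤ) (h : (k : ℝ) * (2 * π) + π = m * (2 * π)) : False := by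
  have : ((2 * k + 1 : ℤ) : ℝ) * π = ((2 * m : ℤ) : ℝ) * π := by push_cast; linarith
  have := mul_right_cancel₀ Real.pi_ne_zero this
  have : (2 * k + 1 : ℤ) = 2 * m := by exact_mod_cast this
  omega

lemma Reg.edge {δ : ℝ} {N : Set ℂ} (R : Reg δ N) {ls : Finset (ℂ × ℂ)} (hls : OnLines ls N) {z : ℂ}
    {b a ρ : ℝ} (h : LS N z b a ρ) :
    ∃ T : ℝ, 0 < T ∧ (∀ r : ℝ, 0 < r → r < T → HP N (z + r * cis b) b) ∧
      z + T * cis b ∈ frontier N ∧ (∀ φ, ¬ HP N (z + T * cis b) φ) ∧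
      ∃ b' ρ', LS N (z + T * cis b) b' (b + π) ρ' := by
  have hN := R.compact.isClosed
  let S := {t : ℝ | 0 < t ∧ ∀ r : ℝ, 0 < r → r < t → HP N (z + r * cis b) b}
  have hρS : ρ ∈ S := ⟨h.hρ, fun r h1 h2 => h.hpb h1 h2⟩
  obtain ⟨M, hM⟩ := R.compact.isBounded.exists_norm_le
  have hbdd : BddAbove S := by
    refine ⟨2 * (‖z‖ + M), fun t ht => ?_⟩
    have h1 := hN.frontier_subset (ht.2 (t / 2) (by linarith [ht.1]) (by linarith [ht.1])).frontier
    have h2 := hM _ h1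
    have h3 : ‖((t / 2 : ℝ) : ℂ) * cis b‖ ≤ ‖z + ((t / 2 : ℝ) : ℂ) * cis b‖ + ‖z‖ := by
      have := norm_sub_le (z + ((t / 2 : ℝ) : ℂ) * cis b) z
      rwa [add_sub_cancel_left] at this
    rw [norm_mul, norm_cis, mul_one, Complex.norm_real, Real.norm_eq_abs, abs_of_pos (by linarith [ht.1])] at h3
    linarith
  obtain ⟨T, hT⟩ : ∃ T, T = sSup S := ⟨_, rfl⟩
  have hρT : ρ ≤ T := hT ▸ le_csSup hbdd hρS
  have hT0 : 0 < T := by linarith [h.hρ]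
  have hHP : ∀ r : ℝ, 0 < r → r < T → HP N (z + r * cis b) b := by
    intro r h1 h2
    obtain ⟨t, ht, htr⟩ := exists_lt_of_lt_csSup ⟨ρ, hρS⟩ (hT ▸ h2)
    exact ht.2 r h1 htr
  have hfr : z + T * cis b ∈ frontier N := by
    have h1 : T ∈ closure (Ioo 0 T) := by rw [closure_Ioo hT0.ne]; exact ⟨hT0.le, le_rfl⟩
    have h2 := map_mem_closure (f := fun t : ℝ => z + (t : ℂ) * cis b) (by fun_prop) h1
      (t := frontier N) (fun r hr => (hHP r hr.1 hr.2).frontier)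
    rwa [isClosed_frontier.closure_eq] at h2
  obtain ⟨b1, a1, ρ1, h1⟩ := R.ls hls hfr
  have hLS : ∃ b' ρ', LS N (z + T * cis b) b' (b + π) ρ' := by
    obtain ⟨m, ⟨m1, m2⟩, -⟩ := existsUnique_add_zsmul_mem_Ico Real.two_pi_pos (b + π) b1
    rw [zsmul_eq_mul] at m1 m2
    obtain ⟨r, r0, r1⟩ := exists_between (lt_min h1.hρ hT0)
    rw [lt_min_iff] at r1
    have e : (z + T * cis b) + r * cis (b + π + m * (2 * π)) = z + ((T - r : ℝ) : ℂ) * cis b := by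
      rw [cis_int, cis_add_pi]; push_cast; ring
    have hp := hHP (T - r) (by linarith) (by linarith)
    rw [← e] at hp
    rcases m1.lt_or_eq with g | g
    · rcases lt_trichotomy (b + π + m * (2 * π)) a1 with g' | g' | g'
      · exact absurd (h1.int r _ r0 r1.1 g g') hp.frontier.2
      · refine ⟨b1 + ((-m : ℤ) : ℝ) * (2 * π), ρ1, ?_⟩
        · have := h1.shift (-m)
          rwa [← g', show b + π + m * (2 * π) + ((-m : ℤ) : ℝ) * (2 * π) = b + π by push_cast; ring] at this
      · exact absurd (hN.frontier_subset hp.frontier) (h1.ext r _ r0 r1.1 g' m2)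
    · have h2 := h1.hpb r0 r1.1
      rw [← g] at hp
      obtain ⟨k, hk⟩ := hp.unique hN h2
      exact (odd_ne m k (by linarith)).elim
  refine ⟨T, hT0, hHP, hfr, ?_, hLS⟩
  intro φ hφ
  obtain ⟨b', ρ', h2⟩ := hLS
  obtain ⟨_, h3⟩ := hφ.ls
  obtain ⟨k, -, hk⟩ := h3.unique hN h2
  have h4 := hφ.int k
  rw [show φ + k * (2 * π) = b by linarith] at h4
  obtain ⟨ρ2, h5⟩ := h4.ls
  have : T + ρ2 ∈ S := by
    refine ⟨by linarith [h5.hρ], fun r g1 g2 => ?_⟩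
    rcases lt_trichotomy r T with g | g | g
    · exact hHP r g1 g
    · rw [g]; exact h4
    · have := h5.hpb (r := r - T) (by linarith) (by linarith)
      convert this using 1
      push_cast; ring
  have := le_csSup hbdd this
  linarith [h5.hρ]

end MS
end

section
open Filter
set_option linter.all false
namespace MS

lemma arg_cis {x : ℝ} (h1 : -π < x) (h2 : x ≤ π) : (cis x).arg = x := by
  rw [cis, Complex.exp_mul_I]
  exact Complex.arg_cos_add_sin_mul_I ⟨h1, h2⟩

lemma arg_dir {w : ℂ} {x : ℝ} (hw : Dir w x) (h1 : -π < x) (h2 : x ≤ π) : w.arg = x := by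
  obtain ⟨r, hr, rfl⟩ := hw
  rw [Complex.arg_real_mul _ hr, arg_cis h1 h2]

lemma slit_of {w : ℂ} {x : ℝ} (hw : Dir w x) (h : |x| < π) : w ∈ Complex.slitPlane := by
  rw [abs_lt] at h
  rw [Complex.mem_slitPlane_iff_arg, arg_dir hw h.1 h.2.le]
  exact ⟨h.2.ne, hw.ne⟩

/-- closed simple polygon in the complex plane, with periodic vertices -/
structure CPoly where
  n : ℕ
  npos : 0 < n
  V : ℤ → ℂ
  per : ∀ k, V (k + n) = V k
  dne : ∀ k, V (k + 1) - V k ≠ 0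
  slit : ∀ k, (V (k + 1 + 1) - V (k + 1)) / (V (k + 1) - V k) ∈ Complex.slitPlane
  inj : ∀ i j : ℤ, 0 ≤ i → i < n → 0 ≤ j → j < n → ∀ s t : ℝ, 0 ≤ s → s < 1 → 0 ≤ t → t < 1 →
    V i + s * (V (i + 1) - V i) = V j + t * (V (j + 1) - V j) → i = j ∧ s = t

def nonflat (N : Set ℂ) : Set ℂ := {z | z ∈ frontier N ∧ ∀ φ, ¬ HP N z φ}

lemma cross_ext {z z' p q a b : ℂ} {t t' s s' : ℝ} (h1 : z = p + t * a) (h2 : z' = p + t' * a)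
    (h3 : z = q + s * b) (h4 : z' = q + s' * b) (h : (b * (starRingEnd ℂ) a).im ≠ 0) : z = z' := by
  have e1 : z - z' = ((t - t' : ℝ) : ℂ) * a := by rw [h1, h2]; push_cast; ring
  have e2 : z - z' = ((s - s' : ℝ) : ℂ) * b := by rw [h3, h4]; push_cast; ring
  have e3 : ((t - t' : ℝ) : ℂ) * a * (starRingEnd ℂ) a = ((s - s' : ℝ) : ℂ) * b * (starRingEnd ℂ) a := by
    rw [← e1, ← e2]
  have := congrArg Complex.im e3
  rw [mul_assoc, mul_assoc, Complex.im_ofReal_mul, Complex.im_ofReal_mul, Complex.mul_conj] at this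
  simp only [Complex.ofReal_im, mul_zero] at this
  have : s - s' = 0 := by
    rcases mul_eq_zero.1 this.symm with g | g
    · exact g
    · exact absurd g h
  rw [this] at e2
  simpa [sub_eq_zero] using e2

lemma Reg.finite_nonflat {δ : ℝ} {N : Set ℂ} (R : Reg δ N) {ls : Finset (ℂ × ℂ)} (hls : OnLines ls N) :
    (nonflat N).Finite := by
  have hsub : nonflat N ⊆ ⋃ x ∈ (↑(ls ×ˢ ls) : Set ((ℂ × ℂ) × (ℂ × ℂ))), {z : ℂ |
      (∃ t : ℝ, z = x.1.1 + t * x.1.2) ∧ (∃ t : ℝ, z = x.2.1 + t * x.2.2) ∧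
        (x.2.2 * (starRingEnd ℂ) x.1.2).im ≠ 0} := by
    rintro z ⟨hz, hnf⟩
    obtain ⟨b, a, ρ, h⟩ := R.ls hls hz
    obtain ⟨ρ', hρ', htd⟩ := tdir_of hls z
    obtain ⟨r, r0, r1⟩ := exists_between (lt_min h.hρ hρ')
    rw [lt_min_iff] at r1
    obtain ⟨p, hp, hp1, t, ht⟩ := htd r b r0 r1.2 (h.fb r r0 r1.1)
    obtain ⟨q, hq, hq1, s, hs⟩ := htd r a r0 r1.2 (h.fa r r0 r1.1)
    simp only [mem_iUnion]
    refine ⟨(p, q), by simp [hp, hq], hp1, hq1, fun h0 => ?_⟩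
    have e : sin (a - b) = s * t * (q.2 * (starRingEnd ℂ) p.2).im := by
      have e1 : sin (a - b) = (cis a * (starRingEnd ℂ) (cis b)).im := by
        simp [cis_re, cis_im, sin_sub]; ring
      rw [e1, hs, ht]
      simp; ring
    simp only at h0
    rw [h0, mul_zero] at e
    have : a - b - π = 0 := zero_of_sin (by linarith [h.hba]) (by linarith [h.hab]) (by
      rw [sin_sub_pi, e, neg_zero])
    have ha : a = b + π := by linarith
    rw [ha] at h
    exact hnf b (h.hp hz)
  refine Set.Finite.subset (Set.Finite.biUnion (Finset.finite_toSet _) fun x _ => ?_) hsub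
  apply Set.Subsingleton.finite
  rintro z ⟨⟨t, ht⟩, ⟨s, hs⟩, h⟩ z' ⟨⟨t', ht'⟩, ⟨s', hs'⟩, -⟩
  exact cross_ext ht ht' hs hs' h

lemma Reg.frontier_nonempty {δ : ℝ} {N : Set ℂ} (R : Reg δ N) : (frontier N).Nonempty := by
  by_contra h
  rw [not_nonempty_iff_eq_empty, frontier_eq_empty_iff] at h
  rcases h with h | h
  · obtain ⟨w, hw⟩ := R.nonempty
    have := interior_subset hw
    rw [h] at this
    exact this
  · have := R.compact
    rw [h] at this
    exact noncompact_univ ℂ this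

lemma Reg.walk0 {δ : ℝ} {N : Set ℂ} (R : Reg δ N) {ls : Finset (ℂ × ℂ)} (hls : OnLines ls N) :
    ∃ (v : ℕ → ℂ) (θ T : ℕ → ℝ), ∀ k, 0 < T k ∧ v (k + 1) = v k + T k * cis (θ k) ∧
      (∀ r : ℝ, 0 < r → r < T k → HP N (v k + r * cis (θ k)) (θ k)) ∧ v k ∈ nonflat N ∧
      |θ (k + 1) - θ k| < π ∧ ∃ a ρ, LS N (v k) (θ k) a ρ := by
  let St := {p : ℂ × ℝ // ∃ a ρ, LS N p.1 p.2 a ρ}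
  have E : ∀ s : St, _ := fun s => R.edge hls (z := s.1.1) (b := s.1.2) s.2.choose_spec.choose_spec
  choose T hT hHP hfr hnf b' ρ' hLS using E
  let step : St → St := fun s => ⟨(s.1.1 + T s * cis s.1.2, b' s), _, _, hLS s⟩
  obtain ⟨z0, hz0⟩ := R.frontier_nonempty
  obtain ⟨b0, a0, ρ0, h0⟩ := R.ls hls hz0
  let s0 : St := ⟨(z0, b0), a0, ρ0, h0⟩
  let st : ℕ → St := fun k => step^[k + 1] s0
  have hst : ∀ k, st (k + 1) = step (st k) := fun k => Function.iterate_succ_apply' _ _ _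
  have hst0 : ∀ k, st k = step (step^[k] s0) := fun k => Function.iterate_succ_apply' _ _ _
  refine ⟨fun k => (st k).1.1, fun k => (st k).1.2, fun k => T (st k), fun k => ⟨hT _, ?_, ?_, ?_, ?_, ?_⟩⟩
  · show (st (k + 1)).1.1 = _
    rw [hst]
  · exact hHP (st k)
  · show (st k).1.1 ∈ _
    rw [hst0]; exact ⟨hfr _, hnf _⟩
  · have := hLS (st k)
    have h1 := this.hba
    have h2 := this.hab
    show |(st (k + 1)).1.2 - (st k).1.2| < π
    rw [hst]
    show |b' (st k) - (st k).1.2| < π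
    rw [abs_lt]; constructor <;> linarith
  · exact (st k).2

lemma Reg.walk {δ : ℝ} {N : Set ℂ} (R : Reg δ N) {ls : Finset (ℂ × ℂ)} (hls : OnLines ls N) :
    ∃ C : CPoly, (∀ k, C.V k ∈ frontier N) ∧ ∀ k, ∃ θ, Dir (C.V (k + 1) - C.V k) θ ∧
      ∀ t : ℝ, 0 < t → t < 1 → HP N (C.V k + t * (C.V (k + 1) - C.V k)) θ := by
  have hN := R.compact.isClosed
  obtain ⟨v, θ, T, hw⟩ := R.walk0 hls
  have hgap : ∃ n : ℕ, 0 < n ∧ ∃ i, v i = v (i + n) := by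
    have : Finite (nonflat N) := R.finite_nonflat hls
    obtain ⟨i, j, hij, he⟩ := Finite.exists_ne_map_eq_of_infinite
      (fun k : ℕ => (⟨v k, (hw k).2.2.2.1⟩ : nonflat N))
    have he : v i = v j := congrArg Subtype.val he
    rcases lt_or_gt_of_ne hij with h | h
    · exact ⟨j - i, by omega, i, by rw [he]; congr 1; omega⟩
    · exact ⟨i - j, by omega, j, by rw [← he]; congr 1; omega⟩
  classical
  obtain ⟨n, ⟨hn0, i0, hi0⟩, hmin⟩ : ∃ n : ℕ, (0 < n ∧ ∃ i, v i = v (i + n)) ∧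
      ∀ m, m < n → ¬ (0 < m ∧ ∃ i, v i = v (i + m)) :=
    ⟨Nat.find hgap, Nat.find_spec hgap, fun m hm => Nat.find_min hgap hm⟩
  obtain ⟨u, hu⟩ : ∃ u : ℕ → ℂ, u = fun k => v (i0 + k) := ⟨_, rfl⟩
  obtain ⟨α, hα⟩ : ∃ α : ℕ → ℝ, α = fun k => θ (i0 + k) := ⟨_, rfl⟩
  obtain ⟨S, hS⟩ : ∃ S : ℕ → ℝ, S = fun k => T (i0 + k) := ⟨_, rfl⟩
  have hw' : ∀ k, 0 < S k ∧ u (k + 1) = u k + S k * cis (α k) ∧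
      (∀ r : ℝ, 0 < r → r < S k → HP N (u k + r * cis (α k)) (α k)) ∧ u k ∈ nonflat N ∧
      |α (k + 1) - α k| < π ∧ ∃ a ρ, LS N (u k) (α k) a ρ := by
    intro k; rw [hu, hα, hS]; exact hw (i0 + k)
  have hun : u n = u 0 := by rw [hu]; exact hi0.symm
  have hinj : ∀ m l, m < n → l < n → u m = u l → m = l := by
    intro m l hm hl he
    rw [hu] at he
    by_contra hne
    rcases lt_or_gt_of_ne hne with h | h
    · exact hmin (l - m) (by omega) ⟨by omega, i0 + m, by rw [show i0 + m + (l - m) = i0 + l by omega]; exact he⟩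
    · exact hmin (m - l) (by omega) ⟨by omega, i0 + l, by rw [show i0 + l + (m - l) = i0 + m by omega]; exact he.symm⟩
  have hnz : (n : ℤ) ≠ 0 := by omega
  let V : ℤ → ℂ := fun k => u (k % n).toNat
  have key : ∀ k : ℤ, ∃ m : ℕ, m = (k % n).toNat ∧ m < n ∧ V k = u m ∧ V (k + 1) = u (m + 1) ∧
      cis (α ((k + 1) % n).toNat) = cis (α (m + 1)) := by
    intro k
    have h1 := Int.emod_nonneg k hnz
    have h2 := Int.emod_lt_of_pos k (show (0:ℤ) < n by omega)
    refine ⟨_, rfl, by omega, rfl, ?_⟩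
    by_cases hc : k % n + 1 = n
    · have e : (k + 1) % n = 0 := by rw [← Int.emod_add_emod, hc, Int.emod_self]
      have e2 : (k % n).toNat + 1 = n := by omega
      simp only [V, e, e2, hun, Int.toNat_zero, true_and]
      obtain ⟨_, _, g1⟩ := (hw' 0).2.2.2.2.2
      obtain ⟨_, _, g2⟩ := (hw' n).2.2.2.2.2
      rw [hun] at g2
      obtain ⟨k, hk, -⟩ := g2.unique hN g1
      rw [hk, cis_int]
    · have e : (k + 1) % n = k % n + 1 := by
        rw [← Int.emod_add_emod, Int.emod_eq_of_lt] <;> omega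
      have e2 : (k % n + 1).toNat = (k % n).toNat + 1 := by omega
      simp only [V, e, e2, and_self]
  have hd : ∀ k : ℤ, V (k + 1) - V k = S (k % n).toNat * cis (α (k % n).toNat) := by
    intro k
    obtain ⟨m, e, -, e1, e2, -⟩ := key k
    rw [e1, e2, (hw' m).2.1, ← e]; ring
  have hdd : ∀ k : ℤ, Dir (V (k + 1) - V k) (α (k % n).toNat) := fun k => by
    rw [hd]; exact dir_mk (hw' _).1 _
  have hVm : ∀ i : ℤ, V i = u (i % n).toNat := fun i => rfl
  refine ⟨⟨n, hn0, V, ?_, fun k => (hdd k).ne, ?_, ?_⟩, ?_, ?_⟩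
  · intro k; simp [V]
  · intro k
    obtain ⟨m, e, -, -, -, e3⟩ := key k
    have h1 : Dir (V (k + 1 + 1) - V (k + 1)) (α (m + 1)) := by
      rw [hd, e3]; exact dir_mk (hw' _).1 _
    have h2 := hdd k
    rw [← e] at h2
    exact slit_of (h1.div h2) (hw' m).2.2.2.2.1
  · intro i j i0 i1 j0 j1 s t s0 s1 t0 t1 he
    rw [hd, hd, hVm, hVm] at he
    rw [Int.emod_eq_of_lt i0 i1, Int.emod_eq_of_lt j0 j1] at he
    have hml : u i.toNat = u j.toNat → i = j ∧ i.toNat = j.toNat := fun h => by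
      have := hinj _ _ (by omega) (by omega) h
      exact ⟨by omega, this⟩
    generalize i.toNat = m at *
    generalize j.toNat = l at *
    rw [← mul_assoc, ← mul_assoc, ← Complex.ofReal_mul, ← Complex.ofReal_mul] at he
    have flat : ∀ (m : ℕ) (s : ℝ), 0 < s → s < 1 →
        HP N (u m + ((s * S m : ℝ) : ℂ) * cis (α m)) (α m) := fun m s h1 h2 =>
      (hw' m).2.2.1 _ (mul_pos h1 (hw' m).1) (by nlinarith [(hw' m).1])
    rcases s0.eq_or_lt with hs | hs
    · rcases t0.eq_or_lt with ht | ht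
      · subst hs ht
        simp at he
        exact ⟨(hml he).1, rfl⟩
      · have := flat l t ht t1
        rw [← he, ← hs] at this
        simp at this
        exact absurd this ((hw' m).2.2.2.1.2 _)
    · rcases t0.eq_or_lt with ht | ht
      · have := flat m s hs s1
        rw [he, ← ht] at this
        simp at this
        exact absurd this ((hw' l).2.2.2.1.2 _)
      · have f1 := flat m s hs s1
        have f2 := flat l t ht t1
        rw [← he] at f2
        obtain ⟨k, hk⟩ := f1.unique hN f2
        have hc : cis (α l) = cis (α m) := by rw [hk, cis_int]
        rw [hc] at he
        have sm := (hw' m).1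
        have sl := (hw' l).1
        rcases lt_trichotomy (s * S m) (t * S l) with g | g | g
        · have := (hw' l).2.2.1 (t * S l - s * S m) (by linarith) (by nlinarith)
          rw [hc, show u l + ((t * S l - s * S m : ℝ) : ℂ) * cis (α m) = u m by
            push_cast; push_cast at he; linear_combination -he] at this
          exact absurd this ((hw' m).2.2.2.1.2 _)
        · rw [g] at he
          have := hml (add_right_cancel he)
          refine ⟨this.1, ?_⟩
          rw [this.2] at g
          exact mul_right_cancel₀ sl.ne' g
        · have := (hw' m).2.2.1 (s * S m - t * S l) (by linarith) (by nlinarith)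
          rw [show u m + ((s * S m - t * S l : ℝ) : ℂ) * cis (α m) = u l by
            push_cast; push_cast at he; linear_combination he] at this
          exact absurd this ((hw' l).2.2.2.1.2 _)
  · intro k; exact (hw' _).2.2.2.1.1
  · intro k
    refine ⟨_, hdd k, fun t h1 h2 => ?_⟩
    show HP N (V k + t * (V (k + 1) - V k)) _
    rw [hd, hVm, ← mul_assoc, ← Complex.ofReal_mul]
    exact (hw' _).2.2.1 _ (mul_pos h1 (hw' _).1) (by nlinarith [(hw' (k % n).toNat).1])

end MS
end

section
open Filter
set_option linter.all false
namespace MS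
namespace CPoly
variable (C : CPoly)

def d (k : ℤ) : ℂ := C.V (k + 1) - C.V k

def x (s : ℝ) : ℂ := C.V ⌊s⌋ + (Int.fract s : ℝ) * C.d ⌊s⌋

lemma x_on {k : ℤ} {s : ℝ} (h1 : (k : ℝ) ≤ s) (h2 : s ≤ k + 1) : C.x s = C.V k + ((s - k : ℝ) : ℂ) * C.d k := by
  rcases h2.lt_or_eq with h2 | h2
  · have : ⌊s⌋ = k := Int.floor_eq_iff.2 ⟨h1, h2⟩
    rw [x, Int.fract, this]
  · have h3 : s = ((k + 1 : ℤ) : ℝ) := by push_cast; exact h2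
    have e : ⌊s⌋ = k + 1 := by rw [h3, Int.floor_intCast]
    rw [x, Int.fract, e, h3, d, d]; push_cast; ring

lemma x_int (k : ℤ) : C.x k = C.V k := by
  rw [C.x_on le_rfl (by linarith)]; simp

lemma x_cont : Continuous C.x := by
  rw [continuous_iff_continuousAt]
  intro s
  rw [continuousAt_iff_continuous_left_right]
  constructor
  · have h1 : ((⌈s⌉ - 1 : ℤ) : ℝ) < s := by push_cast; linarith [Int.ceil_lt_add_one s]
    have h2 : s ≤ ((⌈s⌉ - 1 : ℤ) : ℝ) + 1 := by push_cast; linarith [Int.le_ceil s]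
    generalize ⌈s⌉ - 1 = k at h1 h2
    have hc : ContinuousWithinAt (fun s : ℝ => C.V k + ((s - k : ℝ) : ℂ) * C.d k) (Iic s) s := by
      apply Continuous.continuousWithinAt; fun_prop
    refine hc.congr_of_eventuallyEq ?_ (C.x_on h1.le h2)
    filter_upwards [Ioc_mem_nhdsLE h1] with t ht
    exact C.x_on ht.1.le (ht.2.trans h2)
  · have h1 := Int.floor_le s
    have h2 := Int.lt_floor_add_one s
    generalize ⌊s⌋ = k at h1 h2
    have hc : ContinuousWithinAt (fun s : ℝ => C.V k + ((s - k : ℝ) : ℂ) * C.d k) (Ici s) s := by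
      apply Continuous.continuousWithinAt; fun_prop
    refine hc.congr_of_eventuallyEq ?_ (C.x_on h1 h2.le)
    filter_upwards [Ico_mem_nhdsGE h2] with t ht
    exact C.x_on (h1.trans ht.1) ht.2.le

lemma d_per (k : ℤ) : C.d (k + C.n) = C.d k := by
  rw [d, d, show k + C.n + 1 = k + 1 + (C.n : ℤ) by ring, C.per, C.per]

lemma x_per (s : ℝ) : C.x (s + C.n) = C.x s := by
  rw [x, x, Int.floor_add_natCast, Int.fract_add_natCast, C.per, C.d_per]

lemma x_inj0 {s s' : ℝ} (h0 : 0 ≤ s) (h1 : s < C.n) (h0' : 0 ≤ s') (h1' : s' < C.n)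
    (h : C.x s = C.x s') : s = s' := by
  obtain ⟨e1, e2⟩ := C.inj ⌊s⌋ ⌊s'⌋ (Int.floor_nonneg.2 h0) (Int.floor_lt.2 (by exact_mod_cast h1))
    (Int.floor_nonneg.2 h0') (Int.floor_lt.2 (by exact_mod_cast h1')) _ _ (Int.fract_nonneg s)
    (Int.fract_lt_one s) (Int.fract_nonneg s') (Int.fract_lt_one s') h
  rw [← Int.floor_add_fract s, ← Int.floor_add_fract s', e1, e2]

lemma x_inj {s s' : ℝ} (h1 : s < s') (h2 : s' < s + C.n) : C.x s' - C.x s ≠ 0 := by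
  intro h
  have hn : (0:ℝ) < C.n := by exact_mod_cast C.npos
  obtain ⟨m, ⟨m1, m2⟩, -⟩ := existsUnique_add_zsmul_mem_Ico hn s 0
  rw [zsmul_eq_mul] at m1 m2
  have e : C.x (s' + m * C.n) = C.x (s + m * C.n) := by
    rw [Loop.per_int C.x_per, Loop.per_int C.x_per]; exact sub_eq_zero.1 h
  rcases lt_or_ge (s' + m * C.n) C.n with g | g
  · have := C.x_inj0 (by linarith) g m1 (by linarith) e
    linarith
  · have e2 : C.x (s' + m * C.n - C.n) = C.x (s + m * C.n) := by
      rw [← e, ← C.x_per (s' + m * C.n - C.n), sub_add_cancel]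
    have := C.x_inj0 (by linarith) (by linarith) m1 (by linarith) e2
    linarith

def D : Set (ℝ × ℝ) := {p | p.1 < p.2 ∧ p.2 < p.1 + C.n}

lemma D_convex : Convex ℝ C.D := by
  have : C.D = (LinearMap.snd ℝ ℝ ℝ - LinearMap.fst ℝ ℝ ℝ) ⁻¹' (Ioo 0 (C.n : ℝ)) := by
    ext p
    simp only [D, mem_setOf_eq, mem_preimage, LinearMap.sub_apply, LinearMap.snd_apply,
      LinearMap.fst_apply, mem_Ioo]
    constructor <;> rintro ⟨h1, h2⟩ <;> constructor <;> linarith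
  rw [this]
  exact (convex_Ioo _ _).linear_preimage _

lemma D_open : IsOpen C.D :=
  (isOpen_lt continuous_fst continuous_snd).inter (isOpen_lt continuous_snd (by fun_prop))

lemma slit_comb {ρ : ℂ} (h : ρ ∈ Complex.slitPlane) {u t : ℝ} (hu : 0 ≤ u) (ht : 0 ≤ t) (hut : 0 < u + t) :
    (u : ℂ) * ρ + t ∈ Complex.slitPlane := by
  rw [Complex.mem_slitPlane_iff] at h ⊢
  simp only [Complex.add_re, Complex.add_im, Complex.re_ofReal_mul, Complex.im_ofReal_mul,
    Complex.ofReal_re, Complex.ofReal_im, add_zero]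
  rcases hu.eq_or_lt with h0 | h0
  · left; rw [← h0]; linarith
  · by_cases hi : ρ.im = 0
    · left
      have : 0 < ρ.re := by rcases h with h | h; exact h; exact absurd hi h
      have := mul_pos h0 this
      linarith
    · right; exact mul_ne_zero h0.ne' hi

theorem loop : ∃ (m : ℤ) (γ : Loop (2 * m + 1)) (θ : ℤ → ℝ), γ.x = C.x ∧ γ.n = C.n ∧
    (∀ k, Dir (C.d k) (θ k)) ∧ (∀ k, θ (k + 1) - θ k = (C.d (k + 1) / C.d k).arg) ∧
    (∀ s, γ.θo s = θ ⌊s⌋) ∧ (∀ s, γ.θi s = θ (⌈s⌉ - 1)) := by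
  have hn : (1:ℝ) ≤ C.n := by exact_mod_cast C.npos
  have hxc := C.x_cont
  have hfc : Continuous fun p : ℝ × ℝ => C.x p.2 - C.x p.1 := by fun_prop
  obtain ⟨F, hF, hFd⟩ := lift_exists C.D_open C.D_convex ⟨(0, 1/2), by norm_num, by
    show (1/2 : ℝ) < 0 + C.n; linarith⟩ (f := fun p => C.x p.2 - C.x p.1) hfc.continuousOn
    (fun p hp => C.x_inj hp.1 hp.2)
  have dne : ∀ k, C.d k ≠ 0 := C.dne
  -- edge triangles
  have tri : ∀ k : ℤ, ∃ θ, Dir (C.d k) θ ∧ ∀ s s' : ℝ, (k : ℝ) ≤ s → s < s' → s' ≤ k + 1 → s' < s + C.n →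
      F (s, s') = θ := by
    intro k
    have hS : IsPreconnected (C.D ∩ (Icc (k:ℝ) (k + 1) ×ˢ Icc (k:ℝ) (k + 1))) :=
      (C.D_convex.inter ((convex_Icc _ _).prod (convex_Icc _ _))).isPreconnected
    obtain ⟨m, hm⟩ := lift_unique hS (f := fun p => C.x p.2 - C.x p.1) (hF.mono inter_subset_left)
      (continuousOn_const (c := (C.d k).arg)) (fun p hp => hFd p hp.1) (by
        rintro ⟨s, s'⟩ ⟨⟨h1, h2⟩, ⟨h3, h4⟩, h5, h6⟩
        simp only at *
        rw [C.x_on h5 h6, C.x_on h3 h4]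
        have := (dir_arg (dne k)).smul (c := s' - s) (by linarith)
        convert this using 1
        push_cast; ring)
    exact ⟨_, (dir_arg (dne k)).add_int m, fun s s' h1 h2 h3 h4 => hm (s, s')
      ⟨⟨h2, h4⟩, ⟨h1, by linarith⟩, by linarith, h3⟩⟩
  choose θ hθ hθF using tri
  have turn : ∀ k, θ (k + 1) - θ k = (C.d (k + 1) / C.d k).arg := by
    intro k
    have hS : IsPreconnected (C.D ∩ (Icc (k:ℝ) (k + 1) ×ˢ Icc (k + 1:ℝ) (k + 2))) :=
      (C.D_convex.inter ((convex_Icc _ _).prod (convex_Icc _ _))).isPreconnected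
    have hval : ∀ s s' : ℝ, (k:ℝ) ≤ s → s ≤ k + 1 → (k : ℝ) + 1 ≤ s' → s' ≤ k + 2 →
        (C.x s' - C.x s) / C.d k = ((s' - (k + 1) : ℝ) : ℂ) * (C.d (k + 1) / C.d k) + ((k + 1 - s : ℝ) : ℂ) := by
      intro s s' h1 h2 h3 h4
      rw [C.x_on h1 h2, C.x_on (k := k + 1) (s := s') (by push_cast; exact h3) (by push_cast; linarith)]
      have hd0 := dne k
      have e : C.V (k + 1) = C.V k + C.d k := by rw [d]; ring
      rw [e]
      field_simp
      push_cast; ring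
    have hslit : ∀ p ∈ C.D ∩ (Icc (k:ℝ) (k + 1) ×ˢ Icc (k + 1:ℝ) (k + 2)),
        (C.x p.2 - C.x p.1) / C.d k ∈ Complex.slitPlane := by
      rintro ⟨s, s'⟩ ⟨⟨h1, h2⟩, ⟨h3, h4⟩, h5, h6⟩
      simp only at *
      rw [hval s s' h3 h4 h5 h6]
      exact slit_comb (C.slit k) (by linarith) (by linarith) (by linarith)
    obtain ⟨m, hm⟩ := lift_unique hS (f := fun p => C.x p.2 - C.x p.1) (hF.mono inter_subset_left)
      (G := fun p => ((C.x p.2 - C.x p.1) / C.d k).arg + (C.d k).arg) (by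
        refine ContinuousOn.add ?_ continuousOn_const
        intro p hp
        exact ContinuousAt.comp_continuousWithinAt (g := Complex.arg)
          (f := fun p : ℝ × ℝ => (C.x p.2 - C.x p.1) / C.d k) (Complex.continuousAt_arg (hslit p hp))
          (hfc.div_const _).continuousWithinAt) (fun p hp => hFd p hp.1) (by
        intro p hp
        have h := (dir_arg (Complex.slitPlane_ne_zero (hslit p hp))).mul (dir_arg (dne k))
        rwa [div_mul_cancel₀ _ (dne k)] at h)
    have e1 := hm (k + 1/2, k + 1) ⟨⟨by simp; norm_num, by simp only; linarith⟩,
      ⟨by simp, by simp; norm_num⟩, by simp, by simp⟩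
    have e2 := hm (k + 1, k + 1 + 1/2) ⟨⟨by simp, by simp only; linarith⟩,
      ⟨by simp, by simp⟩, by simp, by simp only; linarith⟩
    simp only at e1 e2
    rw [hθF k _ _ (by linarith) (by linarith) le_rfl (by linarith),
      hval _ _ (by linarith) (by linarith) (by linarith) (by linarith)] at e1
    rw [hθF (k + 1) _ _ (by push_cast; linarith) (by linarith) (by push_cast; linarith) (by linarith),
      hval _ _ (by linarith) (by linarith) (by linarith) (by linarith)] at e2
    have a1 : (((k + 1 - (k + 1) : ℝ) : ℂ) * (C.d (k + 1) / C.d k) + ((k + 1 - (k + 1/2) : ℝ) : ℂ)).arg = 0 := by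
      rw [sub_self, Complex.ofReal_zero, zero_mul, zero_add]
      exact Complex.arg_ofReal_of_nonneg (by linarith)
    have a2 : (((k + 1 + 1/2 - (k + 1) : ℝ) : ℂ) * (C.d (k + 1) / C.d k) + ((k + 1 - (k + 1) : ℝ) : ℂ)).arg =
        (C.d (k + 1) / C.d k).arg := by
      rw [sub_self, Complex.ofReal_zero, add_zero]
      exact Complex.arg_real_mul _ (by linarith)
    rw [a1] at e1
    rw [a2] at e2
    linarith
  obtain ⟨m, hm⟩ := lift_unique C.D_convex.isPreconnected (f := fun p : ℝ × ℝ => C.x (p.1 + C.n) - C.x p.2)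
    (F := fun p : ℝ × ℝ => F (p.2, p.1 + C.n)) (G := fun p => F p + π)
    (hF.comp (by fun_prop) (fun p hp => ⟨hp.2, by simpa using hp.1⟩)) (hF.add continuousOn_const)
    (fun p hp => hFd (p.2, p.1 + C.n) ⟨hp.2, by simpa using hp.1⟩) (by
      intro p hp
      have := (hFd p hp).neg
      rwa [neg_sub, ← C.x_per] at this)
  refine ⟨m, ⟨C.x, C.n, fun s s' => F (s, s'), fun s => θ ⌊s⌋, fun s => θ (⌈s⌉ - 1), by linarith, hxc, C.x_per,
    hF, fun s s' h1 h2 => hFd (s, s') ⟨h1, h2⟩, ?_, ?_, ?_, ?_⟩, θ, rfl, rfl, hθ, turn, fun s => rfl, fun s => rfl⟩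
  · intro s s' h1 h2
    have := hm (s, s') ⟨h1, h2⟩
    simp only at this
    rw [this]; ring
  · intro s
    have h1 := Int.floor_le s
    have h2 := Int.lt_floor_add_one s
    exact ⟨⌊s⌋ + 1 - s, by linarith, fun s' g1 g2 => hθF _ _ _ h1 g1 (by linarith) (by linarith)⟩
  · intro s
    have h1 : ((⌈s⌉ - 1 : ℤ) : ℝ) < s := by push_cast; linarith [Int.ceil_lt_add_one s]
    have h2 : s ≤ ((⌈s⌉ - 1 : ℤ) : ℝ) + 1 := by push_cast; linarith [Int.le_ceil s]
    exact ⟨s - ((⌈s⌉ - 1 : ℤ) : ℝ), by linarith, fun s' g1 g2 => hθF _ _ _ (by linarith) g2 h2 (by linarith)⟩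
  · intro s
    by_cases hs : ∃ k : ℤ, (k : ℝ) = s
    · obtain ⟨k, rfl⟩ := hs
      have := turn (k - 1)
      rw [sub_add_cancel] at this
      simp only [Int.floor_intCast, Int.ceil_intCast]
      rw [this, abs_lt]
      have hs := C.slit (k - 1)
      rw [sub_add_cancel, Complex.mem_slitPlane_iff_arg] at hs
      have hs : (C.d k / C.d (k - 1)).arg ≠ π := by
        rw [d, d, sub_add_cancel]; exact hs.1
      exact ⟨Complex.neg_pi_lt_arg _, lt_of_le_of_ne (Complex.arg_le_pi _) hs⟩
    · have : ⌈s⌉ - 1 = ⌊s⌋ := by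
        have h1 := Int.floor_le s
        have h2 := Int.lt_floor_add_one s
        have h3 : (⌊s⌋ : ℝ) ≠ s := fun h => hs ⟨_, h⟩
        have : ⌈s⌉ = ⌊s⌋ + 1 := by
          rw [Int.ceil_eq_iff]; push_cast
          exact ⟨by rw [add_sub_cancel_right]; exact lt_of_le_of_ne h1 h3, h2.le⟩
        omega
      rw [this, sub_self, abs_zero]; exact Real.pi_pos

end CPoly
end MS
end

section
open Filter
set_option linter.all false
namespace MS

lemma slit_seg {a b p : ℂ} (h : ∀ t : ℝ, 0 ≤ t → t ≤ 1 → p ≠ a + t * (b - a)) :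
    (b - p) / (a - p) ∈ Complex.slitPlane := by
  have ha : a - p ≠ 0 := by
    intro h0; apply h 0 le_rfl zero_le_one; simp; rw [sub_eq_zero] at h0; exact h0.symm
  rw [Complex.mem_slitPlane_iff]
  by_contra hc
  push Not at hc
  obtain ⟨h1, h2⟩ := hc
  set ρ := ((b - p) / (a - p)).re with hρ
  have e : (b - p) / (a - p) = (ρ : ℂ) := by
    apply Complex.ext <;> simp [hρ, h2]
  rw [div_eq_iff ha] at e
  have h3 : 0 < 1 - ρ := by linarith
  apply h (1 / (1 - ρ)) (by positivity) (by rw [div_le_one h3]; linarith)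
  have h4 : (1 - ρ : ℂ) ≠ 0 := by exact_mod_cast h3.ne'
  push_cast
  field_simp
  linear_combination -e

namespace CPoly
variable (C : CPoly)

lemma off_seg {p : ℂ} (hp : p ∉ range C.x) (k : ℤ) (t : ℝ) (h0 : 0 ≤ t) (h1 : t ≤ 1) :
    p ≠ C.V k + t * (C.V (k + 1) - C.V k) := by
  intro h
  apply hp
  refine ⟨k + t, ?_⟩
  rw [C.x_on (k := k) (by linarith) (by linarith), h, d]
  simp

def tm (k : ℤ) (p : ℂ) : ℝ := ((C.V (k + 1) - p) / (C.V k - p)).arg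

lemma tm_cont {k : ℤ} {p : ℂ} (h : ∀ t : ℝ, 0 ≤ t → t ≤ 1 → p ≠ C.V k + t * (C.V (k + 1) - C.V k)) :
    ContinuousAt (C.tm k) p := by
  have hs := slit_seg h
  have hne : C.V k - p ≠ 0 := by
    intro h0; apply h 0 le_rfl zero_le_one; simp; rw [sub_eq_zero] at h0; exact h0.symm
  exact ContinuousAt.comp (g := Complex.arg) (f := fun p => (C.V (k + 1) - p) / (C.V k - p))
    (Complex.continuousAt_arg hs)
    ((continuousAt_const.sub continuousAt_id).div (continuousAt_const.sub continuousAt_id) hne)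

def wd (p : ℂ) : ℝ := ∑ i ∈ Finset.range C.n, C.tm (i : ℤ) p

lemma wd_int {p : ℂ} (hp : p ∉ range C.x) : ∃ k : ℤ, C.wd p = k * (2 * π) := by
  have hne : ∀ k, C.V k - p ≠ 0 := by
    intro k h0
    apply hp ⟨k, by rw [C.x_int]; exact sub_eq_zero.1 h0⟩
  have key : ∀ m : ℕ, Dir ((C.V m - p) / (C.V 0 - p)) (∑ i ∈ Finset.range m, C.tm (i : ℤ) p) := by
    intro m
    induction m with
    | zero =>
      simp only [Nat.cast_zero, Finset.range_zero, Finset.sum_empty]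
      rw [div_self (hne 0)]
      simpa [cis_zero] using dir_cis 0
    | succ m ih =>
      rw [Finset.sum_range_succ]
      have h2 : Dir ((C.V (m + 1) - p) / (C.V m - p)) (C.tm (m : ℤ) p) :=
        dir_arg (div_ne_zero (hne _) (hne _))
      have := ih.mul h2
      convert this using 1
      have := hne m
      have := hne 0
      push_cast
      field_simp
  have h1 := key C.n
  have e : C.V C.n = C.V 0 := by have := C.per 0; rwa [zero_add] at this
  rw [e, div_self (hne 0)] at h1
  have h0 : Dir (1 : ℂ) 0 := by simpa [cis_zero] using dir_cis 0
  obtain ⟨k, hk⟩ := h1.unique h0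
  exact ⟨k, by rw [wd, hk, zero_add]⟩

lemma wd_cont {p : ℂ} (hp : p ∉ range C.x) : ContinuousAt C.wd p := by
  unfold wd
  exact tendsto_finsetSum _ fun i _ => C.tm_cont (C.off_seg hp i)

lemma x_compact : IsCompact (range C.x) := by
  have : range C.x = C.x '' Icc 0 C.n := by
    apply Subset.antisymm
    · rintro _ ⟨s, rfl⟩
      have hn : (0:ℝ) < C.n := by exact_mod_cast C.npos
      obtain ⟨m, ⟨m1, m2⟩, -⟩ := existsUnique_add_zsmul_mem_Ico hn s 0
      rw [zsmul_eq_mul] at m1 m2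
      exact ⟨s + m * C.n, ⟨m1, by linarith⟩, Loop.per_int C.x_per s m⟩
    · rintro _ ⟨s, -, rfl⟩; exact ⟨s, rfl⟩
  rw [this]
  exact isCompact_Icc.image C.x_cont

/-- The polygon bounds the region on its left. -/
def Bd (N : Set ℂ) : Prop := (∀ k, C.V k ∈ frontier N) ∧
  ∀ k, ∃ θ, Dir (C.V (k + 1) - C.V k) θ ∧
    ∀ t : ℝ, 0 < t → t < 1 → HP N (C.V k + t * (C.V (k + 1) - C.V k)) θ

variable {C} {N : Set ℂ} {δ : ℝ}

lemma Bd.sub (h : C.Bd N) : range C.x ⊆ frontier N := by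
  rintro _ ⟨s, rfl⟩
  rcases (Int.fract_nonneg s).eq_or_lt with h0 | h0
  · rw [x, ← h0]; simpa using h.1 _
  · obtain ⟨θ, -, h2⟩ := h.2 ⌊s⌋
    exact (h2 _ h0 (Int.fract_lt_one s)).frontier

theorem Bd.trace (R : Reg δ N) (h : C.Bd N) : frontier N = range C.x := by
  refine Subset.antisymm ?_ h.sub
  intro q hq
  by_contra hqR
  obtain ⟨r, hr, hball⟩ := Metric.isOpen_iff.1 C.x_compact.isClosed.isOpen_compl q hqR
  -- the connected set
  have hfr : ∀ U, IsOpen U → q ∈ U → (U ∩ interior N).Nonempty ∧ (U ∩ Nᶜ).Nonempty := by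
    intro U hU hqU
    constructor
    · have : q ∈ closure (interior N) := by
        rw [← R.regular]; exact R.compact.isClosed.frontier_subset hq
      exact mem_closure_iff.1 this U hU hqU
    · have : q ∈ closure (Nᶜ) := by
        rw [frontier_eq_closure_inter_closure] at hq; exact hq.2
      exact mem_closure_iff.1 this U hU hqU
  obtain ⟨⟨a, ha1, ha2⟩, ⟨b, hb1, hb2⟩⟩ := hfr (Metric.ball q r) Metric.isOpen_ball (Metric.mem_ball_self hr)
  have hS : IsPreconnected ((interior N ∪ Metric.ball q r) ∪ Nᶜ) := by
    refine IsPreconnected.union b (Or.inr hb1) hb2 ?_ R.preconn_compl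
    exact IsPreconnected.union a ha2 ha1 R.conn (convex_ball q r).isPreconnected
  have hoff : ∀ p ∈ (interior N ∪ Metric.ball q r) ∪ Nᶜ, p ∉ range C.x := by
    rintro p ((hp | hp) | hp) hx
    · have := h.sub hx
      rw [R.compact.isClosed.frontier_eq] at this
      exact this.2 hp
    · exact hball hp hx
    · exact hp (R.compact.isClosed.frontier_subset (h.sub hx))
  obtain ⟨k, hk⟩ := int_const hS (g := C.wd) (fun p hp => (C.wd_cont (hoff p hp)).continuousWithinAt)
    (fun p hp => C.wd_int (hoff p hp))
  obtain ⟨θ, ⟨ρ, hρ, hd⟩, hHP⟩ := h.2 0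
  rw [zero_add] at hd
  obtain ⟨ε0, hε0, hε⟩ := hHP (1/2) (by norm_num) (by norm_num)
  rw [zero_add] at hε
  set D0 := C.V 1 - C.V 0 with hD0
  have hD : D0 ≠ 0 := by have := C.dne 0; rwa [zero_add] at this
  set m := C.V 0 + ((1/2 : ℝ) : ℂ) * D0 with hm
  have hmem : ∀ e : ℝ, e ≠ 0 → |e| * ‖D0‖ < ε0 → m + (e : ℂ) * Complex.I * D0 ∈
      (interior N ∪ Metric.ball q r) ∪ Nᶜ := by
    intro e he h1
    have h2 := hε (m + (e : ℂ) * Complex.I * D0) (by simpa using h1)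
    have h3 : ((m + (e : ℂ) * Complex.I * D0 - m) * cis (-θ)).im = e * ρ := by
      have : cis θ * cis (-θ) = 1 := by rw [← cis_add]; simp [cis_zero]
      rw [hd]
      rw [show (m + (e : ℂ) * Complex.I * (ρ * cis θ) - m) * cis (-θ) = (e * ρ : ℝ) * Complex.I * (cis θ * cis (-θ)) by push_cast; ring, this]
      simp
    rw [h3] at h2
    rcases lt_or_gt_of_ne he with h4 | h4
    · right; exact h2.2.1 (mul_neg_of_neg_of_pos h4 hρ)
    · left; left; exact h2.1 (mul_pos h4 hρ)
  -- the rest of the sum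
  obtain ⟨n', hn'⟩ : ∃ n', C.n = n' + 1 := ⟨C.n - 1, by have := C.npos; omega⟩
  have hsum : ∀ p, C.wd p = (∑ i ∈ Finset.range n', C.tm ((i : ℤ) + 1) p) + C.tm 0 p := by
    intro p
    rw [wd, hn', Finset.sum_range_succ']; simp
  have hcont : ContinuousAt (fun p => ∑ i ∈ Finset.range n', C.tm ((i : ℤ) + 1) p) m := by
    refine tendsto_finsetSum _ fun i hi => C.tm_cont ?_
    intro t ht0 ht1 e
    have hm2 : C.x (1/2) = m := by
      rw [C.x_on (k := 0) (by simp) (by norm_num)]; simp [hm, d, hD0]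
    have hx : C.x (((i : ℤ) + 1 : ℤ) + t) = m := by
      rw [e, C.x_on (k := (i : ℤ) + 1) (by linarith) (by linarith), d]; simp
    have hi' : (i : ℝ) + 1 ≤ n' := by exact_mod_cast Finset.mem_range.1 hi
    have hn'' : (C.n : ℝ) = n' + 1 := by exact_mod_cast hn'
    have i0 : (0:ℝ) ≤ i := by positivity
    refine C.x_inj (s := 1/2) (s' := ((i : ℤ) + 1 : ℤ) + t) (by push_cast; linarith) (by push_cast; rw [hn'']; linarith) ?_
    rw [hm2, hx, sub_self]
  set g := fun p => ∑ i ∈ Finset.range n', C.tm ((i : ℤ) + 1) p with hg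
  have hc2 : ContinuousAt (fun e : ℝ => g (m + (e : ℂ) * Complex.I * D0)) 0 := by
    apply ContinuousAt.comp (g := g) (f := fun e : ℝ => m + (e : ℂ) * Complex.I * D0)
    · simpa using hcont
    · fun_prop
  obtain ⟨η, hη, hclose⟩ := Metric.continuousAt_iff.1 hc2 (π/4) (by positivity)
  have hnD := norm_pos_iff.2 hD
  obtain ⟨e, he0, he1, he2, he3⟩ : ∃ e : ℝ, 0 < e ∧ e < η ∧ e * ‖D0‖ < ε0 ∧ e < 1/4 := by
    refine ⟨min (min (η / 2) (ε0 / (2 * ‖D0‖))) (1/8), by positivity, ?_, ?_, ?_⟩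
    · exact (min_le_left _ _).trans_lt ((min_le_left _ _).trans_lt (by linarith))
    · have : min (min (η / 2) (ε0 / (2 * ‖D0‖))) (1/8) ≤ ε0 / (2 * ‖D0‖) :=
        (min_le_left _ _).trans (min_le_right _ _)
      calc _ ≤ ε0 / (2 * ‖D0‖) * ‖D0‖ := by gcongr
        _ = ε0 / 2 := by field_simp
        _ < ε0 := by linarith
    · exact (min_le_right _ _).trans_lt (by norm_num)
  have htm : ∀ e : ℝ, C.tm 0 (m + (e : ℂ) * Complex.I * D0) =
      ((((-(1 - 4 * e ^ 2) : ℝ) : ℂ) + ((4 * e : ℝ) : ℂ) * Complex.I) / ((1 + 4 * e ^ 2 : ℝ) : ℂ)).arg := by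
    intro e
    rw [tm, zero_add]
    congr 1
    have e1 : C.V 1 - (m + (e : ℂ) * Complex.I * D0) = D0 * (1/2 - e * Complex.I) := by
      rw [hm, show C.V 1 = C.V 0 + D0 by rw [hD0]; ring]; push_cast; ring
    have e2 : C.V 0 - (m + (e : ℂ) * Complex.I * D0) = D0 * (-1/2 - e * Complex.I) := by
      rw [hm]; push_cast; ring
    rw [e1, e2, mul_div_mul_left _ _ hD]
    have h1 : (-1/2 - (e:ℂ) * Complex.I) ≠ 0 := by
      intro h; have := congrArg Complex.re h; norm_num at this
    have h2 : ((1 + 4 * e ^ 2 : ℝ) : ℂ) ≠ 0 := by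
      have : (0:ℝ) < 1 + 4 * e ^ 2 := by positivity
      exact_mod_cast this.ne'
    rw [div_eq_div_iff h1 h2]
    push_cast
    linear_combination (4 * (e:ℂ)^2) * Complex.I_sq
  have hre : ∀ e : ℝ, ((((-(1 - 4 * e ^ 2) : ℝ) : ℂ) + ((4 * e : ℝ) : ℂ) * Complex.I) / ((1 + 4 * e ^ 2 : ℝ) : ℂ)).re
      = -(1 - 4 * e ^ 2) / (1 + 4 * e ^ 2) := by
    intro e
    rw [Complex.div_ofReal_re, Complex.add_re, Complex.re_ofReal_mul, Complex.ofReal_re]; simp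
  have him : ∀ e : ℝ, ((((-(1 - 4 * e ^ 2) : ℝ) : ℂ) + ((4 * e : ℝ) : ℂ) * Complex.I) / ((1 + 4 * e ^ 2 : ℝ) : ℂ)).im
      = 4 * e / (1 + 4 * e ^ 2) := by
    intro e
    rw [Complex.div_ofReal_im, Complex.add_im, Complex.im_ofReal_mul, Complex.ofReal_im]; simp
  have habs : ∀ f : ℝ, |f| < 1/4 → π / 2 < |C.tm 0 (m + (f : ℂ) * Complex.I * D0)| := by
    intro f hf
    rw [htm, ← not_le, Complex.abs_arg_le_pi_div_two_iff, hre, not_le]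
    rw [abs_lt] at hf
    apply div_neg_of_neg_of_pos
    · nlinarith
    · positivity
  have hp1 : π / 2 < C.tm 0 (m + (e : ℂ) * Complex.I * D0) := by
    have h1 := habs e (by rwa [abs_of_pos he0])
    rwa [abs_of_nonneg] at h1
    rw [htm, Complex.arg_nonneg_iff, him]; positivity
  have hp2 : C.tm 0 (m + ((-e : ℝ) : ℂ) * Complex.I * D0) < - (π / 2) := by
    have h1 := habs (-e) (by rwa [abs_neg, abs_of_pos he0])
    rw [abs_of_neg] at h1
    · linarith
    rw [htm, Complex.arg_neg_iff, him]
    apply div_neg_of_neg_of_pos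
    · linarith
    · positivity
  have w1 := hk _ (hmem e he0.ne' (by rwa [abs_of_pos he0]))
  have w2 := hk _ (hmem (-e) (by linarith) (by rwa [abs_neg, abs_of_pos he0]))
  have c1 := hclose (x := e) (by simpa [abs_of_pos he0] using he1)
  have c2 := hclose (x := -e) (by simpa [abs_of_pos he0] using he1)
  rw [hsum] at w1 w2
  change g _ + _ = _ at w1
  change g _ + _ = _ at w2
  rw [Real.dist_eq, abs_lt] at c1 c2
  linarith [c1.1, c1.2, c2.1, c2.2, Real.pi_pos]

theorem Bd.rot (R : Reg δ N) (h : C.Bd N) : ∃ (γ : Loop 1) (θ : ℤ → ℝ), γ.x = C.x ∧ γ.n = C.n ∧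
    (∀ k, Dir (C.d k) (θ k)) ∧ (∀ k, θ (k + 1) - θ k = (C.d (k + 1) / C.d k).arg) ∧
    (∀ s, γ.θo s = θ ⌊s⌋) ∧ (∀ s, γ.θi s = θ (⌈s⌉ - 1)) := by
  obtain ⟨m, γ, θ, h1, h2, h3, h4, h5, h6⟩ := C.loop
  suffices hm : m = 0 by
    have hc : 2 * (m : ℝ) + 1 = 1 := by rw [hm]; norm_num
    clear hm
    generalize 2 * (m : ℝ) + 1 = c at γ h1 h2 h5 h6 hc
    subst hc
    exact ⟨γ, θ, h1, h2, h3, h4, h5, h6⟩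
  have hp := Real.pi_pos
  have hx : C.x (1/2) ∈ frontier N := h.sub ⟨_, rfl⟩
  obtain ⟨ω, hω⟩ := R.free (z := C.x (1/2)) (by
    rw [R.compact.isClosed.frontier_eq] at hx; exact hx.2)
  obtain ⟨k, -, b1, b2⟩ := γ.free_bd (s := 1/2) (ω := ω) (by
    rw [h1]; exact hω.mono (h.sub.trans R.compact.isClosed.frontier_subset))
  rw [h5, show ⌊(1/2:ℝ)⌋ = 0 by norm_num] at b1
  rw [h6, show ⌈(1/2:ℝ)⌉ - 1 = 0 by norm_num] at b2
  have m1 : -(2:ℝ) < 2 * m + 1 := by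
    by_contra hc; rw [not_lt] at hc; nlinarith
  have m2 : 2 * (m:ℝ) + 1 < 2 := by
    by_contra hc; rw [not_lt] at hc; nlinarith
  have m1' : (-3:ℤ) < 2 * m := by exact_mod_cast (by linarith : (-3:ℝ) < 2 * m)
  have m2' : 2 * m < (1:ℤ) := by exact_mod_cast (by linarith : 2 * (m:ℝ) < 1)
  rcases (by omega : m = 0 ∨ m = -1) with h0 | h0
  · exact h0
  exfalso
  rw [h0] at b2
  push_cast at b2
  obtain ⟨θ0, hd, hHP⟩ := h.2 0
  have hH := hHP (1/2) (by norm_num) (by norm_num)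
  have hxe : C.x (1/2) = C.V 0 + ((1/2 : ℝ) : ℂ) * (C.V (0 + 1) - C.V 0) := by
    rw [C.x_on (k := 0) (by simp) (by norm_num)]; simp [d]
  rw [← hxe] at hH
  obtain ⟨l, hl⟩ := (h3 0).unique hd
  have hH := hH.int l
  rw [← hl] at hH
  obtain ⟨ε, hε, hH⟩ := hH
  have h7 := hω (ε / 2) (by linarith)
  have h8 := (hH (C.x (1/2) + ((ε / 2 : ℝ) : ℂ) * cis ω) (by
    rw [add_sub_cancel_left, norm_mul, norm_cis, mul_one, Complex.norm_real, Real.norm_eq_abs, abs_of_pos (by linarith)]; linarith)).1 (by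
    rw [add_sub_cancel_left, im_cis]
    have e : sin (ω - θ 0) = sin (ω + k * (2 * π) + 2 * π - θ 0) := by
      rw [← Real.sin_add_int_mul_two_pi (ω - θ 0) (k + 1)]; congr 1; push_cast; ring
    rw [e]
    exact mul_pos (by linarith) (Real.sin_pos_of_pos_of_lt_pi (by linarith) (by linarith)))
  exact h7 (interior_subset h8)
end CPoly
end MS
end

section
open Filter
set_option linter.all false
namespace MS
open Classical in
def sumLines (C D : CPoly) : Finset (ℂ × ℂ) :=
  (Finset.range C.n ×ˢ Finset.range D.n).image (fun p => (C.V p.1 + D.V p.2, C.d p.1)) ∪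
  (Finset.range C.n ×ˢ Finset.range D.n).image (fun p => (C.V p.1 + D.V p.2, D.d p.2))

lemma CPoly.exists_rep {C : CPoly} {z : ℂ} (h : z ∈ range C.x) : ∃ (i : ℕ) (a : ℝ), i < C.n ∧ 0 ≤ a ∧ a < 1 ∧
    z = C.V i + a * C.d i := by
  obtain ⟨s, rfl⟩ := h
  have hn : (0:ℝ) < C.n := by exact_mod_cast C.npos
  obtain ⟨m, ⟨m1, m2⟩, -⟩ := existsUnique_add_zsmul_mem_Ico hn s 0
  rw [zsmul_eq_mul] at m1 m2
  have f0 := Int.floor_nonneg.2 m1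
  have e : ((⌊s + m * C.n⌋.toNat : ℕ) : ℤ) = ⌊s + m * C.n⌋ := Int.toNat_of_nonneg f0
  have f1 : ⌊s + m * C.n⌋ < C.n := Int.floor_lt.2 (by push_cast; linarith)
  refine ⟨⌊s + m * C.n⌋.toNat, Int.fract (s + m * C.n), by omega, Int.fract_nonneg _, Int.fract_lt_one _, ?_⟩
  rw [e, ← Loop.per_int C.x_per s m, CPoly.x]

lemma CPoly.mem_range (C : CPoly) (i : ℤ) {a : ℝ} (h0 : 0 ≤ a) (h1 : a ≤ 1) : C.V i + a * C.d i ∈ range C.x :=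
  ⟨i + a, by rw [C.x_on (k := i) (by linarith) (by linarith)]; simp⟩

theorem onLines_sum {C D : CPoly} {K L : Set ℂ} (hK : IsCompact K) (hL : IsCompact L)
    (fK : frontier K = range C.x) (fL : frontier L = range D.x) : OnLines (sumLines C D) (K + L) := by
  constructor
  · intro p hp
    rw [sumLines, Finset.mem_union, Finset.mem_image, Finset.mem_image] at hp
    rcases hp with ⟨q, -, rfl⟩ | ⟨q, -, rfl⟩
    · exact C.dne _
    · exact D.dne _
  intro w hw
  have hwN := (hK.add hL).isClosed.frontier_eq ▸ hw
  obtain ⟨x, hx, y, hy, rfl⟩ := frontier_add hK hL hw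
  rw [fK] at hx
  rw [fL] at hy
  obtain ⟨i, a, hi, a0, a1, rfl⟩ := C.exists_rep hx
  obtain ⟨j, b, hj, b0, b1, rfl⟩ := D.exists_rep hy
  have m1 : (C.V i + D.V j, C.d i) ∈ sumLines C D := by
    rw [sumLines, Finset.mem_union, Finset.mem_image]
    exact Or.inl ⟨(i, j), by simp [hi, hj], rfl⟩
  have m2 : (C.V i + D.V j, D.d j) ∈ sumLines C D := by
    rw [sumLines, Finset.mem_union, Finset.mem_image, Finset.mem_image]
    exact Or.inr ⟨(i, j), by simp [hi, hj], rfl⟩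
  rcases a0.eq_or_lt with a0 | a0
  · exact ⟨_, m2, b, by rw [← a0]; simp; ring⟩
  rcases b0.eq_or_lt with b0 | b0
  · exact ⟨_, m1, a, by rw [← b0]; simp; ring⟩
  have hd : C.d i ≠ 0 := C.dne _
  set d := C.d i with hdd
  set e := D.d j with hee
  by_cases hc : (starRingEnd ℂ d * e).im = 0
  · refine ⟨_, m1, a + b * (starRingEnd ℂ d * e).re / Complex.normSq d, ?_⟩
    have h1 : e = (((starRingEnd ℂ d * e).re / Complex.normSq d : ℝ) : ℂ) * d := by
      have h2 : starRingEnd ℂ d * e = (((starRingEnd ℂ d * e).re : ℝ) : ℂ) := by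
        apply Complex.ext <;> simp at hc ⊢; linarith
      have h3 : (Complex.normSq d : ℂ) ≠ 0 := by exact_mod_cast (Complex.normSq_pos.2 hd).ne'
      push_cast
      rw [← h2]
      rw [Complex.normSq_eq_conj_mul_self] at h3 ⊢
      rw [div_mul_eq_mul_div, eq_div_iff h3]; ring
    simp only
    conv_lhs => rw [h1]
    push_cast; ring
  exfalso
  apply hwN.2
  rw [mem_interior_iff_mem_nhds]
  set z := C.V i + a * d + (D.V j + b * e) with hz
  have cu : Continuous (fun w : ℂ => (starRingEnd ℂ (w - z) * e).im / (starRingEnd ℂ d * e).im) := by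
    have : Continuous (fun w : ℂ => starRingEnd ℂ (w - z)) := Complex.continuous_conj.comp (by fun_prop)
    exact (Complex.continuous_im.comp (this.mul continuous_const)).div_const _
  have cv : Continuous (fun w : ℂ => (starRingEnd ℂ d * (w - z)).im / (starRingEnd ℂ d * e).im) := by
    fun_prop
  have eu : ∀ᶠ w in nhds z, (starRingEnd ℂ (w - z) * e).im / (starRingEnd ℂ d * e).im ∈ Ioo (-a) (1 - a) := by
    apply cu.continuousAt.eventually_mem
    simp only [sub_self, map_zero, zero_mul, Complex.zero_im, zero_div]
    exact Ioo_mem_nhds (by linarith) (by linarith)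
  have ev : ∀ᶠ w in nhds z, (starRingEnd ℂ d * (w - z)).im / (starRingEnd ℂ d * e).im ∈ Ioo (-b) (1 - b) := by
    apply cv.continuousAt.eventually_mem
    simp only [sub_self, mul_zero, Complex.zero_im, zero_div]
    exact Ioo_mem_nhds (by linarith) (by linarith)
  filter_upwards [eu, ev] with w hu hv
  refine ⟨_, hK.isClosed.frontier_subset (fK ▸ C.mem_range i (a := a + (starRingEnd ℂ (w - z) * e).im / (starRingEnd ℂ d * e).im) (by linarith [hu.1]) (by linarith [hu.2])), _,
    hL.isClosed.frontier_subset (fL ▸ D.mem_range j (a := b + (starRingEnd ℂ d * (w - z)).im / (starRingEnd ℂ d * e).im) (by linarith [hv.1]) (by linarith [hv.2])), ?_⟩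
  have key : (((starRingEnd ℂ (w - z) * e).im / (starRingEnd ℂ d * e).im : ℝ) : ℂ) * d + (((starRingEnd ℂ d * (w - z)).im / (starRingEnd ℂ d * e).im : ℝ) : ℂ) * e = w - z := by
    generalize w - z = q
    have hc' : d.re * e.im - d.im * e.re ≠ 0 := by
      intro h; apply hc; simp; linarith
    have hc2 : -(d.im * e.re) + d.re * e.im ≠ 0 := by intro h; apply hc'; linarith
    apply Complex.ext
    · simp only [Complex.add_re, Complex.re_ofReal_mul, Complex.mul_im, Complex.conj_re, Complex.conj_im]
      have : d.re * e.im + -d.im * e.re ≠ 0 := by intro h; apply hc'; linarith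
      rw [div_mul_eq_mul_div, div_mul_eq_mul_div, ← add_div, div_eq_iff this]; ring
    · simp only [Complex.add_im, Complex.im_ofReal_mul]
      simp only [Complex.mul_im, Complex.conj_re, Complex.conj_im]
      have : d.re * e.im + -d.im * e.re ≠ 0 := by intro h; apply hc'; linarith
      rw [div_mul_eq_mul_div, div_mul_eq_mul_div, ← add_div, div_eq_iff this]; ring
  simp only
  rw [← hdd, ← hee]
  push_cast at key ⊢
  linear_combination key + hz
end MS
end

section
open Filter
set_option linter.all false
namespace MS

lemma contact_lev {K L : Set ℂ} {γ : Loop 1} (P : PolyC K γ) {δ : ℝ} (hδ0 : 0 < δ) (hδ : δ ≤ π)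
    (haco : γ.Aco δ) {s Θ : ℝ} {y : ℂ} (hy : y ∈ L) (hHP : HP (K + L) (γ.x s + y) Θ) :
    ∃ k : ℤ, γ.Lev (s + k * γ.n) Θ := by
  obtain ⟨ε, hε, hL, -⟩ := P.sides hδ0 hδ haco s
  obtain ⟨ε', hε', hH⟩ := hHP
  have hp := Real.pi_pos
  have hturn := abs_lt.1 (γ.turn s)
  have hinter : ∀ v ∈ interior K, v + y ∈ interior (K + L) := by
    intro v hv
    have : interior K + L ⊆ interior (K + L) := by
      apply interior_maximal (add_subset_add_right interior_subset)
      exact isOpen_interior.add_right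
    exact this ⟨v, hv, y, hy, rfl⟩
  have hsin : ∀ φ, γ.θo s < φ → φ < γ.θi s + π → 0 < sin (φ - Θ) := by
    intro φ h1 h2
    set r := min ε ε' / 2 with hr
    have r0 : 0 < r := by positivity
    have r1 : r < ε := by rw [hr]; linarith [min_le_left ε ε', lt_min hε hε']
    have r2 : r < ε' := by rw [hr]; linarith [min_le_right ε ε', lt_min hε hε']
    have h3 := hinter _ (hL ⟨r, φ, r0, r1, h1, h2, rfl⟩)
    have h4 := hH (γ.x s + r * cis φ + y) (by
      rw [show γ.x s + r * cis φ + y - (γ.x s + y) = r * cis φ by ring, norm_mul, norm_cis, mul_one,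
        Complex.norm_real, Real.norm_eq_abs, abs_of_pos r0]; exact r2)
    rw [show γ.x s + r * cis φ + y - (γ.x s + y) = r * cis φ by ring, im_cis] at h4
    by_contra hc
    rw [not_lt] at hc
    rcases hc.lt_or_eq with hc | hc
    · exact h4.2.1 (mul_neg_of_pos_of_neg r0 hc) (interior_subset h3)
    · exact (h4.2.2 (by rw [hc, mul_zero])).2 h3
  obtain ⟨k, hk⟩ := branch (isPreconnected_Ioo (a := γ.θo s) (b := γ.θi s + π)) continuousOn_id (ω := Θ) (by
    intro φ hφ k hk
    have := hsin φ hφ.1 hφ.2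
    rw [id] at hk
    rw [hk, show Θ + k * (2 * π) - Θ = 0 + k * (2 * π) by ring, Real.sin_add_int_mul_two_pi] at this
    simp at this)
  have hsub : ∀ φ, γ.θo s < φ → φ < γ.θi s + π → Θ + k * (2 * π) < φ ∧ φ < Θ + k * (2 * π) + π := by
    intro φ h1 h2
    obtain ⟨h3, h4⟩ := hk φ ⟨h1, h2⟩
    refine ⟨h3, ?_⟩
    by_contra hc
    rw [not_lt] at hc
    have h5 := hsin φ h1 h2
    have h6 : sin (φ - Θ) = - sin (φ - Θ - k * (2 * π) - π) := by
      rw [Real.sin_sub_pi, Real.sin_sub_int_mul_two_pi]; ring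
    have := Real.sin_nonneg_of_nonneg_of_le_pi (x := φ - Θ - k * (2 * π) - π) (by linarith) (by simp only [id] at h4; linarith)
    linarith
  have b1 : Θ + k * (2 * π) ≤ γ.θo s := by
    by_contra hc
    rw [not_le] at hc
    obtain ⟨φ, h1, h2⟩ := exists_between (lt_min hc (by linarith : γ.θo s < γ.θi s + π))
    have := (hsub φ h1 (h2.trans_le (min_le_right _ _))).1
    linarith [min_le_left (Θ + k * (2 * π)) (γ.θi s + π)]
  have b2 : γ.θi s ≤ Θ + k * (2 * π) := by
    by_contra hc
    rw [not_le] at hc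
    obtain ⟨φ, h1, h2⟩ := exists_between (max_lt (by linarith : γ.θo s < γ.θi s + π)
      (by linarith : Θ + k * (2 * π) + π < γ.θi s + π))
    have := (hsub φ ((le_max_left _ _).trans_lt h1) h2).2
    linarith [le_max_right (γ.θo s) (Θ + k * (2 * π) + π)]
  refine ⟨-k, ?_⟩
  have := Loop.Lev.shift (γ := γ) (s := s) (Θ := Θ + k * (2 * π)) ⟨b2, b1⟩ (-k)
  convert this using 1
  push_cast; ring

lemma contact {δ K L γ ζ} (S : Sys δ K L γ ζ) {z : ℂ} {Θ : ℝ} (h : HP (K + L) z Θ) :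
    ∃ s t, γ.x s + ζ.x t = z ∧ γ.Lev s Θ ∧ ζ.Lev t Θ := by
  obtain ⟨x, hx, y, hy, e⟩ := frontier_add S.P.compact S.Q.compact h.frontier
  have hxK := S.P.compact.isClosed.frontier_subset hx
  have hyL := S.Q.compact.isClosed.frontier_subset hy
  rw [S.P.boundary] at hx
  rw [S.Q.boundary] at hy
  obtain ⟨s, rfl⟩ := hx
  obtain ⟨t, rfl⟩ := hy
  simp only at e
  subst e
  obtain ⟨k, hk⟩ := contact_lev S.P S.hδ0 S.hδ S.aK hyL h
  obtain ⟨l, hl⟩ := contact_lev S.Q S.hδ0 S.hδ S.aL hxK (by rw [add_comm K L, add_comm (γ.x s)] at h; exact h)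
  exact ⟨_, _, by rw [Loop.per_int γ.xper, Loop.per_int ζ.xper], hk, hl⟩

lemma lev_free {γ : Loop 1} {s Θ ω : ℝ} (hl : γ.Lev s Θ) (hf : Free (range γ.x) (γ.x s) ω)
    (h1 : Θ - π < ω) (h2 : ω < Θ) (τ : ℝ) (t1 : s < τ) (t2 : τ < s + γ.n) :
    ω < γ.H s τ ∧ γ.H s τ < ω + 2 * π := by
  obtain ⟨k, h3, h4, h5⟩ := γ.free_bd hf
  have hp := Real.pi_pos
  have k1 : (k : ℝ) < 1 := by
    have := hl.1; by_contra hc; rw [not_lt] at hc; nlinarith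
  have k2 : (-1 : ℝ) < k := by
    have := hl.2; by_contra hc; rw [not_lt] at hc; nlinarith
  have k3 : k < 1 := by exact_mod_cast k1
  have k4 : -1 < k := by exact_mod_cast k2
  obtain rfl : k = 0 := by omega
  simpa using h3 τ t1 t2

lemma one_side {γ : Loop 1} {s Θ ω s' Θ' ω' : ℝ} (hl : γ.Lev s Θ) (hf : Free (range γ.x) (γ.x s) ω)
    (h1 : Θ - π < ω) (h2 : ω < Θ) (hl' : γ.Lev s' Θ') (hf' : Free (range γ.x) (γ.x s') ω')
    (h1' : Θ' - π < ω') (h2' : ω' < Θ') (hs : s' ≤ s) (hω : ω < ω' + π) :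
    γ.x s' = γ.x s ∨ (s' < s ∧ s < s' + γ.n ∧ (∀ τ, s' < τ → τ < s' + γ.n → ω' < γ.H s' τ ∧ γ.H s' τ < ω' + 2 * π) ∧
      ω - π < γ.H s' s ∧ γ.H s' s < ω + π) := by
  have hn := γ.npos
  have hp := Real.pi_pos
  obtain ⟨a, ⟨a1, a2⟩, -⟩ := existsUnique_add_zsmul_mem_Ioc hn s' (s - γ.n)
  rw [zsmul_eq_mul] at a1 a2
  rw [sub_add_cancel] at a2
  rcases a2.lt_or_eq with a2 | a2
  swap
  · left; rw [← a2, Loop.per_int γ.xper]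
  right
  have a0 : (-1 : ℝ) < a := by by_contra hc; rw [not_lt] at hc; nlinarith
  have hf2 : Free (range γ.x) (γ.x (s' + a * γ.n)) (ω' + a * (2 * π)) := by
    rw [Loop.per_int γ.xper]; exact hf'.int a
  have b1 := lev_free (hl'.shift a) hf2 (by linarith) (by linarith) s a2 (by linarith)
  have b2 := lev_free hl hf h1 h2 (s' + a * γ.n + γ.n) (by linarith) (by linarith)
  rw [γ.flip _ _ a2 (by linarith)] at b2
  have a3 : (a : ℝ) < 1 := by by_contra hc; rw [not_lt] at hc; nlinarith
  have a4 : a < 1 := by exact_mod_cast a3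
  have a5 : -1 < a := by exact_mod_cast a0
  obtain rfl : a = 0 := by omega
  simp only [Int.cast_zero, zero_mul, add_zero] at *
  exact ⟨a2, by linarith, fun τ t1 t2 => lev_free hl' hf' h1' h2' τ t1 t2, by linarith, by linarith⟩
end MS
end

section
open Filter
set_option linter.all false
namespace MS

lemma im_dir {w : ℂ} {u E : ℝ} (h : Dir w u) : ∃ r > 0, (w * cis (-E)).im = r * sin (u - E) := by
  obtain ⟨r, hr, rfl⟩ := h
  exact ⟨r, hr, im_cis r u E⟩

lemma slide {γ : Loop 1} {N : Set ℂ} {z z' y0 : ℂ} {s s' ω ω' E G : ℝ} (hs : s' < s) (hs2 : s < s' + γ.n)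
    (hN : ∀ τ, γ.x τ + y0 ∈ N) (hz' : γ.x s' + y0 = z')
    (hu : ∀ τ, s' < τ → τ < s' + γ.n → ω' < γ.H s' τ ∧ γ.H s' τ < ω' + 2 * π)
    (hf : Free N z ω) (hE : Dir (z' - z) E) (E1 : ω < E) (E2 : E < ω + 2 * π)
    (E3 : ω' < E + π) (E4 : E + π < ω' + 2 * π) (h1 : E - π < γ.H s' s) (h2 : γ.H s' s < E)
    (hG : Dir (γ.x s + y0 - z) G) (G1 : E + π < G) (G2 : G < E + 2 * π) (G3 : G < ω + 2 * π) : False := by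
  have hp := Real.pi_pos
  set c : ℝ → ℂ := fun τ => γ.x τ + y0 with hc
  have hcc : Continuous c := γ.xcont.add continuous_const
  have hcu : ∀ τ, s' < τ → τ < s' + γ.n → Dir (c τ - z') (γ.H s' τ) := by
    intro τ t1 t2
    rw [← hz']
    have := γ.Hdir s' τ t1 t2
    convert this using 1
    simp only [hc]; ring
  set I : ℝ → ℝ := fun τ => ((c τ - z) * cis (-E)).im with hI
  have hIc : Continuous I := by
    have : Continuous (fun τ => (c τ - z) * cis (-E)) := (hcc.sub continuous_const).mul continuous_const
    exact Complex.continuous_im.comp this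
  have hz0 : ((z' - z) * cis (-E)).im = 0 := by
    obtain ⟨r, -, e⟩ := im_dir (E := E) hE
    rw [e]; simp
  have hI' : ∀ τ, I τ = ((c τ - z') * cis (-E)).im := by
    intro τ
    have : (c τ - z) * cis (-E) = (c τ - z') * cis (-E) + (z' - z) * cis (-E) := by ring
    simp only [hI]
    rw [this, Complex.add_im, hz0, add_zero]
  have hIs' : I s' = 0 := by
    rw [hI']; simp only [hc]; rw [hz']; simp
  have hIs : I s < 0 := by
    rw [hI']
    obtain ⟨r, hr, e⟩ := im_dir (E := E) (hcu s hs hs2)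
    rw [e]
    exact mul_neg_of_pos_of_neg hr (sin_neg_of (by linarith) (by linarith))
  obtain ⟨σ, ⟨⟨⟨σ1, σ2⟩, σ3⟩, σ4⟩⟩ : ∃ σ, IsGreatest (Icc s' s ∩ {τ | 0 ≤ I τ}) σ := by
    apply (isCompact_Icc.inter_right (isClosed_le continuous_const hIc)).exists_isGreatest
    exact ⟨s', ⟨le_rfl, hs.le⟩, hIs'.ge⟩
  have σ3' : 0 ≤ I σ := σ3
  have σs : σ < s := lt_of_le_of_ne σ2 (by rintro rfl; linarith)
  have hneg : ∀ τ, σ < τ → τ ≤ s → I τ < 0 := by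
    intro τ t1 t2
    by_contra hc
    have := σ4 ⟨⟨by linarith, t2⟩, not_lt.1 hc⟩
    linarith
  have hmemσ : Ioc σ s ∈ nhdsWithin σ (Ioi σ) := Ioc_mem_nhdsGT σs
  have hIσ : I σ = 0 := by
    refine le_antisymm ?_ σ3'
    refine le_of_tendsto (hIc.continuousAt.continuousWithinAt (s := Ioi σ)) ?_
    filter_upwards [hmemσ] with τ hτ
    exact (hneg τ hτ.1 hτ.2).le
  -- angle from z
  set v : ℝ → ℝ := fun τ => ((c τ - z) * cis (-(ω + π))).arg + (ω + π) with hv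
  have hsl : ∀ τ, c τ ≠ z → (c τ - z) * cis (-(ω + π)) ∈ Complex.slitPlane := by
    intro τ hτ
    rw [Complex.mem_slitPlane_iff_arg]
    have hne : (c τ - z) * cis (-(ω + π)) ≠ 0 := mul_ne_zero (sub_ne_zero.2 hτ) (cis_ne _)
    refine ⟨?_, hne⟩
    intro h
    obtain ⟨r, hr, e⟩ := dir_arg hne
    rw [h] at e
    apply hf r hr
    have : z + r * cis ω = c τ := by
      have e2 : (c τ - z) * cis (-(ω + π)) * cis (ω + π) = r * cis π * cis (ω + π) := by rw [e]
      rw [mul_assoc, ← cis_add, neg_add_cancel, cis_zero, mul_one, mul_assoc, ← cis_add,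
        show π + (ω + π) = ω + 2 * π by ring, cis_two_pi] at e2
      rw [← e2]; ring
    rw [this]; exact hN τ
  have hvd : ∀ τ, c τ ≠ z → Dir (c τ - z) (v τ) ∧ ω < v τ ∧ v τ < ω + 2 * π := by
    intro τ hτ
    have h1 := hsl τ hτ
    refine ⟨?_, ?_, ?_⟩
    · have := (dir_arg (Complex.slitPlane_ne_zero h1)).mul (dir_cis (ω + π))
      rwa [mul_assoc, ← cis_add, neg_add_cancel, cis_zero, mul_one] at this
    · have := Complex.neg_pi_lt_arg ((c τ - z) * cis (-(ω + π)))
      simp only [hv]; linarith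
    · have := (Complex.mem_slitPlane_iff_arg.1 h1).1
      have := lt_of_le_of_ne (Complex.arg_le_pi _) this
      simp only [hv]; linarith
  have hvc : ∀ τ, c τ ≠ z → ContinuousAt v τ := by
    intro τ hτ
    refine ContinuousAt.add ?_ continuousAt_const
    exact ContinuousAt.comp (g := Complex.arg) (f := fun τ => (c τ - z) * cis (-(ω + π)))
      (Complex.continuousAt_arg (hsl τ hτ)) ((hcc.sub continuous_const).mul continuous_const).continuousAt
  have hne : ∀ τ, σ < τ → τ ≤ s → c τ ≠ z := by
    intro τ t1 t2 e
    have := hneg τ t1 t2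
    simp only [hI, e] at this; simp at this
  -- v on the half open interval
  have hvb : ∀ τ, σ < τ → τ ≤ s → E + π ≤ v τ := by
    obtain ⟨k, hk⟩ := branch (isPreconnected_Ioc (a := σ) (b := s)) (g := v) (ω := E)
      (fun τ hτ => (hvc τ (hne τ hτ.1 hτ.2)).continuousWithinAt) (by
        intro τ hτ k hk
        obtain ⟨r, hr, e⟩ := im_dir (E := E) (hvd τ (hne τ hτ.1 hτ.2)).1
        have := hneg τ hτ.1 hτ.2
        simp only [hI] at this
        rw [e, hk, show E + k * (2 * π) - E = 0 + k * (2 * π) by ring, Real.sin_add_int_mul_two_pi] at this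
        simp at this)
    have e := hvd s (hne s σs le_rfl)
    have e2 : v s = G := dir_unique_of_lt e.1 hG (by linarith) (by linarith)
    have e3 := hk s ⟨σs, le_rfl⟩
    rw [e2] at e3
    have k1 : (k : ℝ) < 1 := by by_contra hc; rw [not_lt] at hc; nlinarith
    have k2 : (-1 : ℝ) < k := by by_contra hc; rw [not_lt] at hc; nlinarith
    have k3 : k < 1 := by exact_mod_cast k1
    have k4 : -1 < k := by exact_mod_cast k2
    obtain rfl : k = 0 := by omega
    intro τ t1 t2
    by_contra hcc
    rw [not_le] at hcc
    have e5 := (hk τ ⟨t1, t2⟩).1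
    simp only [Int.cast_zero, zero_mul, add_zero] at e5
    obtain ⟨r, hr, e⟩ := im_dir (E := E) (hvd τ (hne τ t1 t2)).1
    have e6 := hneg τ t1 t2
    simp only [hI] at e6
    rw [e] at e6
    have := mul_pos hr (sin_pos_of (x := v τ - E) (by linarith) (by linarith))
    linarith
  have hvσ : c σ ≠ z → E + π ≤ v σ := by
    intro h
    refine ge_of_tendsto ((hvc σ h).continuousWithinAt (s := Ioi σ)) ?_
    filter_upwards [hmemσ] with τ hτ
    exact hvb τ hτ.1 hτ.2
  have hun : ∀ τ, σ < τ → τ ≤ s → γ.H s' τ ≤ E := by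
    obtain ⟨k, hk⟩ := branch (isPreconnected_Ioc (a := σ) (b := s)) (g := γ.H s') (ω := E - 2 * π)
      ((γ.H_cont_right s').mono (fun τ hτ => ⟨by linarith [hτ.1], by linarith [hτ.2]⟩)) (by
        intro τ hτ k hk
        obtain ⟨r, hr, e⟩ := im_dir (E := E) (hcu τ (by linarith [hτ.1]) (by linarith [hτ.2]))
        have := hneg τ hτ.1 hτ.2
        rw [hI', e, hk, show E - 2 * π + k * (2 * π) - E = 0 + (k - 1 : ℤ) * (2 * π) by push_cast; ring, Real.sin_add_int_mul_two_pi] at this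
        simp at this)
    have e3 := hk s ⟨σs, le_rfl⟩
    have k1 : (k : ℝ) < 1 := by by_contra hc; rw [not_lt] at hc; nlinarith
    have k3 : k < 1 := by exact_mod_cast k1
    have k5 : (k:ℝ) ≤ 0 := by exact_mod_cast (by omega : k ≤ 0)
    intro τ t1 t2
    have := (hk τ ⟨t1, t2⟩).2
    nlinarith
  have huσ : s' < σ → γ.H s' σ ≤ E := by
    intro h
    have : ContinuousAt (γ.H s') σ := (γ.H_cont_right s').continuousAt (Ioo_mem_nhds h (by linarith))
    refine le_of_tendsto (this.continuousWithinAt (s := Ioi σ)) ?_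
    filter_upwards [hmemσ] with τ hτ
    exact hun τ hτ.1 hτ.2
  have hzz : z' ≠ z := sub_ne_zero.1 hE.ne
  by_cases c1 : c σ = z'
  · have h3 : c σ ≠ z := by rw [c1]; exact hzz
    have h4 := hvd σ h3
    have h5 := hvσ h3
    rw [c1] at h4
    have := dir_unique_of_lt h4.1 hE (by linarith) (by linarith)
    linarith
  have hσ' : s' < σ := lt_of_le_of_ne σ1 (by rintro rfl; exact c1 hz')
  have hdu := hcu σ hσ' (by linarith)
  have hub := hu σ hσ' (by linarith)
  have huE := huσ hσ'
  by_cases c2 : c σ = z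
  · rw [c2] at hdu
    have h3 : Dir (z - z') (E + π) := by have := hE.neg; rwa [neg_sub] at this
    have := dir_unique_of_lt hdu h3 (by linarith) (by linarith)
    linarith
  -- general case
  have hvσ := hvσ c2
  have hvd := hvd σ c2
  obtain ⟨r, hr, e⟩ := im_dir (E := E) hdu
  have hue : γ.H s' σ = E := by
    rw [← hI', hIσ] at e
    have h6 : sin (γ.H s' σ - E) = 0 := by
      rcases mul_eq_zero.1 e.symm with h | h; exact absurd h hr.ne'; exact h
    have := zero_of_sin (x := γ.H s' σ - E) (by linarith) (by linarith) h6
    linarith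
  rw [hue] at hdu
  have h7 : Dir (c σ - z) E := by
    obtain ⟨a, ha, ea⟩ := hdu
    obtain ⟨b, hb, eb⟩ := hE
    refine ⟨a + b, by linarith, ?_⟩
    rw [show c σ - z = (c σ - z') + (z' - z) by ring, ea, eb]; push_cast; ring
  have := dir_unique_of_lt hvd.1 h7 (by linarith) (by linarith)
  linarith

theorem sum_aco {δ K L γ ζ} (S : Sys δ K L γ ζ) {C : CPoly} (hC : C.Bd (K + L)) {ρ : Loop 1} {θ : ℤ → ℝ}
    (hx : ρ.x = C.x) (hn : ρ.n = C.n) (hd : ∀ k, Dir (C.d k) (θ k)) (ho : ∀ s, ρ.θo s = θ ⌊s⌋)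
    (hi : ∀ s, ρ.θi s = θ (⌈s⌉ - 1)) {i j : ℤ} (hij : i < j) (hjn : j < i + C.n) :
    -π + δ ≤ θ j - θ i := by
  have R := S.reg
  have hp := Real.pi_pos
  have key : ∀ k : ℤ, HP (K + L) (C.x (k + 1/2)) (θ k) ∧ ρ.θo (k + 1/2) = θ k ∧ ρ.θi (k + 1/2) = θ k := by
    intro k
    refine ⟨?_, ?_, ?_⟩
    · obtain ⟨θ0, h1, h2⟩ := hC.2 k
      have h3 := h2 (1/2) (by norm_num) (by norm_num)
      obtain ⟨l, hl⟩ := (hd k).unique h1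
      rw [hl, C.x_on (k := k) (by linarith) (by linarith)]
      convert h3.int l using 3
      · congr 1; ring
      · rfl
    · rw [ho]; congr 1; rw [Int.floor_eq_iff]; constructor <;> linarith
    · rw [hi]; congr 1
      have : ⌈(k:ℝ) + 1/2⌉ = k + 1 := by rw [Int.ceil_eq_iff]; push_cast; constructor <;> linarith
      rw [this]; ring
  have fr : ∀ k : ℤ, ∃ ω, Free (K + L) (C.x (k + 1/2)) ω ∧ θ k - π < ω ∧ ω < θ k ∧
      ∀ τ : ℝ, k + 1/2 < τ → τ < k + 1/2 + ρ.n → ω < ρ.H (k + 1/2) τ ∧ ρ.H (k + 1/2) τ < ω + 2 * π := by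
    intro k
    obtain ⟨h1, h2, h3⟩ := key k
    obtain ⟨ω, hω⟩ := R.free (z := C.x (k + 1/2)) h1.frontier.2
    obtain ⟨l, a1, a2, a3⟩ := ρ.free_bd (s := k + 1/2) (ω := ω) (by
      rw [hx]; exact hω.mono (hC.sub.trans R.compact.isClosed.frontier_subset))
    rw [h2] at a2
    rw [h3] at a3
    exact ⟨ω + l * (2 * π), hω.int l, by linarith, by linarith, a1⟩
  obtain ⟨ω, hω, o1, o2, o3⟩ := fr i
  obtain ⟨ω', hω', o1', o2', o3'⟩ := fr j
  obtain ⟨s, t, hst, l1, l2⟩ := contact S (key i).1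
  obtain ⟨s', t', hst', l1', l2'⟩ := contact S (key j).1
  have hij' : (i : ℝ) < j := by exact_mod_cast hij
  have hjn' : (j : ℝ) < i + ρ.n := by rw [hn]; exact_mod_cast hjn
  have hE := ρ.Hdir (i + 1/2) (j + 1/2) (by linarith) (by linarith)
  have E1 := o3 (j + 1/2) (by linarith) (by linarith)
  have E2 := o3' (i + 1/2 + ρ.n) (by linarith) (by linarith)
  rw [ρ.flip _ _ (by linarith) (by linarith), one_mul] at E2
  rw [hx] at hE
  set E := ρ.H (i + 1/2) (j + 1/2) with hEE
  set z := C.x (i + 1/2) with hz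
  set z' := C.x (j + 1/2) with hz'
  by_contra hcon
  rw [not_le] at hcon
  have ss : s' ≤ s := by
    by_contra hc
    rw [not_le] at hc
    have := S.aK s s' hc
    linarith [l1.2, l1'.1]
  have tt : t' ≤ t := by
    by_contra hc
    rw [not_le] at hc
    have := S.aL t t' hc
    linarith [l2.2, l2'.1]
  have mK : ∀ τ, γ.x τ ∈ K := fun τ => S.P.range_sub ⟨τ, rfl⟩
  have mL : ∀ τ, ζ.x τ ∈ L := fun τ => S.Q.range_sub ⟨τ, rfl⟩
  have fK : ∀ {s t z ω}, γ.x s + ζ.x t = z → Free (K + L) z ω → Free (range γ.x) (γ.x s) ω := by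
    rintro s t z ω rfl hf r hr ⟨τ, hτ⟩
    apply hf r hr
    refine ⟨γ.x τ, mK τ, ζ.x t, mL t, ?_⟩
    simp only; rw [hτ]; ring
  have fL : ∀ {s t z ω}, γ.x s + ζ.x t = z → Free (K + L) z ω → Free (range ζ.x) (ζ.x t) ω := by
    rintro s t z ω rfl hf r hr ⟨τ, hτ⟩
    apply hf r hr
    refine ⟨γ.x s, mK s, ζ.x τ, mL τ, ?_⟩
    simp only; rw [hτ]; ring
  have hx1 := one_side l1 (fK hst hω) o1 o2 l1' (fK hst' hω') o1' o2' ss (by linarith)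
  have hy1 := one_side l2 (fL hst hω) o1 o2 l2' (fL hst' hω') o1' o2' tt (by linarith)
  have hE' : Dir (z - z') (E + π) := by have := hE.neg; rwa [neg_sub] at this
  rcases hx1 with ex | ⟨p1, p2, p3, p4, p5⟩
  · rcases hy1 with ey | ⟨q1, q2, q3, q4, q5⟩
    · apply hE.ne; rw [← hst, ← hst', ex, ey, sub_self]
    · have h1 := ζ.Hdir t' t q1 q2
      have h2 : ζ.x t - ζ.x t' = z - z' := by rw [← hst, ← hst', ex]; ring
      rw [h2] at h1
      have := q3 t q1 q2
      have := dir_unique_of_lt h1 hE' (by linarith) (by linarith)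
      linarith
  have hh := γ.Hdir s' s p1 p2
  have hhb := p3 s p1 p2
  rcases hy1 with ey | ⟨q1, q2, q3, q4, q5⟩
  · have h2 : γ.x s - γ.x s' = z - z' := by rw [← hst, ← hst', ey]; ring
    rw [h2] at hh
    have := dir_unique_of_lt hh hE' (by linarith) (by linarith)
    linarith
  have hg := ζ.Hdir t' t q1 q2
  have hgb := q3 t q1 q2
  have hsum : (γ.x s - γ.x s') + (ζ.x t - ζ.x t') = z - z' := by rw [← hst, ← hst']; ring
  have hGx : Dir (γ.x s + ζ.x t' - z) (ζ.H t' t + π) := by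
    have := hg.neg
    rw [← hst]; convert this using 1; ring
  have hGy : Dir (ζ.x t + γ.x s' - z) (γ.H s' s + π) := by
    have := hh.neg
    rw [← hst]; convert this using 1; ring
  -- signs
  obtain ⟨p, hp0, ep⟩ := hh
  obtain ⟨q, hq0, eq⟩ := hg
  obtain ⟨r, hr0, er⟩ := hE
  have e1 : (r : ℂ) * cis E * cis (-E) + p * cis (γ.H s' s) * cis (-E) + q * cis (ζ.H t' t) * cis (-E) = 0 := by
    rw [← er, ← ep, ← eq]
    linear_combination cis (-E) * hsum
  have e2 := congrArg Complex.im e1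
  have e3 : r + p * cos (γ.H s' s - E) + q * cos (ζ.H t' t - E) = 0 := by
    have := congrArg Complex.re e1
    simp only [mul_assoc, ← cis_add, Complex.add_re, Complex.re_ofReal_mul, cis_re, Complex.zero_re, add_neg_cancel, cos_zero, mul_one] at this
    rw [sub_eq_add_neg, sub_eq_add_neg]; exact this
  rw [Complex.add_im, Complex.add_im, im_cis, im_cis, im_cis] at e2
  simp only [sub_self, sin_zero, mul_zero, zero_add, Complex.zero_im] at e2
  have hb1 : -π < γ.H s' s - E := by linarith
  have hb2 : γ.H s' s - E < π := by linarith
  have gb1 : -π < ζ.H t' t - E := by linarith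
  have gb2 : ζ.H t' t - E < π := by linarith
  rcases lt_trichotomy (γ.H s' s - E) 0 with hc | hc | hc
  · have s1 := mul_neg_of_pos_of_neg hp0 (sin_neg_of hb1 hc)
    have s2 : 0 < sin (ζ.H t' t - E) := by
      have : 0 < q * sin (ζ.H t' t - E) := by linarith
      exact (pos_iff_pos_of_mul_pos this).1 hq0
    have s3 := pos_of_sin gb1 gb2 s2
    exact slide (γ := γ) (N := K + L) (y0 := ζ.x t') p1 p2 (fun τ => ⟨_, mK τ, _, mL t', rfl⟩) hst' p3 hω
      ⟨r, hr0, er⟩ E1.1 E1.2 E2.1 E2.2 (by linarith) (by linarith) hGx (by linarith) (by linarith) (by linarith)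
  · rw [hc] at e2 e3
    simp only [sin_zero, mul_zero, zero_add, cos_zero, mul_one] at e2 e3
    have s2 : sin (ζ.H t' t - E) = 0 := by
      rcases mul_eq_zero.1 e2 with h | h; exact absurd h hq0.ne'; exact h
    rw [zero_of_sin gb1 gb2 s2, cos_zero] at e3
    linarith
  · have s1 := mul_pos hp0 (sin_pos_of hc hb2)
    have s2 : sin (ζ.H t' t - E) < 0 := by
      by_contra h
      have := mul_nonneg hq0.le (not_lt.1 h)
      linarith
    have s3 := neg_of_sin gb1 gb2 s2
    exact slide (γ := ζ) (N := K + L) (y0 := γ.x s') q1 q2 (fun τ => ⟨_, mK s', _, mL τ, add_comm _ _⟩)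
      (by rw [add_comm]; exact hst') q3 hω
      ⟨r, hr0, er⟩ E1.1 E1.2 E2.1 E2.2 (by linarith) (by linarith) hGy (by linarith) (by linarith) (by linarith)
end MS
end

section
open Filter
set_option linter.all false
namespace MS

lemma rot_range {f : ℕ → ℝ × ℝ} {θ : ℕ → ℝ} (h : ∀ k, vangle (f k) (f (k + 1)) = θ (k + 1) - θ k) (l : ℕ) :
    ∀ a, rotShifts ((List.range' a (l + 1)).map f) = θ (a + l) - θ a := by
  induction l with
  | zero => intro a; simp [rotShifts]
  | succ l ih =>
    intro a
    have e : (List.range' a (l + 1 + 1)).map f = f a :: f (a + 1) :: (List.range' (a + 1 + 1) l).map f := by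
      simp [List.range'_succ]
    have e2 : (List.range' (a + 1) (l + 1)).map f = f (a + 1) :: (List.range' (a + 1 + 1) l).map f := by
      simp [List.range'_succ]
    rw [e, rotShifts, ← e2, ih, h]
    rw [show a + 1 + l = a + (l + 1) by ring]; ring

lemma sublist_range {t : List ℕ} {m : ℕ} : t <:+: List.range m ↔ ∃ a l, a + l ≤ m ∧ t = List.range' a l := by
  constructor
  · rintro ⟨p, q, h⟩
    rw [List.range_eq_range'] at h
    obtain ⟨k, hk, h1, h2⟩ := List.range'_eq_append_iff.1 h.symm
    obtain ⟨k', hk', h3, h4⟩ := List.range'_eq_append_iff.1 h1.symm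
    exact ⟨_, _, by omega, h4⟩
  · rintro ⟨a, l, h, rfl⟩
    refine ⟨List.range' 0 a, List.range' (a + l) (m - (a + l)), ?_⟩
    rw [List.range_eq_range', eq_comm, List.range'_eq_append_iff]
    refine ⟨a + l, h, ?_, by simp⟩
    rw [eq_comm, List.range'_eq_append_iff]
    exact ⟨a, by omega, by simp, by simp⟩

variable {f : ℕ → ℝ × ℝ} {n : ℕ} 

lemma app_one (hn : 0 < n) (hf : ∀ k, f (k + n) = f k) :
    (List.range n).map f ++ ((List.range n).map f).take 1 = (List.range (n + 1)).map f := by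
  have h0 := hf 0
  rw [zero_add] at h0
  have e : (List.range (n + 1)).map f = (List.range n).map f ++ [f n] := by simp [List.range_succ]
  rw [e, ← List.map_take, List.take_range, show min 1 n = 1 by omega, h0]
  simp

lemma app_self (hf : ∀ k, f (k + n) = f k) :
    (List.range n).map f ++ (List.range n).map f = (List.range (n + n)).map f := by
  rw [List.range_add, List.map_append, List.map_map]
  congr 1
  apply List.map_congr_left
  intro k _
  simp [add_comm n k, hf]

lemma rotClosed_range {θ : ℕ → ℝ} (hn : 0 < n) (hf : ∀ k, f (k + n) = f k)
    (h : ∀ k, vangle (f k) (f (k + 1)) = θ (k + 1) - θ k) :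
    rotClosed ((List.range n).map f) = θ n - θ 0 := by
  rw [rotClosed, app_one hn hf, List.range_eq_range', rot_range h, zero_add]

lemma aco_le {θ : ℕ → ℝ} (hf : ∀ k, f (k + n) = f k)
    (h : ∀ k, vangle (f k) (f (k + 1)) = θ (k + 1) - θ k) {a l : ℕ} (ha : a + (l + 1) ≤ n + n) (hl : l < n) :
    acoClosed ((List.range n).map f) ≤ θ (a + l) - θ a := by
  rw [acoClosed]
  apply csInf_le
  · apply Set.Finite.bddBelow
    apply Set.Finite.image
    refine Set.Finite.subset (List.finite_toSet (((List.range n).map f ++ (List.range n).map f).sublists)) ?_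
    rintro t ⟨-, ht⟩
    exact List.mem_sublists.2 ht.sublist
  · refine ⟨(List.range' a (l + 1)).map f, ⟨?_, ?_⟩, rot_range h l a⟩
    · simp; omega
    · rw [app_self hf, List.infix_map_iff]
      exact ⟨_, sublist_range.2 ⟨a, l + 1, ha, rfl⟩, rfl⟩

lemma le_aco {θ : ℕ → ℝ} (hf : ∀ k, f (k + n) = f k)
    (h : ∀ k, vangle (f k) (f (k + 1)) = θ (k + 1) - θ k) {M : ℝ} (hM : M ≤ 0)
    (hb : ∀ a l, l < n → M ≤ θ (a + l) - θ a) : M ≤ acoClosed ((List.range n).map f) := by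
  rw [acoClosed]
  apply le_csInf
  · exact ⟨_, [], ⟨by simp, ⟨[], _, rfl⟩⟩, rfl⟩
  · rintro _ ⟨t, ⟨h1, h2⟩, rfl⟩
    rw [app_self hf, List.infix_map_iff] at h2
    obtain ⟨t', h3, rfl⟩ := h2
    obtain ⟨a, l, h4, rfl⟩ := sublist_range.1 h3
    cases l with
    | zero => simpa [rotShifts] using hM
    | succ l =>
      rw [rot_range h]
      simp at h1
      exact hb a l (by omega)
end MS
end

section
open Filter
set_option linter.all false
namespace MS

/-- The identification of the complex plane with the real plane. -/
def ec : ℂ ≃L[ℝ] ℝ × ℝ := Complex.equivRealProdCLM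

lemma ec_apply (z : ℂ) : ec z = (z.re, z.im) := rfl

lemma vangle_ec (z w : ℂ) : vangle (ec z) (ec w) = (w / z).arg := by
  rw [vangle, ec_apply, ec_apply]
  simp [Complex.re_add_im]

def Rep (P : Polyline) (C : CPoly) : Prop :=
  P.shifts = (List.range C.n).map (fun i : ℕ => ec (C.d i)) ∧ P.start = ec (C.V 0)

namespace Rep
variable {P : Polyline} {C : CPoly}

lemma len (h : Rep P C) : P.shifts.length = C.n := by rw [h.1]; simp

lemma fper (h : Rep P C) (k : ℕ) : (fun i : ℕ => ec (C.d i)) (k + C.n) = (fun i : ℕ => ec (C.d i)) k := by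
  simp only [Nat.cast_add, C.d_per]

lemma vert (h : Rep P C) {i : ℕ} (hi : i ≤ C.n) : P.vert i = ec (C.V i) := by
  induction i with
  | zero => rw [Polyline.vert, h.2]; simp
  | succ i ih =>
    have hl : i < P.shifts.length := by rw [h.len]; omega
    have := ih (by omega)
    rw [Polyline.vert] at this ⊢
    rw [List.sum_take_succ _ _ hl, ← add_assoc, this]
    have : P.shifts[i] = ec (C.d i) := by simp [h.1]
    rw [this, ← map_add, CPoly.d]
    congr 1; push_cast; ring

lemma param (h : Rep P C) {t : ℝ} (h0 : 0 ≤ t) (h1 : t ≤ C.n) : P.param t = ec (C.x t) := by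
  have hf : (⌊t⌋.toNat : ℤ) = ⌊t⌋ := Int.toNat_of_nonneg (Int.floor_nonneg.2 h0)
  have hle : ⌊t⌋.toNat ≤ C.n := by
    zify; rw [hf]; exact_mod_cast (Int.floor_le t).trans h1
  rw [Polyline.param, h.vert hle, hf, CPoly.x, map_add]
  congr 1
  rw [← Complex.real_smul, map_smul]
  rcases h1.lt_or_eq with h1 | h1
  · have hlt : ⌊t⌋.toNat < C.n := by
      zify; rw [hf]; exact_mod_cast (Int.floor_le t).trans_lt h1
    congr 1
    simp [h.1, hlt, hf]
  · rw [h1]; simp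

lemma trace (h : Rep P C) : P.trace = ec '' range C.x := by
  rw [Polyline.trace, h.len]
  ext z; constructor
  · rintro ⟨t, ht, rfl⟩
    exact ⟨_, ⟨t, rfl⟩, (h.param ht.1 ht.2).symm⟩
  · rintro ⟨w, hw, rfl⟩
    obtain ⟨i, a, hi, h0, h1, rfl⟩ := CPoly.exists_rep hw
    have hi' : (i : ℝ) + 1 ≤ C.n := by exact_mod_cast hi
    have hi0 : (0:ℝ) ≤ i := by positivity
    refine ⟨i + a, ⟨by linarith, by linarith⟩, ?_⟩
    rw [h.param (by linarith) (by linarith), C.x_on (k := i) (by push_cast; linarith) (by push_cast; linarith)]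
    simp

lemma proper (h : Rep P C) : P.Proper := by
  constructor
  · intro h0; have := h.len; rw [h0] at this; simp at this; have := C.npos; omega
  · intro v hv
    rw [h.1, List.mem_map] at hv
    obtain ⟨i, -, rfl⟩ := hv
    have := C.dne i
    rw [← CPoly.d] at this
    simpa using this

lemma nonRev (h : Rep P C) : NonReverse (P.shifts ++ P.shifts.take 1) := by
  rw [h.1, app_one C.npos h.fper]
  show List.IsChain _ _
  rw [List.isChain_map, List.isChain_range_succ]
  rintro k hk ⟨a, ha, hb⟩
  have hb : C.d ((k + 1 : ℕ) : ℤ) = a • C.d k := by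
    apply ec.injective; rw [map_smul]; exact hb
  have := C.slit k
  have e : C.V (k + 1 + 1) - C.V (k + 1) = a • C.d k := by rw [← hb, CPoly.d]; push_cast; rfl
  have hne : C.d k ≠ 0 := C.dne k
  rw [e, ← CPoly.d, Complex.real_smul, mul_div_cancel_right₀ _ hne, Complex.ofReal_mem_slitPlane] at this
  linarith

lemma simpleClosed (h : Rep P C) : P.SimpleClosed := by
  constructor
  · have := h.vert le_rfl
    have e : C.V C.n = C.V 0 := by simpa using C.per 0
    rw [e, ← h.2, Polyline.vert, ← h.len, List.take_length] at this
    simpa [Polyline.Closed] using this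
  · rintro s ⟨h0, h1⟩ t ⟨h2, h3⟩ e
    rw [h.len] at h1 h3
    rw [h.param h0 h1.le, h.param h2 h3.le] at e
    exact C.x_inj0 h0 h1 h2 h3 (ec.injective e)

lemma vang (h : Rep P C) {θ : ℤ → ℝ} (hθ : ∀ k, θ (k + 1) - θ k = (C.d (k + 1) / C.d k).arg) (k : ℕ) :
    vangle ((fun i : ℕ => ec (C.d i)) k) ((fun i : ℕ => ec (C.d i)) (k + 1)) =
      (fun i : ℕ => θ i) (k + 1) - (fun i : ℕ => θ i) k := by
  simp only [vangle_ec]; push_cast; rw [hθ]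

lemma rotC (h : Rep P C) {θ : ℤ → ℝ} (hθ : ∀ k, θ (k + 1) - θ k = (C.d (k + 1) / C.d k).arg) :
    rotClosed P.shifts = θ C.n - θ 0 := by
  rw [h.1, rotClosed_range (θ := fun i : ℕ => θ i) C.npos h.fper (h.vang hθ)]; rfl

end Rep
end MS
end

section
open Filter
set_option linter.all false
namespace MS

lemma slit_of_opp {z w : ℂ} (hz : z ≠ 0) (hw : w ≠ 0) (h : ¬ Opp (ec z) (ec w)) : w / z ∈ Complex.slitPlane := by
  by_contra hc
  rw [Complex.mem_slitPlane_iff, not_or, not_lt, not_not] at hc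
  have e : w / z = ((w / z).re : ℂ) := by
    apply Complex.ext <;> simp [hc.2]
  have e2 : w = (w / z).re • z := by
    rw [Complex.real_smul, ← e, div_mul_cancel₀ _ hz]
  apply h
  refine ⟨(w / z).re, lt_of_le_of_ne hc.1 ?_, ?_⟩
  · intro h0; rw [h0] at e2; simp at e2; exact hw e2
  · rw [← map_smul, ← e2]

lemma exists_rep {P : Polyline} (hp : P.Proper) (hn : NonReverse (P.shifts ++ P.shifts.take 1))
    (hs : P.SimpleClosed) : ∃ C : CPoly, Rep P C := by
  obtain ⟨n, hnn⟩ : ∃ n, P.shifts.length = n := ⟨_, rfl⟩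
  have npos : 0 < n := by rw [← hnn]; exact List.length_pos_of_ne_nil hp.1
  have npos' : (0:ℤ) < n := by exact_mod_cast npos
  obtain ⟨g, hg⟩ : ∃ g : ℕ → ℝ × ℝ, g = fun i => P.shifts.getD (i % n) 0 := ⟨_, rfl⟩
  have gper : ∀ k, g (k + n) = g k := by intro k; simp [hg]
  have gmod : ∀ k, g (k % n) = g k := by intro k; simp [hg]
  have glt : ∀ k, k < n → g k = P.shifts.getD k 0 := by
    intro k hk; simp [hg, Nat.mod_eq_of_lt hk]
  have gs : P.shifts = (List.range n).map g := by
    apply List.ext_getElem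
    · simp [hnn]
    · intro i h1 h2
      have : i < n := by omega
      simp [glt i this, h1]
  have gne : ∀ k, g k ≠ 0 := by
    intro k; rw [← gmod]
    apply hp.2
    rw [gs, List.mem_map]
    exact ⟨_, List.mem_range.2 (Nat.mod_lt _ npos), rfl⟩
  have gopp0 : ∀ k, k < n → ¬ Opp (g k) (g (k + 1)) := by
    rw [gs, app_one npos gper] at hn
    have hn : List.IsChain (fun v w => ¬ Opp v w) ((List.range (n + 1)).map g) := hn
    rw [List.isChain_map, List.isChain_range_succ] at hn
    exact hn
  have vn : P.vert n = P.vert 0 := by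
    have := hs.1
    rw [Polyline.Closed] at this
    simp [Polyline.vert, ← hnn, this]
  have vs : ∀ k, k < n → P.vert (k + 1) = P.vert k + g k := by
    intro k hk
    have hl : k < P.shifts.length := by omega
    rw [Polyline.vert, Polyline.vert, List.sum_take_succ _ _ hl, ← add_assoc, glt k hk]
    simp [hl]
  obtain ⟨r, hr⟩ : ∃ r : ℤ → ℕ, r = fun k => (k % (n:ℤ)).toNat := ⟨_, rfl⟩
  have rc : ∀ k, (r k : ℤ) = k % n := by
    intro k; rw [hr]; exact Int.toNat_of_nonneg (Int.emod_nonneg _ npos'.ne')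
  have rlt : ∀ k, r k < n := by
    intro k; zify; rw [rc]; exact Int.emod_lt_of_pos _ npos'
  have rsucc : ∀ k, r (k + 1) = (r k + 1) % n := by
    intro k; zify; rw [rc, rc, Int.emod_add_emod]
  have rper : ∀ k, r (k + n) = r k := by
    intro k; zify; rw [rc, rc, Int.add_emod_right]
  have rid : ∀ k : ℕ, k < n → r k = k := by
    intro k hk; zify; rw [rc]; exact_mod_cast Nat.mod_eq_of_lt hk
  have vr : ∀ k, P.vert (r (k + 1)) = P.vert (r k) + g (r k) := by
    intro k
    rw [← vs _ (rlt k), rsucc]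
    have := rlt k
    rcases (by omega : r k + 1 < n ∨ r k + 1 = n) with h | h
    · rw [Nat.mod_eq_of_lt h]
    · rw [h, Nat.mod_self, vn]
  have gsucc : ∀ k, g (r (k + 1)) = g (r k + 1) := by intro k; rw [rsucc, gmod]
  obtain ⟨V, hV⟩ : ∃ V : ℤ → ℂ, V = fun k => ec.symm (P.vert (r k)) := ⟨_, rfl⟩
  have hd : ∀ k, V (k + 1) - V k = ec.symm (g (r k)) := by
    intro k; simp only [hV]; rw [← map_sub, vr, add_sub_cancel_left]
  have hdne : ∀ k, ec.symm (g (r k)) ≠ 0 := by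
    intro k; simpa using gne (r k)
  have hpar : ∀ i : ℤ, 0 ≤ i → i < n → ∀ s : ℝ, 0 ≤ s → s < 1 →
      V i + s * (V (i + 1) - V i) = ec.symm (P.param (i + s)) := by
    intro i h0 h1 s h2 h3
    obtain ⟨k, rfl⟩ := Int.eq_ofNat_of_zero_le h0
    have hk : k < n := by exact_mod_cast h1
    have hf : ⌊((k:ℤ):ℝ) + s⌋ = k := Int.floor_eq_iff.2 ⟨by linarith, by linarith⟩
    rw [hd, Polyline.param, Int.fract, hf, map_add, map_smul, Complex.real_smul, rid k hk, glt k hk]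
    simp [hV, rid k hk]
  refine ⟨⟨n, npos, V, ?_, ?_, ?_, ?_⟩, ?_, ?_⟩
  · intro k; simp only [hV, rper]
  · intro k; rw [hd]; exact hdne k
  · intro k; rw [hd, hd]
    apply slit_of_opp (hdne k) (hdne _)
    simp only [ContinuousLinearEquiv.apply_symm_apply]
    rw [gsucc]; exact gopp0 _ (rlt k)
  · intro i j h1 h2 h3 h4 s t h5 h6 h7 h8 he
    rw [hpar i h1 h2 s h5 h6, hpar j h3 h4 t h7 h8] at he
    have he := ec.symm.injective he
    have i0 : (0:ℝ) ≤ i := by exact_mod_cast h1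
    have j0 : (0:ℝ) ≤ j := by exact_mod_cast h3
    have i1 : (i:ℝ) + 1 ≤ n := by exact_mod_cast h2
    have j1 : (j:ℝ) + 1 ≤ n := by exact_mod_cast h4
    have inj := hs.2
    have := @inj (i + s) ⟨by linarith, by rw [hnn]; linarith⟩
      (j + t) ⟨by linarith, by rw [hnn]; linarith⟩ he
    have e1 : ⌊(i:ℝ) + s⌋ = i := Int.floor_eq_iff.2 ⟨by linarith, by linarith⟩
    have e2 : ⌊(j:ℝ) + t⌋ = j := Int.floor_eq_iff.2 ⟨by linarith, by linarith⟩
    have e3 : i = j := by rw [← e1, ← e2, this]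
    subst e3
    exact ⟨rfl, by linarith⟩
  · refine gs.trans ?_
    apply List.map_congr_left
    intro i hi
    rw [List.mem_range] at hi
    simp only [CPoly.d, hd, rid i hi, ContinuousLinearEquiv.apply_symm_apply]
  · have : r 0 = 0 := by simpa using rid 0 npos
    simp [hV, this, Polyline.vert]

/-- A simple polygon yields a loop of winding one. -/
lemma polygon_data {K : Set (ℝ × ℝ)} {P : Polyline} (hK : IsSimplePolygon K P) {δ : ℝ}
    (hδ : -π + δ ≤ acoClosed P.shifts) :
    ∃ (C : CPoly) (γ : Loop 1), PolyC (ec.symm '' K) γ ∧ γ.Aco δ ∧ γ.x = C.x ∧ acoClosed P.shifts ≤ 0 := by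
  obtain ⟨C, hC⟩ := exists_rep hK.proper hK.nonReverse hK.simpleClosed
  have hp := Real.pi_pos
  obtain ⟨γ, θ, h1, h2, h3, h4, h5, h6⟩ : ∃ (γ : Loop 1) (θ : ℤ → ℝ), γ.x = C.x ∧ γ.n = C.n ∧
    (∀ k, Dir (C.d k) (θ k)) ∧ (∀ k, θ (k + 1) - θ k = (C.d (k + 1) / C.d k).arg) ∧
    (∀ s, γ.θo s = θ ⌊s⌋) ∧ (∀ s, γ.θi s = θ (⌈s⌉ - 1)) := by
    obtain ⟨m, γ, θ, h1, h2, h3, h4, h5, h6⟩ := C.loop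
    have hc : 2 * (m : ℝ) + 1 = 1 := by
      have e1 := hC.rotC h4
      rw [hK.orient] at e1
      have e2 := γ.θo_per 0
      rw [h5, h5, h2, zero_add, Int.floor_natCast, Int.floor_zero] at e2
      have : (2 * (m:ℝ) + 1) * (2 * π) = 1 * (2 * π) := by linarith
      exact mul_right_cancel₀ (by positivity) this
    generalize 2 * (m : ℝ) + 1 = c at γ h1 h2 h5 h6 hc
    subst hc
    exact ⟨γ, θ, h1, h2, h3, h4, h5, h6⟩
  have hn' : (0:ℤ) < C.n := by exact_mod_cast C.npos
  have θper : ∀ i q : ℤ, θ (i + q * C.n) = θ i + q * (2 * π) := by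
    intro i q
    have := γ.θo_per_int i q
    rw [h5, h5, h2, Int.floor_intCast, show (i:ℝ) + q * C.n = ((i + q * C.n : ℤ) : ℝ) by push_cast; ring,
      Int.floor_intCast] at this
    rw [this]; ring
  have hle : ∀ a l : ℕ, a < C.n → l < C.n → acoClosed P.shifts ≤ θ (a + l) - θ a := by
    intro a l ha hl
    rw [hC.1]
    have := aco_le (θ := fun i : ℕ => θ i) hC.fper (hC.vang h4) (a := a) (l := l) (by omega) hl
    simpa using this
  refine ⟨C, γ, ⟨?_, ?_, ?_⟩, ?_, h1, ?_⟩
  · exact hK.compact.image ec.symm.continuous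
  · have e := ec.symm.toHomeomorph.image_closure (interior K)
    have e2 := ec.symm.toHomeomorph.image_interior K
    have e : ec.symm '' closure (interior K) = closure (ec.symm '' (interior K)) := e
    have e2 : ec.symm '' interior K = interior (ec.symm '' K) := e2
    rw [← e2, ← e, ← hK.regular]
  · have e := ec.symm.toHomeomorph.image_frontier K
    have e : ec.symm '' frontier K = frontier (ec.symm '' K) := e
    rw [← e, hK.boundary, hC.trace, h1, image_image]
    simp
  · intro s s' hs
    rw [h6, h5]
    have hij : ⌊s⌋ ≤ ⌈s'⌉ - 1 := by
      have : ⌊s⌋ < ⌈s'⌉ := Int.floor_lt_ceil_of_lt hs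
      omega
    generalize ⌊s⌋ = i at hij ⊢
    generalize ⌈s'⌉ - 1 = j at hij ⊢
    have a1 := Int.emod_nonneg i hn'.ne'
    have a2 := Int.emod_lt_of_pos i hn'
    have b1 := Int.emod_nonneg (j - i) hn'.ne'
    have b2 := Int.emod_lt_of_pos (j - i) hn'
    have a3 := Int.emod_add_mul_ediv i C.n
    have b3 := Int.emod_add_mul_ediv (j - i) C.n
    have q0 : 0 ≤ (j - i) / C.n := Int.ediv_nonneg (by omega) hn'.le
    generalize i % C.n = a at *
    generalize (j - i) % C.n = l at *
    generalize i / C.n = p at *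
    generalize (j - i) / C.n = q at *
    obtain ⟨a, rfl⟩ := Int.eq_ofNat_of_zero_le a1
    obtain ⟨l, rfl⟩ := Int.eq_ofNat_of_zero_le b1
    have ei : i = (a:ℤ) + p * C.n := by rw [← a3]; ring
    have ej : j = ((a:ℤ) + l) + (p + q) * C.n := by
      have : j = i + ((l:ℤ) + C.n * q) := by omega
      rw [this, ei]; ring
    rw [ei, ej, θper, θper]
    have := hle a l (by exact_mod_cast a2) (by exact_mod_cast b2)
    have hq : (0:ℝ) ≤ q := by exact_mod_cast q0
    push_cast
    nlinarith [mul_nonneg hq hp.le]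
  · simpa using hle 0 0 C.npos C.npos

theorem main {K L : Set (ℝ × ℝ)} {P Q : Polyline}
    (hK : IsSimplePolygon K P) (hL : IsSimplePolygon L Q)
    (hacoK : -π < acoClosed P.shifts) (hacoL : -π < acoClosed Q.shifts) :
    ∃ R : Polyline, IsSimplePolygon (K + L) R ∧
      min (acoClosed P.shifts) (acoClosed Q.shifts) ≤ acoClosed R.shifts := by
  have hp := Real.pi_pos
  obtain ⟨M, hM⟩ : ∃ M, M = min (acoClosed P.shifts) (acoClosed Q.shifts) := ⟨_, rfl⟩
  have M1 : M ≤ acoClosed P.shifts := hM ▸ min_le_left _ _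
  have M2 : M ≤ acoClosed Q.shifts := hM ▸ min_le_right _ _
  have M3 : -π < M := hM ▸ lt_min hacoK hacoL
  rw [← hM]
  obtain ⟨CK, γ, PK, aK, xK, hK0⟩ := polygon_data hK (δ := M + π) (by linarith)
  obtain ⟨CL, ζ, PL, aL, xL, hL0⟩ := polygon_data hL (δ := M + π) (by linarith)
  have S : Sys (M + π) (ec.symm '' K) (ec.symm '' L) γ ζ :=
    ⟨by linarith, by linarith, PK, PL, aK, aL⟩
  have R := S.reg
  have hls := onLines_sum (C := CK) (D := CL) PK.compact PL.compact (by rw [PK.boundary, xK]) (by rw [PL.boundary, xL])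
  obtain ⟨C, hB1, hB2⟩ := R.walk hls
  have hB : C.Bd (ec.symm '' K + ec.symm '' L) := ⟨hB1, hB2⟩
  have hsum : ec '' (ec.symm '' K + ec.symm '' L) = K + L := by
    rw [Set.image_add, image_image, image_image]; simp
  have hfr := CPoly.Bd.trace R hB
  obtain ⟨ρ, θ, h1, h2, h3, h4, h5, h6⟩ := CPoly.Bd.rot R hB
  have hR : Rep ⟨ec (C.V 0), (List.range C.n).map (fun i : ℕ => ec (C.d i))⟩ C := ⟨rfl, rfl⟩
  refine ⟨⟨ec (C.V 0), (List.range C.n).map (fun i : ℕ => ec (C.d i))⟩, ⟨hK.compact.add hL.compact, ?_, hR.proper,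
    hR.nonRev, hR.simpleClosed, ?_, ?_⟩, ?_⟩
  · have e := ec.toHomeomorph.image_closure (interior (ec.symm '' K + ec.symm '' L))
    have e2 := ec.toHomeomorph.image_interior (ec.symm '' K + ec.symm '' L)
    have e : ec '' closure (interior (ec.symm '' K + ec.symm '' L)) =
      closure (ec '' (interior (ec.symm '' K + ec.symm '' L))) := e
    have e2 : ec '' interior (ec.symm '' K + ec.symm '' L) = interior (ec '' (ec.symm '' K + ec.symm '' L)) := e2
    rw [← hsum, ← e2, ← e, ← R.regular]
  · have e := ec.toHomeomorph.image_frontier (ec.symm '' K + ec.symm '' L)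
    have e : ec '' frontier (ec.symm '' K + ec.symm '' L) = frontier (ec '' (ec.symm '' K + ec.symm '' L)) := e
    rw [hR.trace, ← hsum, ← e, hfr]
  · rw [hR.rotC h4]
    have := ρ.θo_per 0
    rw [h5, h5, h2, zero_add, Int.floor_natCast, Int.floor_zero] at this
    rw [this]; ring
  · refine le_aco (θ := fun i : ℕ => θ i) hR.fper (hR.vang h4) (by linarith) ?_
    intro a l hl
    rcases Nat.eq_zero_or_pos l with rfl | hl0
    · simp; linarith
    · have := sum_aco S hB h1 h2 h3 h5 h6 (i := a) (j := a + l) (by omega) (by omega)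
      push_cast; linarith
end MS
end

/-- **Theorem 1 (main).** If `K` and `L` are simple polygons with
`aco K > -π` and `aco L > -π`, then the Minkowski sum `K + L` is a simple
polygon and `aco (K + L) ≥ min (aco K) (aco L)`. -/
theorem minkowski_sum_simple_polygon (K L : Set (ℝ × ℝ)) (P Q : Polyline)
    (hK : IsSimplePolygon K P) (hL : IsSimplePolygon L Q)
    (hacoK : -π < acoClosed P.shifts) (hacoL : -π < acoClosed Q.shifts) :
    ∃ R : Polyline, IsSimplePolygon (K + L) R ∧
      min (acoClosed P.shifts) (acoClosed Q.shifts) ≤ acoClosed R.shifts := by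
  exact MS.main hK hL hacoK hacoL
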